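/- arXiv:1602.08242 — 3 statements merged into one kernel-verified Lean document; each statement's English description precedes it below -/
import Mathlib

section
/- Let G be a countable discrete infinite amenable group acting continuously on a compact metric space (X,d), let {F_n} be a tempered Følner sequence in G satisfying lim_{n→∞} |F_n|/log n = ∞, and let μ be an ergodic G-invariant Borel probability measure on X. Then h_μ(X,G) ≤ h^B_top(G_μ,{F_n}), where G_μ = {x ∈ X : (1/|F_n|) Σ_{g∈F_n} f(gx) → ∫_X f dμ for every continuous f : X → ℝ}. -/
open MeasureTheory Filter Set
open scoped Pointwise ENNReal NNReal Topology

section Defs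

variable {G : Type*} [Group G] [DecidableEq G] {X : Type*}

/-- A Følner sequence: a sequence of nonempty finite subsets of `G` that is asymptotically
invariant: `|Fₙ △ gFₙ|/|Fₙ| → 0` for every `g ∈ G`. -/
def IsFolnerSeq (F : ℕ → Finset G) : Prop :=
  (∀ n, (F n).Nonempty) ∧
    ∀ g : G, Tendsto (fun n => ((symmDiff (F n) ((F n).image (g * ·))).card : ℝ) / (F n).card)
      atTop (𝓝 0)

/-- A sequence of finite subsets is tempered if `|⋃_{k<n} Fₖ⁻¹ Fₙ| ≤ C |Fₙ|` for a constant `C`. -/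
def IsTemperedSeq (F : ℕ → Finset G) : Prop :=
  ∃ C : ℝ, ∀ n : ℕ, (((Finset.range n).biUnion fun k => (F k)⁻¹ * F n).card : ℝ) ≤ C * (F n).card

/-- The growth condition `|Fₙ|/log n → ∞`. -/
def GrowthCond (F : ℕ → Finset G) : Prop :=
  Tendsto (fun n => ((F n).card : ℝ) / Real.log n) atTop atTop

variable [MetricSpace X] [MulAction G X]

/-- The Bowen ball `B_F(x,ε) = {y : d(gx, gy) < ε for all g ∈ F}`. -/
def bowenBall (F : Finset G) (x : X) (ε : ℝ) : Set X :=
  {y | ∀ g ∈ F, dist (g • x) (g • y) < ε}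

/-- `M(Z,N,ε,s,{Fₙ})`: infimum of `Σᵢ exp(-s |F_{nᵢ}|)` over countable families of Bowen balls
`B_{F_{nᵢ}}(xᵢ,ε)` with `nᵢ ≥ N` covering `Z`. -/
noncomputable def bowenMpre (F : ℕ → Finset G) (Z : Set X) (N : ℕ) (ε s : ℝ) : ℝ≥0∞ :=
  ⨅ (C : Set (X × ℕ)) (_ : C.Countable ∧ (∀ p ∈ C, N ≤ p.2) ∧
      Z ⊆ ⋃ p ∈ C, bowenBall (F p.2) p.1 ε),
    ∑' p : C, ENNReal.ofReal (Real.exp (-s * ((F (p : X × ℕ).2).card : ℝ)))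

/-- `M(Z,s,{Fₙ}) = lim_{ε→0} lim_{N→∞} M(Z,N,ε,s,{Fₙ})`; since the quantity is monotone
(nondecreasing as `N` increases and as `ε` decreases), the limits are suprema. -/
noncomputable def bowenMeasure (F : ℕ → Finset G) (Z : Set X) (s : ℝ) : ℝ≥0∞ :=
  ⨆ (ε : ℝ) (_ : 0 < ε), ⨆ N : ℕ, bowenMpre F Z N ε s

/-- The Bowen topological entropy of `Z` along `{Fₙ}`: the critical value of `s` at which
`M(Z,s,{Fₙ})` jumps from `+∞` to `0`. -/
noncomputable def bowenEntropy (F : ℕ → Finset G) (Z : Set X) : ℝ≥0∞ :=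
  ⨆ (s : ℝ) (_ : bowenMeasure F Z s = ⊤), ENNReal.ofReal s

/-- The minimal cardinality of a subcover of `⋁_{g ∈ F} g⁻¹ U` for a cover `U`. -/
noncomputable def coverNumber (U : Finset (Set X)) (F : Finset G) : ℕ :=
  sInf {k : ℕ | ∃ f : Fin k → G → Set X, (∀ i, ∀ g ∈ F, f i g ∈ U) ∧
    (univ : Set X) ⊆ ⋃ i, ⋂ g ∈ F, (fun x => g • x) ⁻¹' f i g}

/-- The topological entropy of the `G`-action on `X` (computed along `{Fₙ}`; it is independent
of the Følner sequence). -/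
noncomputable def topEntropy (X : Type*) [MetricSpace X] {G : Type*} [Group G] [MulAction G X]
    (F : ℕ → Finset G) : ℝ≥0∞ :=
  ⨆ (U : Finset (Set X)) (_ : (∀ V ∈ U, IsOpen V) ∧ ⋃₀ (U : Set (Set X)) = univ),
    limsup (fun n => ENNReal.ofReal (Real.log (coverNumber U (F n)) / (F n).card)) atTop

end Defs

section MeasDefs

variable {G : Type*} [Group G] [DecidableEq G] {X : Type*} [MeasurableSpace X] [MulAction G X]

/-- The Shannon entropy `H_μ(⋁_{g∈F} g⁻¹ P)` of the join over `F` of the finite measurable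
partition `P` given by the fibers of `α`. -/
noncomputable def partitionEntropy (μ : Measure X) {ι : Type*} [Fintype ι] (α : X → ι)
    (F : Finset G) : ℝ :=
  ∑ f : ↥F → ι, Real.negMulLog ((μ {x | ∀ g : ↥F, α ((g : G) • x) = f g}).toReal)

/-- The entropy `h_μ(G,P) = lim_n H_μ(P^{Fₙ})/|Fₙ|` of the partition given by the fibers
of `α` (the limit existing, it is the `limsup`). -/
noncomputable def partitionDynEntropy (F : ℕ → Finset G) (μ : Measure X) {ι : Type*} [Fintype ι]
    (α : X → ι) : ℝ :=
  limsup (fun n => partitionEntropy μ α (F n) / (F n).card) atTop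

/-- The measure-theoretic entropy `h_μ(X,G)`: the supremum over finite measurable partitions
(encoded as measurable maps `X → Fin k`) of `lim_n H_μ(P^{Fₙ})/|Fₙ|`. -/
noncomputable def measEntropy (F : ℕ → Finset G) (μ : Measure X) : ℝ≥0∞ :=
  ⨆ (k : ℕ) (α : X → Fin k) (_ : Measurable α),
    limsup (fun n => ENNReal.ofReal (partitionEntropy μ α (F n) / (F n).card)) atTop

/-- `μ` is `G`-invariant. -/
def InvariantMeasure (G : Type*) [Group G] [MulAction G X] (μ : Measure X) : Prop :=
  ∀ g : G, Measure.map (fun x => g • x) μ = μ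

/-- `μ` is ergodic: every Borel set `A` with `μ(A △ g⁻¹A) = 0` for all `g` is trivial. -/
def ErgodicMeasure (G : Type*) [Group G] [MulAction G X] (μ : Measure X) : Prop :=
  ∀ A : Set X, MeasurableSet A →
    (∀ g : G, μ (symmDiff A ((fun x => g • x) ⁻¹' A)) = 0) → μ A = 0 ∨ μ A = 1

end MeasDefs

section LocalDefs

variable {G : Type*} [Group G] [DecidableEq G] {X : Type*} [MetricSpace X] [MulAction G X]
  [MeasurableSpace X]

/-- The set of generic points of `μ` with respect to `{Fₙ}`. -/
def genericPointSet (F : ℕ → Finset G) (μ : Measure X) : Set X :=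
  {x | ∀ f : C(X, ℝ),
    Tendsto (fun n => (∑ g ∈ F n, f (g • x)) / (F n).card) atTop (𝓝 (∫ y, f y ∂μ))}

/-- The lower local entropy of `μ` at `x` along `{Fₙ}`:
`lim_{δ→0} liminf_n -(1/|Fₙ|) log μ(B_{Fₙ}(x,δ))` (the limit in `δ` being a supremum
by monotonicity). -/
noncomputable def localLowerEntropy (F : ℕ → Finset G) (μ : Measure X) (x : X) : ℝ≥0∞ :=
  ⨆ (δ : ℝ) (_ : 0 < δ),
    liminf (fun n =>
      ENNReal.ofReal (-(Real.log ((μ (bowenBall (F n) x δ)).toReal)) / (F n).card)) atTop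

end LocalDefs

section PartComb

/-- greedy selection of almost disjoint sets -/
lemma exists_greedy {ι G : Type*} [DecidableEq ι] [DecidableEq G] (T : ι → Finset G) (φ : G → ℝ)
    (hφ : ∀ g, 0 ≤ φ g) (δ : ℝ) (hδ1 : δ ≤ 1) (E : Finset ι) :
    ∃ S ⊆ E, (1 - δ) * ∑ a ∈ S, ∑ g ∈ T a, φ g ≤ ∑ g ∈ S.biUnion T, φ g ∧
      ∀ b ∈ E, δ * ∑ g ∈ T b, φ g ≤ ∑ g ∈ T b ∩ S.biUnion T, φ g := by
  induction E using Finset.induction_on with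
  | empty => exact ⟨∅, by simp, by simp, by simp⟩
  | insert a E ha ih =>
    obtain ⟨S, hSE, h1, h2⟩ := ih
    by_cases h : δ * ∑ g ∈ T a, φ g ≤ ∑ g ∈ T a ∩ S.biUnion T, φ g
    · refine ⟨S, hSE.trans (Finset.subset_insert _ _), h1, ?_⟩
      intro b hb
      rcases Finset.mem_insert.1 hb with rfl | hb
      · exact h
      · exact h2 b hb
    · push Not at h
      have haS : a ∉ S := fun h' => ha (hSE h')
      refine ⟨insert a S, Finset.insert_subset_insert _ hSE, ?_, ?_⟩
      · rw [Finset.sum_insert haS, Finset.biUnion_insert]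
        have := Finset.sum_union_inter (s₁ := T a) (s₂ := S.biUnion T) (f := φ)
        linarith
      · intro b hb
        rw [Finset.biUnion_insert]
        rcases Finset.mem_insert.1 hb with rfl | hb
        · rw [Finset.inter_eq_left.2 Finset.subset_union_left]
          have : 0 ≤ ∑ g ∈ T b, φ g := Finset.sum_nonneg fun g _ => hφ g
          nlinarith
        · refine (h2 b hb).trans (Finset.sum_le_sum_of_subset_of_nonneg ?_ fun g _ _ => hφ g)
          exact Finset.inter_subset_inter_left Finset.subset_union_right

section
variable {G : Type*} [Group G] [DecidableEq G]

/-- right translate of a finite set -/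
def rtr (F : Finset G) (c : G) : Finset G := F.image (· * c)

lemma mem_rtr {F : Finset G} {c g : G} : g ∈ rtr F c ↔ ∃ h ∈ F, h * c = g := by
  rw [rtr, Finset.mem_image]

lemma card_rtr (F : Finset G) (c : G) : (rtr F c).card = F.card :=
  Finset.card_image_of_injective _ (mul_left_injective c)

/-- double counting for translates of a single set -/
lemma level_count (F : Finset G) (E U : Finset G) (φ : G → ℝ) (hφ : ∀ g, 0 ≤ φ g) :
    ∑ b ∈ E, ∑ g ∈ rtr F b ∩ U, φ g ≤ F.card * ∑ g ∈ U, φ g := by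
  have : ∀ b ∈ E, ∑ g ∈ rtr F b ∩ U, φ g = ∑ g ∈ U, if g ∈ rtr F b then φ g else 0 := by
    intro b _
    rw [Finset.inter_comm, Finset.sum_ite_mem]
  rw [Finset.sum_congr rfl this, Finset.sum_comm, Finset.mul_sum]
  refine Finset.sum_le_sum fun g _ => ?_
  rw [← Finset.sum_filter, Finset.sum_const, nsmul_eq_mul]
  refine mul_le_mul_of_nonneg_right ?_ (hφ g)
  norm_cast
  refine Finset.card_le_card_of_injOn (fun b => g * b⁻¹) ?_ ?_
  · intro b hb
    simp only [Finset.coe_filter, mem_ofPred_eq, mem_rtr] at hb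
    obtain ⟨_, h, hh, rfl⟩ := hb
    simpa using hh
  · intro b _ b' _ h
    simpa using h

lemma tempered_cover (F : ℕ → Finset G) (C : ℝ) (hC0 : 0 ≤ C)
    (hC : ∀ n : ℕ, (((Finset.range n).biUnion fun k => (F k)⁻¹ * F n).card : ℝ) ≤ C * (F n).card)
    (hne : ∀ n, (F n).Nonempty)
    (φ : G → ℝ) (hφ : ∀ g, 0 ≤ φ g) (l δ : ℝ) (hl : 0 < l) (hδ0 : 0 < δ) (hδ1 : δ < 1)
    (n : G → ℕ) (K : ℕ) : ∀ (E : Finset G), (∀ a ∈ E, n a < K) →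
    (∀ a ∈ E, l * (F (n a)).card ≤ ∑ g ∈ rtr (F (n a)) a, φ g) →
    ∃ S ⊆ E, (1 - δ) * ∑ a ∈ S, ∑ g ∈ rtr (F (n a)) a, φ g
        ≤ ∑ g ∈ S.biUnion (fun a => rtr (F (n a)) a), φ g ∧
      l * E.card ≤ (1 / δ + C / (1 - δ)) * ∑ g ∈ S.biUnion (fun a => rtr (F (n a)) a), φ g := by
  induction K with
  | zero =>
    intro E hE _
    have : E = ∅ := Finset.eq_empty_of_forall_notMem fun a ha => by simpa using hE a ha
    subst this
    exact ⟨∅, by simp, by simp, by simp⟩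
  | succ K ih =>
    intro E hE hmass
    have h1δ : 0 < 1 - δ := by linarith
    set EK := E.filter fun a => n a = K with hEK
    obtain ⟨SK, hSKE, hS1, hS2⟩ := exists_greedy (fun a => rtr (F K) a) φ hφ δ hδ1.le EK
    set UK := SK.biUnion fun a => rtr (F K) a with hUK
    set E' := E.filter fun b => n b < K ∧ Disjoint (rtr (F (n b)) b) UK with hE'
    obtain ⟨S', hS'E, hS'1, hS'2⟩ := ih E' (fun a ha => (Finset.mem_filter.1 ha).2.1)
      (fun a ha => hmass a (Finset.mem_filter.1 ha).1)
    set U' := S'.biUnion fun a => rtr (F (n a)) a with hU'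
    have hSKn : ∀ a ∈ SK, n a = K := fun a ha => (Finset.mem_filter.1 (hSKE ha)).2
    have hUKeq : SK.biUnion (fun a => rtr (F (n a)) a) = UK :=
      Finset.biUnion_congr rfl fun a ha => by rw [hSKn a ha]
    have hdisjU : Disjoint U' UK := by
      rw [hU', Finset.disjoint_biUnion_left]
      intro a ha
      exact (Finset.mem_filter.1 (hS'E ha)).2.2
    have hdisjS : Disjoint S' SK := by
      rw [Finset.disjoint_left]
      intro a ha ha'
      have h1 := (Finset.mem_filter.1 (hS'E ha)).2.1
      have h2 := hSKn a ha'
      omega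
    have hsum : ∑ g ∈ (S' ∪ SK).biUnion (fun a => rtr (F (n a)) a), φ g
        = ∑ g ∈ U', φ g + ∑ g ∈ UK, φ g := by
      rw [Finset.union_biUnion, hUKeq, Finset.sum_union hdisjU]
    refine ⟨S' ∪ SK, ?_, ?_, ?_⟩
    · exact Finset.union_subset (hS'E.trans (Finset.filter_subset _ _))
        (hSKE.trans (Finset.filter_subset _ _))
    · rw [hsum, Finset.sum_union hdisjS]
      have : ∑ a ∈ SK, ∑ g ∈ rtr (F (n a)) a, φ g = ∑ a ∈ SK, ∑ g ∈ rtr (F K) a, φ g :=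
        Finset.sum_congr rfl fun a ha => by rw [hSKn a ha]
      rw [this]
      linarith
    · rw [hsum]
      set killed := SK.biUnion fun a => rtr ((Finset.range K).biUnion fun k => (F k)⁻¹ * F K) a
      have hsub : E ⊆ EK ∪ (E' ∪ killed) := by
        intro b hb
        have hb1 := hE b hb
        by_cases hbK : n b = K
        · exact Finset.mem_union_left _ (Finset.mem_filter.2 ⟨hb, hbK⟩)
        refine Finset.mem_union_right _ ?_
        by_cases hd : Disjoint (rtr (F (n b)) b) UK
        · exact Finset.mem_union_left _ (Finset.mem_filter.2 ⟨hb, by omega, hd⟩)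
        refine Finset.mem_union_right _ ?_
        rw [Finset.not_disjoint_iff] at hd
        obtain ⟨g, hg, hg'⟩ := hd
        obtain ⟨h, hh, rfl⟩ := mem_rtr.1 hg
        obtain ⟨a, ha, hga⟩ := Finset.mem_biUnion.1 hg'
        obtain ⟨h', hh', he⟩ := mem_rtr.1 hga
        refine Finset.mem_biUnion.2 ⟨a, ha, mem_rtr.2 ⟨h⁻¹ * h', ?_, ?_⟩⟩
        · refine Finset.mem_biUnion.2 ⟨n b, Finset.mem_range.2 (by omega), ?_⟩
          exact Finset.mul_mem_mul (Finset.inv_mem_inv hh) hh'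
        · rw [mul_assoc, he]; group
      have hcard : (E.card : ℝ) ≤ EK.card + (E'.card + killed.card) := by
        have h1 := Finset.card_le_card hsub
        have h2 := Finset.card_union_le EK (E' ∪ killed)
        have h3 := Finset.card_union_le E' killed
        exact_mod_cast h1.trans (h2.trans (by omega))
      have hFpos : (0 : ℝ) < (F K).card := by exact_mod_cast (hne K).card_pos
      -- level K
      have hA : l * EK.card ≤ 1 / δ * ∑ g ∈ UK, φ g := by
        have h1 := level_count (F K) EK UK φ hφ
        have h2 : ∑ b ∈ EK, δ * (l * (F K).card) ≤ ∑ b ∈ EK, ∑ g ∈ rtr (F K) b ∩ UK, φ g := by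
          refine Finset.sum_le_sum fun b hb => ?_
          refine le_trans ?_ (hS2 b hb)
          have h3 := hmass b (Finset.mem_filter.1 hb).1
          rw [(Finset.mem_filter.1 hb).2] at h3
          exact mul_le_mul_of_nonneg_left h3 hδ0.le
        rw [Finset.sum_const, nsmul_eq_mul] at h2
        have h3 : (F K).card * (δ * (l * EK.card)) ≤ (F K).card * ∑ g ∈ UK, φ g := by
          linarith
        have h4 := le_of_mul_le_mul_left h3 hFpos
        rw [one_div, ← div_eq_inv_mul, le_div_iff₀ hδ0]
        linarith
      have hB : l * killed.card ≤ C / (1 - δ) * ∑ g ∈ UK, φ g := by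
        have h1 : (killed.card : ℝ) ≤ ∑ a ∈ SK, C * (F K).card := by
          have : killed.card ≤ ∑ a ∈ SK,
              (rtr ((Finset.range K).biUnion fun k => (F k)⁻¹ * F K) a).card :=
            Finset.card_biUnion_le
          refine (Nat.cast_le.2 this).trans ?_
          push_cast
          refine Finset.sum_le_sum fun a _ => ?_
          rw [card_rtr]; exact hC K
        have h2 : ∑ a ∈ SK, l * (C * (F K).card) ≤ ∑ a ∈ SK, C * ∑ g ∈ rtr (F K) a, φ g := by
          refine Finset.sum_le_sum fun a ha => ?_
          have h3 := hmass a (Finset.mem_filter.1 (hSKE ha)).1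
          rw [hSKn a ha] at h3
          have := mul_le_mul_of_nonneg_left h3 hC0
          linarith
        rw [← Finset.mul_sum SK (fun _ => C * ((F K).card : ℝ)) l,
          ← Finset.mul_sum SK (fun a => ∑ g ∈ rtr (F K) a, φ g) C] at h2
        have h3 : l * killed.card ≤ C * ∑ a ∈ SK, ∑ g ∈ rtr (F K) a, φ g :=
          (mul_le_mul_of_nonneg_left h1 hl.le).trans h2
        have h4 := mul_le_mul_of_nonneg_left hS1 hC0
        rw [div_mul_eq_mul_div, le_div_iff₀ h1δ]
        nlinarith
      calc l * E.card ≤ l * (EK.card + (E'.card + killed.card)) :=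
            mul_le_mul_of_nonneg_left hcard hl.le
        _ ≤ _ := by linarith
end

end PartComb

section PartTile

section
variable {G : Type*} [Group G] [DecidableEq G]

lemma folner_defect (F : ℕ → Finset G) (hFol : IsFolnerSeq F) (P : Finset G) (η : ℝ) (hη : 0 < η) :
    ∀ᶠ n in atTop, ∑ g ∈ P, ((symmDiff (F n) ((F n).image (g * ·))).card : ℝ) ≤ η * (F n).card := by
  have h : Tendsto (fun n => ∑ g ∈ P,
      ((symmDiff (F n) ((F n).image (g * ·))).card : ℝ) / (F n).card) atTop (𝓝 0) := by
    have := tendsto_finsetSum (f := fun (g : G) n =>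
      ((symmDiff (F n) ((F n).image (g * ·))).card : ℝ) / (F n).card) (x := atTop)
      (a := fun _ => 0) P (fun g _ => hFol.2 g)
    simpa using this
  filter_upwards [h.eventually (gt_mem_nhds hη)] with n hn
  have hpos : (0 : ℝ) < (F n).card := by exact_mod_cast (hFol.1 n).card_pos
  rw [← Finset.sum_div, div_lt_iff₀ hpos] at hn
  exact hn.le

/-- `P⁻¹ F \ F` is small -/
lemma outer_boundary (F : ℕ → Finset G) (hFol : IsFolnerSeq F) (P : Finset G) (η : ℝ)
    (hη : 0 < η) :
    ∀ᶠ n in atTop, (((P * F n) \ F n).card : ℝ) ≤ η * (F n).card := by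
  filter_upwards [folner_defect F hFol P η hη] with n hn
  refine le_trans ?_ hn
  have : (P * F n) \ F n ⊆ P.biUnion fun g => symmDiff (F n) ((F n).image (g * ·)) := by
    intro x hx
    rw [Finset.mem_sdiff, Finset.mem_mul] at hx
    obtain ⟨⟨p, hp, f, hf, rfl⟩, hx⟩ := hx
    refine Finset.mem_biUnion.2 ⟨p, hp, ?_⟩
    rw [Finset.mem_symmDiff]
    exact Or.inr ⟨Finset.mem_image_of_mem _ hf, hx⟩
  exact_mod_cast (Finset.card_le_card this).trans Finset.card_biUnion_le

lemma inner_boundary (F : ℕ → Finset G) (hFol : IsFolnerSeq F) (P : Finset G) (η : ℝ)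
    (hη : 0 < η) :
    ∀ᶠ n in atTop, (((F n).filter fun c => ∃ g ∈ P, g * c ∉ F n).card : ℝ) ≤ η * (F n).card := by
  filter_upwards [folner_defect F hFol P⁻¹ η hη] with n hn
  refine le_trans ?_ hn
  have : ((F n).filter fun c => ∃ g ∈ P, g * c ∉ F n) ⊆
      P⁻¹.biUnion fun g => symmDiff (F n) ((F n).image (g * ·)) := by
    intro x hx
    rw [Finset.mem_filter] at hx
    obtain ⟨hx, g, hg, hgx⟩ := hx
    refine Finset.mem_biUnion.2 ⟨g⁻¹, Finset.inv_mem_inv hg, ?_⟩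
    rw [Finset.mem_symmDiff]
    refine Or.inl ⟨hx, fun h => ?_⟩
    obtain ⟨y, hy, rfl⟩ := Finset.mem_image.1 h
    simp at hgx
    exact hgx hy
  exact_mod_cast (Finset.card_le_card this).trans Finset.card_biUnion_le

/-- the tile of a (center,label) pair -/
def tile {L : Type*} (F : ℕ → Finset G) (ν : L → ℕ) (p : G × L) : Finset G := rtr (F (ν p.2)) p.1

lemma multi_tiling {L : Type*} [DecidableEq L] [Nonempty L] (F : ℕ → Finset G) (C : ℝ) (hC0 : 0 ≤ C)
    (hC : ∀ n : ℕ, (((Finset.range n).biUnion fun k => (F k)⁻¹ * F n).card : ℝ) ≤ C * (F n).card)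
    (hne : ∀ n, (F n).Nonempty) (δ η : ℝ) (hδ0 : 0 < δ) (hδ1 : δ ≤ 1 / 2) (hη : 0 < η)
    (ν : L → ℕ) (J : ℕ) (Λ : ℕ → Finset L)
    (hΛ : ∀ i j, i < j → j < J → ∀ l ∈ Λ j,
      (((((Λ i).biUnion fun l => F (ν l))⁻¹ * F (ν l)) \ F (ν l)).card : ℝ) ≤ η * (F (ν l)).card)
    (B D : Finset G) (Q : G → L → Prop) (hDB : D ⊆ B) (hDcard : ((B \ D).card : ℝ) ≤ η * B.card)
    (hD : ∀ c ∈ D, ∀ i < J, ∃ l ∈ Λ i, Q c l ∧ rtr (F (ν l)) c ⊆ B) (γ : ℝ)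
    (hγ : γ = 1 / δ + C / (1 - δ)) :
    ∀ t ≤ J, ∃ S : Finset (G × L),
      (∀ p ∈ S, p.1 ∈ D ∧ Q p.1 p.2 ∧ tile F ν p ⊆ B ∧ ∃ j, J - t ≤ j ∧ j < J ∧ p.2 ∈ Λ j) ∧
      (1 - δ) * ∑ p ∈ S, ((F (ν p.2)).card : ℝ) ≤ (S.biUnion (tile F ν)).card ∧
      ((B \ S.biUnion (tile F ν)).card : ℝ) ≤ ((1 - 1 / γ) ^ t + 3 * η) * B.card := by
  have hγ1 : 1 ≤ γ := by
    have h1 : 1 ≤ 1 / δ := by rw [le_div_iff₀ hδ0]; linarith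
    have h2 : 0 ≤ C / (1 - δ) := div_nonneg hC0 (by linarith)
    linarith
  intro t
  induction t with
  | zero =>
    intro _
    refine ⟨∅, by simp, by simp, ?_⟩
    simp only [Finset.biUnion_empty, Finset.sdiff_empty, pow_zero]
    have : (0 : ℝ) ≤ B.card := by positivity
    nlinarith
  | succ t ih =>
    intro ht
    obtain ⟨S, hS, hS1, hS2⟩ := ih (by omega)
    set U := S.biUnion (tile F ν) with hU
    set j := J - (t + 1) with hj
    have hjJ : j < J := by omega
    have hUB : U ⊆ B := Finset.biUnion_subset.2 fun p hp => (hS p hp).2.2.1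
    have hex : ∀ c : G, ∃ l : L, c ∈ D → l ∈ Λ j ∧ Q c l ∧ rtr (F (ν l)) c ⊆ B := by
      intro c
      by_cases hc : c ∈ D
      · obtain ⟨l, hl⟩ := hD c hc j hjJ
        exact ⟨l, fun _ => hl⟩
      · exact ⟨Classical.arbitrary L, fun h => absurd h hc⟩
    choose lab hlab using hex
    set E := D.filter fun c => Disjoint (rtr (F (ν (lab c))) c) U with hE
    obtain ⟨S', hS'E, h1, h2⟩ := tempered_cover F C hC0 hC hne (fun _ => 1) (by simp) 1 δ
      one_pos hδ0 (by linarith) (fun c => ν (lab c)) (E.sup (fun c => ν (lab c)) + 1) E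
      (fun a ha => Nat.lt_succ_of_le (Finset.le_sup (f := fun c => ν (lab c)) ha))
      (fun a _ => by simp [card_rtr])
    set U' := S'.biUnion fun a => rtr (F (ν (lab a))) a with hU'
    simp only [Finset.sum_const, nsmul_eq_mul, mul_one, one_mul, card_rtr, ← hγ] at h1 h2
    have hdisj : Disjoint U U' := by
      rw [disjoint_comm, hU', Finset.disjoint_biUnion_left]
      intro a ha
      exact (Finset.mem_filter.1 (hS'E ha)).2
    have hU'B : U' ⊆ B := Finset.biUnion_subset.2 fun a ha =>
      (hlab a (Finset.mem_filter.1 (hS'E ha)).1).2.2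
    set S'' := S'.image fun c => (c, lab c) with hS''
    have hbi : (S ∪ S'').biUnion (tile F ν) = U ∪ U' := by
      rw [Finset.union_biUnion, hS'', Finset.image_biUnion]
      rfl
    refine ⟨S ∪ S'', ?_, ?_, ?_⟩
    · intro p hp
      rcases Finset.mem_union.1 hp with hp | hp
      · obtain ⟨a, b, c, i, hi, hi'⟩ := hS p hp
        exact ⟨a, b, c, i, by omega, hi'⟩
      · obtain ⟨c, hc, rfl⟩ := Finset.mem_image.1 hp
        have hcD := (Finset.mem_filter.1 (hS'E hc)).1
        obtain ⟨a, b, d⟩ := hlab c hcD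
        exact ⟨hcD, b, d, j, le_rfl, hjJ, a⟩
    · rw [hbi, Finset.card_union_of_disjoint hdisj]
      have h3 : ∑ p ∈ S ∪ S'', ((F (ν p.2)).card : ℝ) ≤
          ∑ p ∈ S, ((F (ν p.2)).card : ℝ) + ∑ p ∈ S'', ((F (ν p.2)).card : ℝ) := by
        have := Finset.sum_union_inter (s₁ := S) (s₂ := S'') (f := fun p => ((F (ν p.2)).card : ℝ))
        have h4 : 0 ≤ ∑ p ∈ S ∩ S'', ((F (ν p.2)).card : ℝ) :=
          Finset.sum_nonneg fun _ _ => Nat.cast_nonneg _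
        linarith
      have h4 : ∑ p ∈ S'', ((F (ν p.2)).card : ℝ) = ∑ c ∈ S', ((F (ν (lab c))).card : ℝ) := by
        rw [hS'', Finset.sum_image]
        intro a _ b _ h
        exact (Prod.mk.inj h).1
      have h5 : (0 : ℝ) < 1 - δ := by linarith
      push_cast
      nlinarith
    · rw [hbi]
      -- count of E
      set W := S.biUnion fun p =>
        rtr ((((Λ j).biUnion fun l => F (ν l))⁻¹ * F (ν p.2)) \ F (ν p.2)) p.1 with hW
      have hsub : B \ U ⊆ E ∪ ((B \ D) ∪ W) := by
        intro c hc
        rw [Finset.mem_sdiff] at hc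
        by_cases hcD : c ∈ D
        swap
        · exact Finset.mem_union_right _ (Finset.mem_union_left _ (Finset.mem_sdiff.2 ⟨hc.1, hcD⟩))
        by_cases hd : Disjoint (rtr (F (ν (lab c))) c) U
        · exact Finset.mem_union_left _ (Finset.mem_filter.2 ⟨hcD, hd⟩)
        refine Finset.mem_union_right _ (Finset.mem_union_right _ ?_)
        rw [Finset.not_disjoint_iff] at hd
        obtain ⟨g, hg, hg'⟩ := hd
        obtain ⟨h, hh, rfl⟩ := mem_rtr.1 hg
        obtain ⟨p, hp, hgp⟩ := Finset.mem_biUnion.1 hg'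
        obtain ⟨h', hh', he⟩ := mem_rtr.1 hgp
        have hce : h⁻¹ * h' * p.1 = c := by rw [mul_assoc, he]; group
        refine Finset.mem_biUnion.2 ⟨p, hp, mem_rtr.2 ⟨h⁻¹ * h', ?_, hce⟩⟩
        refine Finset.mem_sdiff.2 ⟨Finset.mul_mem_mul (Finset.inv_mem_inv
          (Finset.mem_biUnion.2 ⟨_, (hlab c hcD).1, hh⟩)) hh', fun h3 => hc.2 ?_⟩
        exact Finset.mem_biUnion.2 ⟨p, hp, mem_rtr.2 ⟨_, h3, hce⟩⟩
      have hcard : ((B \ U).card : ℝ) ≤ E.card + ((B \ D).card + W.card) := by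
        have h1 := Finset.card_le_card hsub
        have h2 := Finset.card_union_le E ((B \ D) ∪ W)
        have h3 := Finset.card_union_le (B \ D) W
        exact_mod_cast h1.trans (h2.trans (by omega))
      have hWc : (W.card : ℝ) ≤ η * ∑ p ∈ S, ((F (ν p.2)).card : ℝ) := by
        rw [Finset.mul_sum]
        have : W.card ≤ ∑ p ∈ S, (rtr ((((Λ j).biUnion fun l => F (ν l))⁻¹ * F (ν p.2))
          \ F (ν p.2)) p.1).card := Finset.card_biUnion_le
        refine (Nat.cast_le.2 this).trans ?_
        push_cast
        refine Finset.sum_le_sum fun p hp => ?_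
        rw [card_rtr]
        obtain ⟨_, _, _, i, hi, hi', hpi⟩ := hS p hp
        exact hΛ j i (by omega) hi' _ hpi
      have hUc : (U.card : ℝ) ≤ B.card := by exact_mod_cast Finset.card_le_card hUB
      have hSig : ∑ p ∈ S, ((F (ν p.2)).card : ℝ) ≤ 2 * B.card := by
        have : 0 ≤ ∑ p ∈ S, ((F (ν p.2)).card : ℝ) := Finset.sum_nonneg fun _ _ => Nat.cast_nonneg _
        nlinarith
      have hEc : ((B \ U).card : ℝ) - 3 * η * B.card ≤ E.card := by nlinarith
      have hfin : ((B \ (U ∪ U')).card : ℝ) = (B \ U).card - U'.card := by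
        have : B \ (U ∪ U') = (B \ U) \ U' := by rw [← Finset.sup_eq_union, sdiff_sdiff_left]
        rw [this, Finset.cast_card_sdiff]
        intro x hx
        exact Finset.mem_sdiff.2 ⟨hU'B hx, fun h => Finset.disjoint_left.1 hdisj h hx⟩
      rw [hfin]
      have hγ0 : 0 < γ := by linarith
      have h6 : 1 / γ * (((B \ U).card : ℝ) - 3 * η * B.card) ≤ U'.card := by
        rw [one_div, ← div_eq_inv_mul, div_le_iff₀ hγ0]
        linarith
      have h7 : 0 ≤ 1 - 1 / γ := by
        have : 1 / γ ≤ 1 := by rw [div_le_one hγ0]; exact hγ1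
        linarith
      have h8 := mul_le_mul_of_nonneg_left hS2 h7
      rw [pow_succ]
      linarith
end

end PartTile

section PartErg

set_option linter.unusedSectionVars false
set_option linter.unusedVariables false
section
variable {G : Type*} [Group G] [DecidableEq G] {X : Type*} [MetricSpace X] [CompactSpace X]
  [MulAction G X] [ContinuousConstSMul G X] [MeasurableSpace X] [BorelSpace X]

lemma mpres {μ : Measure X} (hinv : InvariantMeasure G μ) (g : G) :
    MeasurePreserving (fun x : X => g • x) μ μ :=
  ⟨(continuous_const_smul g).measurable, hinv g⟩

/-- the continuous coboundaries -/
def cobSpan (G : Type*) [Group G] (X : Type*) [MetricSpace X] [MulAction G X]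
    [ContinuousConstSMul G X] : Submodule ℝ C(X, ℝ) :=
  Submodule.span ℝ {w | ∃ (φ : C(X, ℝ)) (h : G),
    w = φ.comp ⟨fun x => h • x, continuous_const_smul h⟩ - φ}

lemma cobSpan_avg (F : ℕ → Finset G) (hFol : IsFolnerSeq F) (w : C(X, ℝ)) (hw : w ∈ cobSpan G X)
    (x : X) : Tendsto (fun n => (∑ g ∈ F n, w (g • x)) / (F n).card) atTop (𝓝 0) := by
  induction hw using Submodule.span_induction with
  | mem w hw =>
    obtain ⟨φ, h, rfl⟩ := hw
    have hlim := (hFol.2 h).mul_const ‖φ‖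
    rw [zero_mul] at hlim
    refine squeeze_zero_norm (fun n => ?_) hlim
    have hpos : (0 : ℝ) < (F n).card := by exact_mod_cast (hFol.1 n).card_pos
    rw [norm_div, Real.norm_natCast, div_mul_eq_mul_div]
    refine div_le_div_of_nonneg_right ?_ hpos.le
    have h1 : ∑ g ∈ F n, (φ.comp ⟨fun x => h • x, continuous_const_smul h⟩ - φ) (g • x)
        = ∑ g ∈ (F n).image (h * ·), φ (g • x) - ∑ g ∈ F n, φ (g • x) := by
      rw [Finset.sum_image (fun a _ b _ hab => mul_left_cancel hab), ← Finset.sum_sub_distrib]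
      simp [mul_smul]
    rw [h1]
    set A := F n
    set B := (F n).image (h * ·)
    have h2 : ∑ g ∈ B, φ (g • x) - ∑ g ∈ A, φ (g • x)
        = ∑ g ∈ B \ A, φ (g • x) - ∑ g ∈ A \ B, φ (g • x) := by
      have e1 := Finset.sum_sdiff_sub_sum_sdiff (s₁ := A) (s₂ := B) (f := fun g => φ (g • x))
      linarith
    rw [h2]
    have bd : ∀ T : Finset G, ‖∑ g ∈ T, φ (g • x)‖ ≤ T.card * ‖φ‖ := by
      intro T
      refine (norm_sum_le _ _).trans ?_
      refine (Finset.sum_le_card_nsmul _ _ ‖φ‖ fun g _ => φ.norm_coe_le_norm _).trans ?_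
      rw [nsmul_eq_mul]
    refine (norm_sub_le _ _).trans ((add_le_add (bd _) (bd _)).trans ?_)
    rw [← add_mul]
    refine mul_le_mul_of_nonneg_right ?_ (norm_nonneg _)
    have hd : Disjoint (A \ B) (B \ A) := disjoint_sdiff_sdiff
    have : (symmDiff A B).card = (A \ B).card + (B \ A).card := by
      rw [← Finset.card_union_of_disjoint hd]; rfl
    rw [this]; push_cast; linarith
  | zero => simp
  | add u v _ _ hu hv =>
    have := hu.add hv
    rw [add_zero] at this
    refine this.congr fun n => ?_
    simp [Finset.sum_add_distrib, add_div]
  | smul a u _ hu =>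
    have := hu.const_mul a
    rw [mul_zero] at this
    refine this.congr fun n => ?_
    simp [← Finset.mul_sum, mul_div_assoc]

lemma invariant_const [Countable G] {μ : Measure X} [IsProbabilityMeasure μ]
    (herg : ErgodicMeasure G μ) (ψ : X → ℝ) (hψ : Measurable ψ)
    (hi : ∀ h : G, (fun x => ψ (h • x)) =ᵐ[μ] ψ) : ∃ a, ψ =ᵐ[μ] Function.const X a := by
  refine Filter.exists_eventuallyEq_const_of_forall_separating MeasurableSet ?_
  intro U hU
  have hA : MeasurableSet (ψ ⁻¹' U) := hψ hU
  have hsd : ∀ g : G, μ (symmDiff (ψ ⁻¹' U) ((fun x => g • x) ⁻¹' (ψ ⁻¹' U))) = 0 := by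
    intro h
    rw [measure_symmDiff_eq_zero_iff]
    filter_upwards [hi h] with x hx
    have : (x ∈ ψ ⁻¹' U) = (x ∈ (fun x => h • x) ⁻¹' (ψ ⁻¹' U)) := by
      simp only [Set.mem_preimage, hx]
    exact this
  rcases herg (ψ ⁻¹' U) hA hsd with h | h
  · right
    exact measure_eq_zero_iff_ae_notMem.1 h
  · left
    exact (prob_compl_eq_zero_iff hA).2 h

lemma cob_approx [Countable G] (μ : Measure X) [IsProbabilityMeasure μ]
    (hinv : InvariantMeasure G μ) (herg : ErgodicMeasure G μ) (f : C(X, ℝ)) (ε : ℝ) (hε : 0 < ε) :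
    ∃ w ∈ cobSpan G X, ∫⁻ x, ‖f x - ∫ y, f y ∂μ - w x‖ₑ ∂μ ≤ ENNReal.ofReal ε := by
  set c := ∫ y, f y ∂μ with hc
  set f0 : C(X, ℝ) := f - ContinuousMap.const X c with hf0
  let T := ContinuousMap.toLp (E := ℝ) 2 μ ℝ
  set V : Submodule ℝ (Lp ℝ 2 μ) := (cobSpan G X).map T.toLinearMap with hV
  have key : T f0 ∈ V.topologicalClosure := by
    rw [← Submodule.orthogonal_orthogonal_eq_closure, Submodule.mem_orthogonal]
    intro ψ hψ
    rw [Submodule.mem_orthogonal] at hψ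
    have hinvψ : ∀ h : G, Lp.compMeasurePreserving _ (mpres hinv h) ψ = ψ := by
      intro h
      let U := Lp.compMeasurePreserving (E := ℝ) (p := 2) _ (mpres hinv h)
      have h1 : ∀ φ : C(X, ℝ), inner ℝ (U (T φ)) ψ = inner ℝ (T φ) ψ := by
        intro φ
        have hmem : T (φ.comp ⟨fun x => h • x, continuous_const_smul h⟩ - φ) ∈ V :=
          Submodule.mem_map_of_mem (Submodule.subset_span ⟨φ, h, rfl⟩)
        have h2 := hψ _ hmem
        rw [map_sub, inner_sub_left, sub_eq_zero] at h2
        rw [← h2]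
        congr 1
      have h2 : ∀ ξ : Lp ℝ 2 μ, inner ℝ (U ξ) ψ = inner ℝ ξ ψ := by
        have hd : DenseRange T := ContinuousMap.toLp_denseRange ℝ μ ℝ (by simp)
        have hcU : Continuous U := (Lp.isometry_compMeasurePreserving (mpres hinv h)).continuous
        have := hd.equalizer (g := fun ξ => inner ℝ (U ξ) ψ) (h := fun ξ => inner ℝ ξ ψ)
          (by fun_prop) (by fun_prop) (funext h1)
        exact fun ξ => congrFun this ξ
      have h3 : ‖U ψ‖ = ‖ψ‖ := Lp.norm_compMeasurePreserving ψ (mpres hinv h)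
      have h4 := norm_sub_sq_real (U ψ) ψ
      rw [h2 ψ, h3, real_inner_self_eq_norm_sq] at h4
      have h5 : ‖U ψ - ψ‖ = 0 := by
        have : ‖U ψ - ψ‖ ^ 2 = 0 := by rw [h4]; ring
        exact pow_eq_zero_iff (two_ne_zero) |>.1 this
      exact sub_eq_zero.1 (norm_eq_zero.1 h5)
    obtain ⟨a, ha⟩ := invariant_const (G := G) herg ψ (Lp.stronglyMeasurable ψ).measurable (by
      intro h
      have h1 := Lp.coeFn_compMeasurePreserving ψ (mpres hinv h)
      rw [hinvψ h] at h1
      exact h1.symm)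
    rw [L2.inner_def]
    have h6 : (fun x => inner ℝ (ψ x) (T f0 x)) =ᵐ[μ] fun x => a * (f x - c) := by
      filter_upwards [ha, ContinuousMap.coeFn_toLp (p := 2) (𝕜 := ℝ) μ f0] with x h1 h2
      have h2' : T f0 x = f0 x := h2
      rw [h2', h1]
      simp [hf0, mul_comm]
    rw [integral_congr_ae h6, integral_const_mul, integral_sub
      (f.continuous.integrable_of_hasCompactSupport (HasCompactSupport.of_compactSpace _))
      (integrable_const _)]
    simp [hc]
  rw [← SetLike.mem_coe, Submodule.topologicalClosure_coe, Metric.mem_closure_iff] at key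
  obtain ⟨v, hv, hd⟩ := key ε hε
  obtain ⟨w, hw, rfl⟩ := hv
  refine ⟨w, hw, ?_⟩
  have hd' : ‖T (f0 - w)‖ < ε := by
    rw [map_sub, ← dist_eq_norm]; exact hd
  have h7 : eLpNorm (T (f0 - w)) 2 μ ≤ ENNReal.ofReal ε := by
    rw [Lp.norm_def] at hd'
    exact (ENNReal.le_ofReal_iff_toReal_le (Lp.eLpNorm_ne_top _) hε.le).2 hd'.le
  calc ∫⁻ x, ‖f x - c - w x‖ₑ ∂μ = eLpNorm (f0 - w : C(X, ℝ)) 1 μ := by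
        rw [eLpNorm_one_eq_lintegral_enorm]; rfl
    _ ≤ eLpNorm (f0 - w : C(X, ℝ)) 2 μ :=
        eLpNorm_le_eLpNorm_of_exponent_le (by norm_num) (f0 - w).continuous.aestronglyMeasurable
    _ = eLpNorm (T (f0 - w)) 2 μ :=
        eLpNorm_congr_ae (ContinuousMap.coeFn_toLp (p := 2) (𝕜 := ℝ) μ (f0 - w)).symm
    _ ≤ _ := h7
end

end PartErg

section PartMax

set_option linter.unusedSectionVars false
section
variable {G : Type*} [Group G] [DecidableEq G] {X : Type*} [MetricSpace X] [CompactSpace X]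
  [MulAction G X] [ContinuousConstSMul G X] [MeasurableSpace X] [BorelSpace X]

/-- pointwise (finite) form of the maximal inequality -/
lemma maximal_pointwise (F : ℕ → Finset G) (C : ℝ) (hC0 : 0 ≤ C)
    (hC : ∀ n : ℕ, (((Finset.range n).biUnion fun k => (F k)⁻¹ * F n).card : ℝ) ≤ C * (F n).card)
    (hne : ∀ n, (F n).Nonempty) (u : X → ℝ) (hu : ∀ x, 0 ≤ u x) (l : ℝ) (hl : 0 < l) (K : ℕ)
    (B : Finset G) (x : X) (E : Set X) (hE : ∀ y ∈ E, ∃ n < K, l * (F n).card ≤ ∑ g ∈ F n, u (g • y)) :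
    l * ∑ c ∈ B, E.indicator (fun _ => (1 : ℝ)) (c • x) ≤ (2 + 2 * C) *
      ∑ g ∈ (Finset.range K).biUnion F * B, u (g • x) := by
  classical
  have hex : ∀ c : G, ∃ n, c • x ∈ E → n < K ∧ l * (F n).card ≤ ∑ g ∈ F n, u (g • c • x) := by
    intro c
    by_cases h : c • x ∈ E
    · obtain ⟨n, h1, h2⟩ := hE _ h
      exact ⟨n, fun _ => ⟨h1, h2⟩⟩
    · exact ⟨0, fun h' => absurd h' h⟩
  choose n hn using hex
  obtain ⟨S, hS, _, h2⟩ := tempered_cover F C hC0 hC hne (fun g => u (g • x)) (fun g => hu _) l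
    (1 / 2) hl (by norm_num) (by norm_num) n K (B.filter fun c => c • x ∈ E)
    (fun a ha => (hn a (Finset.mem_filter.1 ha).2).1)
    (fun a ha => by
      have := (hn a (Finset.mem_filter.1 ha).2).2
      rw [rtr, Finset.sum_image (fun _ _ _ _ h => mul_right_cancel h)]
      simpa [mul_smul] using this)
  have h3 : ∑ c ∈ B, E.indicator (fun _ => (1 : ℝ)) (c • x)
      = ((B.filter fun c => c • x ∈ E).card : ℝ) := by
    simp [Set.indicator_apply]
  rw [h3]
  refine h2.trans ?_
  have h4 : (1 / (1 / 2) + C / (1 - 1 / 2) : ℝ) = 2 + 2 * C := by ring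
  rw [h4]
  refine mul_le_mul_of_nonneg_left ?_ (by linarith)
  refine Finset.sum_le_sum_of_subset_of_nonneg ?_ fun g _ _ => hu _
  refine Finset.biUnion_subset.2 fun a ha => ?_
  intro g hg
  obtain ⟨h, hh, rfl⟩ := mem_rtr.1 hg
  have ha' := Finset.mem_filter.1 (hS ha)
  exact Finset.mul_mem_mul (Finset.mem_biUnion.2
    ⟨_, Finset.mem_range.2 (hn a ha'.2).1, hh⟩) ha'.1

lemma maximal_ineq_aux (F : ℕ → Finset G) (hFol : IsFolnerSeq F) (C : ℝ) (hC0 : 0 ≤ C)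
    (hC : ∀ n : ℕ, (((Finset.range n).biUnion fun k => (F k)⁻¹ * F n).card : ℝ) ≤ C * (F n).card)
    (μ : Measure X) [IsProbabilityMeasure μ] (hinv : InvariantMeasure G μ)
    (u : X → ℝ) (hu : ∀ x, 0 ≤ u x) (hum : Measurable u) (l : ℝ) (hl : 0 < l) (K : ℕ) :
    ENNReal.ofReal l * μ {y | ∃ n < K, l * (F n).card ≤ ∑ g ∈ F n, u (g • y)} ≤
      ENNReal.ofReal (4 + 4 * C) * ∫⁻ x, ENNReal.ofReal (u x) ∂μ := by
  set E := {y | ∃ n < K, l * (F n).card ≤ ∑ g ∈ F n, u (g • y)} with hE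
  have hsm : ∀ g : G, Measurable fun x : X => g • x := fun g => (continuous_const_smul g).measurable
  have hEm : MeasurableSet E := by
    have : E = ⋃ n ∈ Finset.range K, {y | l * (F n).card ≤ ∑ g ∈ F n, u (g • y)} := by
      ext y; simp [hE]
    rw [this]
    refine Finset.measurableSet_biUnion _ fun n _ => measurableSet_le measurable_const ?_
    exact Finset.measurable_sum _ fun g _ => hum.comp (hsm g)
  obtain ⟨m, hm⟩ := (outer_boundary F hFol ((Finset.range K).biUnion F) 1 one_pos).exists
  set P := (Finset.range K).biUnion F
  have hcard : ((P * F m).card : ℝ) ≤ 2 * (F m).card := by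
    have h1 := Finset.card_le_card (Finset.subset_union_left (s₁ := P * F m) (s₂ := F m))
    rw [← Finset.sdiff_union_self_eq_union] at h1
    have h2 := h1.trans (Finset.card_union_le _ _)
    have h3 : ((P * F m).card : ℝ) ≤ ((P * F m) \ F m).card + (F m).card := by exact_mod_cast h2
    linarith
  have hpt : ∀ x, ENNReal.ofReal l * ∑ c ∈ F m, E.indicator (fun _ => (1 : ℝ≥0∞)) (c • x) ≤
      ENNReal.ofReal (2 + 2 * C) * ∑ g ∈ P * F m, ENNReal.ofReal (u (g • x)) := by
    intro x
    have h := maximal_pointwise F C hC0 hC hFol.1 u hu l hl K (F m) x E (fun y hy => hy)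
    have h' := ENNReal.ofReal_le_ofReal h
    rw [ENNReal.ofReal_mul hl.le, ENNReal.ofReal_mul (by linarith),
      ENNReal.ofReal_sum_of_nonneg (fun g _ => hu _), ENNReal.ofReal_sum_of_nonneg
        (fun g _ => Set.indicator_nonneg (fun _ _ => zero_le_one) _)] at h'
    refine le_trans (le_of_eq ?_) h'
    congr 1
    refine Finset.sum_congr rfl fun c _ => ?_
    by_cases hc : c • x ∈ E <;> simp [hc]
  have hint := lintegral_mono (μ := μ) hpt
  have hind : Measurable (E.indicator (fun _ => (1 : ℝ≥0∞))) := measurable_const.indicator hEm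
  have hinvl : ∀ (g : G) (v : X → ℝ≥0∞), Measurable v → ∫⁻ x, v (g • x) ∂μ = ∫⁻ x, v x ∂μ :=
    fun g v hv => (mpres hinv g).lintegral_comp hv
  have hsumI : ∀ (a : ℝ≥0∞) (B : Finset G) (v : X → ℝ≥0∞), Measurable v →
      ∫⁻ x, a * ∑ c ∈ B, v (c • x) ∂μ = a * (B.card * ∫⁻ x, v x ∂μ) := by
    intro a B v hv
    have hv' : ∀ g : G, Measurable fun x => v (g • x) := fun g => hv.comp (hsm g)
    rw [lintegral_const_mul _ (Finset.measurable_sum _ fun g _ => hv' g),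
      lintegral_finsetSum _ (fun g _ => hv' g), Finset.sum_congr rfl (fun g _ => hinvl g _ hv),
      Finset.sum_const, nsmul_eq_mul]
  rw [hsumI _ _ _ hind, hsumI _ _ (fun x => ENNReal.ofReal (u x)) hum.ennreal_ofReal,
    lintegral_indicator_const hEm, one_mul] at hint
  have hm0 : ((F m).card : ℝ≥0∞) ≠ 0 := by exact_mod_cast (hFol.1 m).card_pos.ne'
  have hmt : ((F m).card : ℝ≥0∞) ≠ ⊤ := ENNReal.natCast_ne_top _
  rw [← ENNReal.mul_le_mul_iff_right hm0 hmt]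
  have hcard' : ((P * F m).card : ℝ≥0∞) ≤ 2 * (F m).card := by
    have : (P * F m).card ≤ 2 * (F m).card := by exact_mod_cast hcard
    exact_mod_cast this
  calc ((F m).card : ℝ≥0∞) * (ENNReal.ofReal l * μ E) = ENNReal.ofReal l * ((F m).card * μ E) := by
        ring
    _ ≤ ENNReal.ofReal (2 + 2 * C) * ((P * F m).card * ∫⁻ x, ENNReal.ofReal (u x) ∂μ) := hint
    _ ≤ ENNReal.ofReal (2 + 2 * C) * (2 * (F m).card * ∫⁻ x, ENNReal.ofReal (u x) ∂μ) := by gcongr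
    _ = _ := by
      have : ENNReal.ofReal (4 + 4 * C) = 2 * ENNReal.ofReal (2 + 2 * C) := by
        rw [show (2 : ℝ≥0∞) = ENNReal.ofReal 2 by simp, ← ENNReal.ofReal_mul (by norm_num)]
        ring_nf
      rw [this]; ring

lemma maximal_ineq (F : ℕ → Finset G) (hFol : IsFolnerSeq F) (C : ℝ) (hC0 : 0 ≤ C)
    (hC : ∀ n : ℕ, (((Finset.range n).biUnion fun k => (F k)⁻¹ * F n).card : ℝ) ≤ C * (F n).card)
    (μ : Measure X) [IsProbabilityMeasure μ] (hinv : InvariantMeasure G μ)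
    (u : X → ℝ) (hu : ∀ x, 0 ≤ u x) (hum : Measurable u) (l : ℝ) (hl : 0 < l) :
    ENNReal.ofReal l * μ {y | ∃ n, l * (F n).card ≤ ∑ g ∈ F n, u (g • y)} ≤
      ENNReal.ofReal (4 + 4 * C) * ∫⁻ x, ENNReal.ofReal (u x) ∂μ := by
  have h1 : {y : X | ∃ n, l * (F n).card ≤ ∑ g ∈ F n, u (g • y)} =
      ⋃ K : ℕ, {y | ∃ n < K, l * (F n).card ≤ ∑ g ∈ F n, u (g • y)} := by
    ext y
    simp only [Set.mem_iUnion, Set.mem_ofPred_eq]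
    constructor
    · rintro ⟨n, hn⟩
      exact ⟨n + 1, n, by omega, hn⟩
    · rintro ⟨_, n, _, hn⟩
      exact ⟨n, hn⟩
  rw [h1, Monotone.measure_iUnion, ENNReal.mul_iSup]
  · exact iSup_le fun K => maximal_ineq_aux F hFol C hC0 hC μ hinv u hu hum l hl K
  · intro K K' hK y
    rintro ⟨n, hn, h⟩
    exact ⟨n, by omega, h⟩

lemma ae_tendsto_avg [Countable G] (F : ℕ → Finset G) (hFol : IsFolnerSeq F)
    (hTemp : IsTemperedSeq F)
    (μ : Measure X) [IsProbabilityMeasure μ] (hinv : InvariantMeasure G μ)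
    (herg : ErgodicMeasure G μ) (f : C(X, ℝ)) :
    ∀ᵐ x ∂μ, Tendsto (fun n => (∑ g ∈ F n, f (g • x)) / (F n).card) atTop (𝓝 (∫ y, f y ∂μ)) := by
  obtain ⟨C, hC⟩ := hTemp
  have hcp : ∀ n, (0 : ℝ) < (F n).card := fun n => by exact_mod_cast (hFol.1 n).card_pos
  have hC0 : 0 ≤ C := by
    by_contra h
    have h1 : (0 : ℝ) ≤ C * (F 0).card := (Nat.cast_nonneg _).trans (hC 0)
    nlinarith [hcp 0]
  set c := ∫ y, f y ∂μ with hc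
  have hnull : ∀ l : ℝ, 0 < l →
      μ {x | ∃ᶠ n in atTop, 2 * l ≤ |(∑ g ∈ F n, f (g • x)) / (F n).card - c|} = 0 := by
    intro l hl
    set A := {x | ∃ᶠ n in atTop, 2 * l ≤ |(∑ g ∈ F n, f (g • x)) / (F n).card - c|} with hA
    have hbound : ∀ ε : ℝ, 0 < ε → ENNReal.ofReal (l / 1) * μ A ≤
        ENNReal.ofReal ((4 + 4 * C) * ε) := by
      intro ε hε
      obtain ⟨w, hw, hwi⟩ := cob_approx (G := G) μ hinv herg f ε hε
      set u : X → ℝ := fun x => |f x - c - w x| with hu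
      have hum : Measurable u := by
        have : Continuous u := by fun_prop
        exact this.measurable
      have hsub : A ⊆ {y | ∃ n, l * (F n).card ≤ ∑ g ∈ F n, u (g • y)} := by
        intro x hx
        have hw0 := cobSpan_avg F hFol w hw x
        have hev : ∀ᶠ n in atTop, |(∑ g ∈ F n, w (g • x)) / (F n).card| < l := by
          have := hw0.abs
          rw [abs_zero] at this
          exact this.eventually (gt_mem_nhds hl)
        obtain ⟨n, h1, h2⟩ := (Frequently.and_eventually hx hev).exists
        refine ⟨n, ?_⟩
        have h3 : (∑ g ∈ F n, f (g • x)) / (F n).card - c =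
            (∑ g ∈ F n, (f (g • x) - c - w (g • x))) / (F n).card +
            (∑ g ∈ F n, w (g • x)) / (F n).card := by
          rw [Finset.sum_sub_distrib, Finset.sum_sub_distrib, Finset.sum_const, nsmul_eq_mul]
          have := (hcp n).ne'
          field_simp
          ring
        rw [h3] at h1
        have h4 := h1.trans (abs_add_le _ _)
        have h5 : l ≤ |(∑ g ∈ F n, (f (g • x) - c - w (g • x))) / (F n).card| := by linarith
        rw [abs_div, abs_of_pos (hcp n), le_div_iff₀ (hcp n)] at h5
        exact h5.trans (Finset.abs_sum_le_sum_abs _ _)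
      rw [div_one]
      calc ENNReal.ofReal l * μ A ≤ ENNReal.ofReal l *
            μ {y | ∃ n, l * (F n).card ≤ ∑ g ∈ F n, u (g • y)} := by gcongr
        _ ≤ ENNReal.ofReal (4 + 4 * C) * ∫⁻ x, ENNReal.ofReal (u x) ∂μ :=
          maximal_ineq F hFol C hC0 hC μ hinv u (fun x => abs_nonneg _) hum l hl
        _ ≤ ENNReal.ofReal (4 + 4 * C) * ENNReal.ofReal ε := by
          gcongr
          refine le_trans (le_of_eq ?_) hwi
          refine lintegral_congr fun x => ?_
          rw [← Real.enorm_abs, Real.enorm_of_nonneg (abs_nonneg _)]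
        _ = _ := by rw [ENNReal.ofReal_mul (by linarith)]
    have hz : ENNReal.ofReal (l / 1) * μ A = 0 := by
      refine le_antisymm (ENNReal.le_of_forall_pos_le_add fun ε hε _ => ?_) zero_le
      have h4C : 0 < 4 + 4 * C := by linarith
      have := hbound (ε / (4 + 4 * C)) (by positivity)
      rw [mul_div_cancel₀ _ h4C.ne'] at this
      simpa using this
    rcases mul_eq_zero.1 hz with h | h
    · rw [ENNReal.ofReal_eq_zero] at h
      linarith
    · exact h
  have hall : ∀ᵐ x ∂μ, ∀ k : ℕ, ¬ ∃ᶠ n in atTop,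
      2 * (1 / ((k : ℝ) + 1)) ≤ |(∑ g ∈ F n, f (g • x)) / (F n).card - c| := by
    rw [ae_all_iff]
    intro k
    exact measure_eq_zero_iff_ae_notMem.1 (hnull _ (by positivity))
  filter_upwards [hall] with x hx
  rw [Metric.tendsto_atTop']
  intro ε hε
  obtain ⟨k, hk⟩ := exists_nat_one_div_lt (half_pos hε)
  have h1 := hx k
  rw [not_frequently, eventually_atTop] at h1
  obtain ⟨N, hN⟩ := h1
  refine ⟨N, fun n hn => ?_⟩
  have := hN n hn.le
  rw [Real.dist_eq]
  push Not at this
  linarith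

lemma ae_generic [Countable G] (F : ℕ → Finset G) (hFol : IsFolnerSeq F)
    (hTemp : IsTemperedSeq F)
    (μ : Measure X) [IsProbabilityMeasure μ] (hinv : InvariantMeasure G μ)
    (herg : ErgodicMeasure G μ) : ∀ᵐ x ∂μ, x ∈ genericPointSet F μ := by
  have hcp : ∀ n, (0 : ℝ) < (F n).card := fun n => by exact_mod_cast (hFol.1 n).card_pos
  have hX : Nonempty X := by
    by_contra h
    rw [not_nonempty_iff] at h
    have := measure_univ (μ := μ)
    rw [Set.univ_eq_empty_iff.2 h] at this
    simp at this
  obtain ⟨d, hd⟩ := TopologicalSpace.exists_dense_seq C(X, ℝ)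
  have h := ae_all_iff.2 fun k => ae_tendsto_avg F hFol hTemp μ hinv herg (d k)
  filter_upwards [h] with x hx
  intro f
  rw [Metric.tendsto_atTop]
  intro ε hε
  obtain ⟨k, hk⟩ := hd.exists_dist_lt f (show 0 < ε / 4 by linarith)
  obtain ⟨N, hN⟩ := Metric.tendsto_atTop.1 (hx k) (ε / 4) (by linarith)
  refine ⟨N, fun n hn => ?_⟩
  have h1 := hN n hn
  have hpt : ∀ y, |f y - d k y| ≤ ε / 4 := fun y => by
    rw [← Real.dist_eq]; exact (ContinuousMap.dist_apply_le_dist y).trans hk.le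
  have hi : ∀ φ : C(X, ℝ), Integrable φ μ := fun φ =>
    φ.continuous.integrable_of_hasCompactSupport (HasCompactSupport.of_compactSpace _)
  have h2 : |∫ y, f y ∂μ - ∫ y, d k y ∂μ| ≤ ε / 4 := by
    rw [← integral_sub (hi f) (hi _)]
    have := norm_integral_le_of_norm_le_const (μ := μ) (f := fun y => f y - d k y) (C := ε / 4)
      (Eventually.of_forall hpt)
    simpa using this
  have h3 : |(∑ g ∈ F n, f (g • x)) / (F n).card - (∑ g ∈ F n, d k (g • x)) / (F n).card|
      ≤ ε / 4 := by
    rw [← sub_div, ← Finset.sum_sub_distrib, abs_div, abs_of_pos (hcp n), div_le_iff₀ (hcp n)]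
    refine (Finset.abs_sum_le_sum_abs _ _).trans ?_
    refine (Finset.sum_le_card_nsmul _ _ (ε / 4) fun g _ => hpt _).trans ?_
    rw [nsmul_eq_mul, mul_comm]
  rw [Real.dist_eq] at h1 ⊢
  rw [abs_le] at h2 h3
  rw [abs_lt] at h1 ⊢
  constructor <;> linarith
end

end PartMax

section PartEnt

set_option linter.unusedSectionVars false

lemma gibbs_bound {β : Type*} (T : Finset β) (p : β → ℝ) (hp : ∀ b ∈ T, 0 ≤ p b) (M : ℝ)
    (hM : 0 < M) (hT : (T.card : ℝ) ≤ M) :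
    ∑ b ∈ T, Real.negMulLog (p b) ≤ (∑ b ∈ T, p b) * Real.log M + 1 := by
  have h1 : ∀ b ∈ T, Real.negMulLog (p b) ≤ p b * Real.log M + 1 / M := by
    intro b hb
    rcases (hp b hb).eq_or_lt with h | h
    · rw [← h]; simp; positivity
    · have h2 := Real.log_le_sub_one_of_pos (show 0 < 1 / (p b * M) by positivity)
      rw [one_div, Real.log_inv, Real.log_mul h.ne' hM.ne'] at h2
      have h3 := mul_le_mul_of_nonneg_left h2 h.le
      have h4 : p b * ((p b * M)⁻¹ - 1) = 1 / M - p b := by field_simp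
      rw [h4] at h3
      rw [Real.negMulLog]
      linarith
  refine (Finset.sum_le_sum h1).trans ?_
  rw [Finset.sum_add_distrib, Finset.sum_mul, Finset.sum_const, nsmul_eq_mul]
  have : (T.card : ℝ) * (1 / M) ≤ 1 := by
    rw [mul_one_div, div_le_one hM]; exact hT
  linarith

lemma code_count {A : Type*} [DecidableEq A] (I : Finset A) (w : A → ℝ) (hw : ∀ a, 0 ≤ w a) (m : ℝ)
    (Sc : Finset (Finset A)) (hSc : ∀ S ∈ Sc, S ⊆ I ∧ Real.exp (-m) ≤ ∏ a ∈ S, w a) :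
    (Sc.card : ℝ) ≤ Real.exp (m + ∑ a ∈ I, w a) := by
  have h1 : (Sc.card : ℝ) * Real.exp (-m) ≤ ∑ S ∈ Sc, ∏ a ∈ S, w a := by
    rw [← nsmul_eq_mul]
    exact Finset.card_nsmul_le_sum _ _ _ fun S hS => (hSc S hS).2
  have h2 : ∑ S ∈ Sc, ∏ a ∈ S, w a ≤ ∑ S ∈ I.powerset, ∏ a ∈ S, w a :=
    Finset.sum_le_sum_of_subset_of_nonneg
      (fun S hS => Finset.mem_powerset.2 (hSc S hS).1)
      (fun S _ _ => Finset.prod_nonneg fun a _ => hw a)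
  rw [← Finset.prod_one_add] at h2
  have h3 : ∏ a ∈ I, (1 + w a) ≤ Real.exp (∑ a ∈ I, w a) := by
    rw [Real.exp_sum]
    refine Finset.prod_le_prod (fun a _ => by linarith [hw a]) fun a _ => ?_
    linarith [Real.add_one_le_exp (w a)]
  have h4 := (h1.trans h2).trans h3
  rw [Real.exp_neg, ← div_eq_mul_inv, div_le_iff₀ (Real.exp_pos _)] at h4
  rw [Real.exp_add, mul_comm]
  exact h4

section
variable {G : Type*} [Group G] [DecidableEq G] {X : Type*} [MetricSpace X] [CompactSpace X]
  [MulAction G X] [ContinuousConstSMul G X] [MeasurableSpace X] [BorelSpace X]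

lemma entropy_le_of_names (μ : Measure X) [IsProbabilityMeasure μ] {k : ℕ} (hk : 0 < k)
    (α : X → Fin k) (hα : Measurable α) (B : Finset G) (Nm : Finset (↥B → Fin k)) (M η : ℝ)
    (hM : 1 ≤ M) (hNm : (Nm.card : ℝ) ≤ M) (hη : 0 ≤ η)
    (hμ : μ {x | (fun g : ↥B => α ((g : G) • x)) ∉ Nm} ≤ ENNReal.ofReal η) :
    partitionEntropy μ α B ≤ Real.log M + η * Real.log k * B.card + 2 := by
  set name : X → (↥B → Fin k) := fun x g => α ((g : G) • x) with hname
  have hnm : Measurable name :=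
    measurable_pi_lambda _ fun g => hα.comp (continuous_const_smul (g : G)).measurable
  have hcell : ∀ f : ↥B → Fin k, {x | ∀ g : ↥B, α ((g : G) • x) = f g} = name ⁻¹' {f} := by
    intro f
    ext x
    simp [hname, funext_iff]
  set p : (↥B → Fin k) → ℝ := fun f => (μ (name ⁻¹' {f})).toReal with hp
  have hH : partitionEntropy μ α B = ∑ f, Real.negMulLog (p f) := by
    unfold partitionEntropy
    exact Finset.sum_congr rfl fun f _ => by rw [hcell f]
  have hsum : ∀ T : Finset (↥B → Fin k), ∑ f ∈ T, p f = (μ (name ⁻¹' ↑T)).toReal := by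
    intro T
    rw [← sum_measure_preimage_singleton T (fun y _ => hnm (measurableSet_singleton y)),
      ENNReal.toReal_sum (fun _ _ => measure_ne_top _ _)]
  rw [hH, ← Finset.sum_add_sum_compl Nm]
  have hp0 : ∀ f, 0 ≤ p f := fun f => ENNReal.toReal_nonneg
  have h1 := gibbs_bound Nm p (fun f _ => hp0 f) M (by linarith) hNm
  have hk1 : (1 : ℝ) ≤ k := by exact_mod_cast hk
  have h2 := gibbs_bound Nmᶜ p (fun f _ => hp0 f) ((k : ℝ) ^ B.card) (by positivity) (by
    have := Finset.card_le_univ (Nmᶜ)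
    rw [Fintype.card_fun, Fintype.card_fin, Fintype.card_coe] at this
    exact_mod_cast this)
  rw [hsum] at h1 h2
  have h3 : (μ (name ⁻¹' ↑Nm)).toReal ≤ 1 := by
    have := ENNReal.toReal_mono ENNReal.one_ne_top (prob_le_one (μ := μ) (s := name ⁻¹' ↑Nm))
    simpa using this
  have h4 : (μ (name ⁻¹' ↑Nmᶜ)).toReal ≤ η := by
    refine ENNReal.toReal_le_of_le_ofReal hη ?_
    convert hμ using 2
    ext x
    simp [hname]
  have h5 : 0 ≤ Real.log M := Real.log_nonneg hM
  have h6 : 0 ≤ Real.log k := Real.log_nonneg hk1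
  rw [Real.log_pow] at h2
  have h7 : (μ (name ⁻¹' ↑Nm)).toReal * Real.log M ≤ Real.log M := by nlinarith
  have h8 : (μ (name ⁻¹' ↑Nmᶜ)).toReal * (B.card * Real.log k) ≤ η * (B.card * Real.log k) :=
    mul_le_mul_of_nonneg_right h4 (by positivity)
  nlinarith

open Classical in
/-- decoding of a name from a tiling and an error set -/
noncomputable def decode (F : ℕ → Finset G) {k : ℕ} (hk : 0 < k) (β : X → Fin k) (B : Finset G)
    (c : Finset (G × (X × ℕ)) × Finset (G × Fin k)) : ↥B → Fin k := fun g =>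
  if h : ∃ v, ((g : G), v) ∈ c.2 then h.choose
  else if h : ∃ p ∈ c.1, (g : G) ∈ tile F Prod.snd p then
    β (((g : G) * h.choose.1⁻¹) • h.choose.2.1)
  else ⟨0, hk⟩

lemma decode_spec (F : ℕ → Finset G) {k : ℕ} (hk : 0 < k) (α β : X → Fin k) (K : Set X) (ε : ℝ)
    (hβ : ∀ z, ∀ y ∈ K, dist z y < ε → β z = α y) (B : Finset G)
    (S : Finset (G × (X × ℕ))) (x : X)
    (hS : ∀ p ∈ S, p.1 • x ∈ bowenBall (F p.2.2) p.2.1 ε) (R : Finset (G × Fin k))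
    (hR1 : ∀ q ∈ R, q.2 = α (q.1 • x))
    (hR2 : ∀ g ∈ B, (g ∉ S.biUnion (tile F Prod.snd) ∨ g • x ∉ K) → (g, α (g • x)) ∈ R) :
    decode F hk β B (S, R) = fun g : ↥B => α ((g : G) • x) := by
  funext g
  unfold decode
  by_cases h : ∃ v, ((g : G), v) ∈ R
  · rw [dif_pos h]
    exact hR1 _ h.choose_spec
  · rw [dif_neg h]
    have hg : (g : G) ∈ S.biUnion (tile F Prod.snd) ∧ (g : G) • x ∈ K := by
      by_contra hcon
      exact h ⟨_, hR2 g g.2 (by tauto)⟩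
    have h' : ∃ p ∈ S, (g : G) ∈ tile F Prod.snd p := Finset.mem_biUnion.1 hg.1
    rw [dif_pos h']
    obtain ⟨h1, h2⟩ := h'.choose_spec
    set p := h'.choose
    refine hβ _ _ hg.2 ?_
    obtain ⟨t, ht, hte⟩ := mem_rtr.1 h2
    have h3 := hS p h1 t ht
    have h4 : (g : G) * p.1⁻¹ = t := by rw [← hte]; group
    rw [h4]
    rw [← mul_smul, hte] at h3
    exact h3

/-- Markov type bound for bad visits -/
lemma markov_visits (μ : Measure X) (hinv : InvariantMeasure G μ)
    (D : Set X) (hD : MeasurableSet D) (B : Finset G) (hB : B.Nonempty) (a b : ℝ) (ha : 0 < a)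
    (hb : 0 < b) (hμ : μ Dᶜ ≤ ENNReal.ofReal (a * b)) :
    μ {x | ¬ (∑ c ∈ B, Dᶜ.indicator (fun _ => (1 : ℝ≥0∞)) (c • x) ≤ ENNReal.ofReal (a * B.card))}
      ≤ ENNReal.ofReal b := by
  set v : X → ℝ≥0∞ := fun x => ∑ c ∈ B, Dᶜ.indicator (fun _ => (1 : ℝ≥0∞)) (c • x) with hv
  have hind : Measurable (Dᶜ.indicator (fun _ => (1 : ℝ≥0∞))) := measurable_const.indicator hD.compl
  have hind' : ∀ c : G, Measurable fun x : X => Dᶜ.indicator (fun _ => (1 : ℝ≥0∞)) (c • x) :=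
    fun c => hind.comp (continuous_const_smul c).measurable
  have hvm : Measurable v := Finset.measurable_sum _ fun c _ => hind' c
  have hint : ∫⁻ x, v x ∂μ = B.card * μ Dᶜ := by
    rw [hv, lintegral_finsetSum _ (fun c _ => hind' c),
      Finset.sum_congr rfl (fun c _ => (mpres hinv c).lintegral_comp hind),
      lintegral_indicator_const hD.compl, one_mul, Finset.sum_const, nsmul_eq_mul]
  have hBpos : (0 : ℝ) < B.card := by exact_mod_cast hB.card_pos
  have h1 := mul_meas_ge_le_lintegral (μ := μ) hvm (ENNReal.ofReal (a * B.card))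
  rw [hint] at h1
  have h0 : ENNReal.ofReal (a * B.card) ≠ 0 := by
    rw [Ne, ENNReal.ofReal_eq_zero, not_le]; positivity
  rw [← ENNReal.mul_le_mul_iff_right h0 ENNReal.ofReal_ne_top]
  calc _ ≤ ENNReal.ofReal (a * B.card) * μ {x | ENNReal.ofReal (a * B.card) ≤ v x} :=
        mul_le_mul' le_rfl (measure_mono fun x hx => (not_le.1 hx).le)
    _ ≤ B.card * μ Dᶜ := h1
    _ ≤ B.card * ENNReal.ofReal (a * b) := by gcongr
    _ = _ := by
      rw [← ENNReal.ofReal_natCast, ← ENNReal.ofReal_mul hBpos.le, ← ENNReal.ofReal_mul (by positivity)]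
      ring_nf

lemma isOpen_bowenBall (F : Finset G) (x : X) (ε : ℝ) : IsOpen (bowenBall F x ε) := by
  have : bowenBall F x ε = ⋂ g ∈ F, {y | dist (g • x) (g • y) < ε} := by
    ext y; simp [bowenBall]
  rw [this]
  refine isOpen_biInter_finset fun g _ => isOpen_lt ?_ continuous_const
  exact continuous_const.dist (continuous_const_smul g)

/-- a Lusin type statement for a finite partition -/
lemma lusin_partition (μ : Measure X) [IsProbabilityMeasure μ] {k : ℕ} (hk : 0 < k) (α : X → Fin k)
    (hα : Measurable α) (κ : ℝ) (hκ : 0 < κ) :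
    ∃ K : Set X, MeasurableSet K ∧ μ Kᶜ ≤ ENNReal.ofReal κ ∧ ∃ ε > 0, ∃ β : X → Fin k,
      ∀ z, ∀ y ∈ K, dist z y < ε → β z = α y := by
  classical
  have hk' : (0 : ℝ) < k := by exact_mod_cast hk
  have hcl : ∀ i : Fin k, ∃ Ki ⊆ α ⁻¹' {i}, IsClosed Ki ∧
      μ (α ⁻¹' {i} \ Ki) < ENNReal.ofReal (κ / k) := by
    intro i
    exact (hα (measurableSet_singleton i)).exists_isClosed_sdiff_lt (measure_ne_top _ _)
      (by rw [Ne, ENNReal.ofReal_eq_zero, not_le]; positivity)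
  choose Kf hKsub hKcl hKμ using hcl
  have hsep : ∀ᶠ ε in 𝓝[>] (0 : ℝ), ∀ i j : Fin k, i ≠ j →
      Disjoint (Metric.thickening ε (Kf i)) (Metric.thickening ε (Kf j)) := by
    rw [eventually_all]; intro i
    rw [eventually_all]; intro j
    by_cases hij : i = j
    · exact Eventually.of_forall fun ε h => absurd hij h
    · have hd : Disjoint (Kf i) (Kf j) := by
        rw [Set.disjoint_left]
        intro x h1 h2
        exact hij ((hKsub i h1).symm.trans (hKsub j h2))
      obtain ⟨ε0, hε0, hd0⟩ := hd.exists_thickenings (hKcl i).isCompact (hKcl j)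
      filter_upwards [Ioo_mem_nhdsGT hε0] with ε hε _
      exact hd0.mono (Metric.thickening_mono hε.2.le _) (Metric.thickening_mono hε.2.le _)
  obtain ⟨ε, hsepε, hε⟩ := (hsep.and self_mem_nhdsWithin).exists
  refine ⟨⋃ i, Kf i, MeasurableSet.iUnion fun i => (hKcl i).measurableSet, ?_, ε, hε,
    fun z => if h : ∃ i, z ∈ Metric.thickening ε (Kf i) then h.choose else ⟨0, hk⟩, ?_⟩
  · have hsub : (⋃ i, Kf i)ᶜ ⊆ ⋃ i, (α ⁻¹' {i} \ Kf i) := by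
      intro x hx
      simp only [Set.mem_compl_iff, Set.mem_iUnion, not_exists] at hx
      exact Set.mem_iUnion.2 ⟨α x, rfl, hx _⟩
    refine (measure_mono hsub).trans ((measure_iUnion_le _).trans ?_)
    rw [tsum_fintype]
    refine (Finset.sum_le_sum fun i _ => (hKμ i).le).trans ?_
    rw [Finset.sum_const, nsmul_eq_mul, Finset.card_univ, Fintype.card_fin,
      ← ENNReal.ofReal_natCast, ← ENNReal.ofReal_mul hk'.le, mul_div_cancel₀ _ hk'.ne']
  · intro z y hy hzy
    obtain ⟨i, hi⟩ := Set.mem_iUnion.1 hy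
    have hz : z ∈ Metric.thickening ε (Kf i) := Metric.mem_thickening_iff.2 ⟨y, hi, hzy⟩
    have hαy : α y = i := hKsub i hi
    have h : ∃ i, z ∈ Metric.thickening ε (Kf i) := ⟨i, hz⟩
    simp only [dif_pos h]
    rw [hαy]
    by_contra hne
    exact Set.disjoint_left.1 (hsepε _ _ hne) h.choose_spec hz
end

end PartEnt

section PartCov

set_option linter.unusedSectionVars false

variable {G : Type*} [Group G] [DecidableEq G] {X : Type*} [MetricSpace X] [CompactSpace X]
  [MulAction G X] [ContinuousConstSMul G X] [MeasurableSpace X] [BorelSpace X]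

lemma card_tendsto (F : ℕ → Finset G) (hGrow : GrowthCond F) :
    Tendsto (fun n => ((F n).card : ℝ)) atTop atTop := by
  refine tendsto_atTop_mono' _ ?_ hGrow
  filter_upwards [eventually_ge_atTop 3] with n hn
  have h1 : (1 : ℝ) ≤ Real.log n := by
    rw [Real.le_log_iff_exp_le (by positivity)]
    have : (3 : ℝ) ≤ n := by exact_mod_cast hn
    linarith [Real.exp_one_lt_d9]
  exact div_le_self (Nat.cast_nonneg _) h1

lemma small_cover (F : ℕ → Finset G) (hGrow : GrowthCond F) (Z : Set X) (s s' : ℝ) (hs : s < s')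
    (hZ : bowenMeasure F Z s ≠ ⊤) (ε : ℝ) (hε : 0 < ε) (N : ℕ) (θ : ℝ) (hθ : 0 < θ) :
    ∃ C : Set (X × ℕ), C.Countable ∧ (∀ p ∈ C, N ≤ p.2) ∧
      Z ⊆ ⋃ p ∈ C, bowenBall (F p.2) p.1 ε ∧
      ∑' p : C, ENNReal.ofReal (Real.exp (-s' * ((F (p : X × ℕ).2).card : ℝ))) ≤
        ENNReal.ofReal θ := by
  set b := (bowenMeasure F Z s).toReal with hb
  have hb0 : 0 ≤ b := ENNReal.toReal_nonneg
  have hbe : bowenMeasure F Z s = ENNReal.ofReal b := (ENNReal.ofReal_toReal hZ).symm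
  obtain ⟨N', hN'⟩ := eventually_atTop.1
    ((card_tendsto F hGrow).eventually_ge_atTop (Real.log ((b + 1) / θ) / (s' - s)))
  have h1 : bowenMpre F Z (max N N') ε s < ENNReal.ofReal (b + 1) := by
    calc _ ≤ bowenMeasure F Z s :=
          (le_iSup (fun N => bowenMpre F Z N ε s) _).trans
            (le_iSup₂_of_le (f := fun (ε : ℝ) (_ : 0 < ε) => ⨆ N : ℕ, bowenMpre F Z N ε s) ε hε le_rfl)
      _ < _ := by
        rw [hbe]
        exact (ENNReal.ofReal_lt_ofReal_iff (by linarith)).2 (by linarith)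
  unfold bowenMpre at h1
  simp only [iInf_lt_iff] at h1
  obtain ⟨C, ⟨hc, hN, hcov⟩, hsum⟩ := h1
  refine ⟨C, hc, fun p hp => (le_max_left _ _).trans (hN p hp), hcov, ?_⟩
  calc _ ≤ ∑' p : C, ENNReal.ofReal (θ / (b + 1)) *
        ENNReal.ofReal (Real.exp (-s * ((F (p : X × ℕ).2).card : ℝ))) := by
        refine ENNReal.tsum_le_tsum fun p => ?_
        rw [← ENNReal.ofReal_mul (by positivity)]
        refine ENNReal.ofReal_le_ofReal ?_
        have h2 := hN' p.1.2 ((le_max_right _ _).trans (hN p p.2))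
        rw [div_le_iff₀ (by linarith)] at h2
        have h3 : θ / (b + 1) = Real.exp (-Real.log ((b + 1) / θ)) := by
          rw [Real.exp_neg, Real.exp_log (by positivity), inv_div]
        rw [h3, ← Real.exp_add]
        refine Real.exp_le_exp.2 ?_
        linarith
    _ = ENNReal.ofReal (θ / (b + 1)) * _ := ENNReal.tsum_mul_left
    _ ≤ ENNReal.ofReal (θ / (b + 1)) * ENNReal.ofReal (b + 1) := by gcongr
    _ = _ := by
      rw [← ENNReal.ofReal_mul (by positivity)]
      congr 1
      field_simp

lemma finite_cover (F : ℕ → Finset G) (hGrow : GrowthCond F) (μ : Measure X)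
    [IsProbabilityMeasure μ] (Z : Set X) (hZμ : ∀ᵐ x ∂μ, x ∈ Z) (s s' : ℝ) (hs : s < s')
    (hZ : bowenMeasure F Z s ≠ ⊤) (ε : ℝ) (hε : 0 < ε) (N : ℕ) (θ κ : ℝ) (hθ : 0 < θ) (hκ : 0 < κ) :
    ∃ Λ : Finset (X × ℕ), (∀ p ∈ Λ, N ≤ p.2) ∧
      ∑ p ∈ Λ, Real.exp (-s' * ((F p.2).card : ℝ)) ≤ θ ∧
      μ (⋃ p ∈ Λ, bowenBall (F p.2) p.1 ε)ᶜ ≤ ENNReal.ofReal κ := by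
  classical
  obtain ⟨C, hc, hN, hcov, hsum⟩ := small_cover F hGrow Z s s' hs hZ ε hε N θ hθ
  have hfull : μ (⋃ p ∈ C, bowenBall (F p.2) p.1 ε) = 1 := by
    rw [← measure_univ (μ := μ)]
    refine measure_congr ?_
    filter_upwards [hZμ] with x hx
    exact propext ⟨fun _ => trivial, fun _ => hcov hx⟩
  have hCne : C.Nonempty := by
    by_contra h
    rw [not_nonempty_iff_eq_empty] at h
    simp [h] at hfull
  obtain ⟨e, he⟩ := hc.exists_eq_range hCne
  set b : ℕ → Set X := fun i => bowenBall (F (e i).2) (e i).1 ε with hb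
  have hU : ⋃ i, b i = ⋃ p ∈ C, bowenBall (F p.2) p.1 ε := by
    rw [he, biUnion_range]
  have ht := tendsto_measure_iUnion_accumulate (μ := μ) (f := b)
  rw [hU, hfull] at ht
  have hev := ht.eventually (lt_mem_nhds (show 1 - ENNReal.ofReal κ < 1 from
    ENNReal.sub_lt_self ENNReal.one_ne_top one_ne_zero (by simpa using hκ)))
  obtain ⟨n, hn⟩ := hev.exists
  refine ⟨(Finset.range (n + 1)).image e, ?_, ?_, ?_⟩
  · intro p hp
    obtain ⟨i, -, rfl⟩ := Finset.mem_image.1 hp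
    exact hN _ (he ▸ mem_range_self i)
  · have hsub : ∀ p ∈ (Finset.range (n + 1)).image e, p ∈ C := by
      intro p hp
      obtain ⟨i, -, rfl⟩ := Finset.mem_image.1 hp
      exact he ▸ mem_range_self i
    rw [← ENNReal.ofReal_le_ofReal_iff hθ.le, ENNReal.ofReal_sum_of_nonneg
      (fun _ _ => (Real.exp_pos _).le)]
    refine le_trans ?_ hsum
    rw [tsum_subtype C (fun p : X × ℕ => ENNReal.ofReal (Real.exp (-s' * ((F p.2).card : ℝ))))]
    refine le_trans (le_of_eq ?_) (ENNReal.sum_le_tsum ((Finset.range (n + 1)).image e))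
    refine Finset.sum_congr rfl fun p hp => ?_
    rw [indicator_of_mem (hsub p hp)]
  · have hacc : Set.accumulate b n = ⋃ p ∈ (Finset.range (n + 1)).image e,
        bowenBall (F p.2) p.1 ε := by
      ext x
      simp [Set.mem_accumulate, hb, Nat.lt_succ_iff]
    rw [← hacc, prob_compl_eq_one_sub]
    · exact tsub_le_iff_tsub_le.1 hn.le
    · rw [hacc]
      exact (isOpen_biUnion fun p _ => isOpen_bowenBall _ _ _).measurableSet

lemma scales (F : ℕ → Finset G) (hFol : IsFolnerSeq F) (hGrow : GrowthCond F) (μ : Measure X)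
    [IsProbabilityMeasure μ] (Z : Set X) (hZμ : ∀ᵐ x ∂μ, x ∈ Z) (s s' : ℝ) (hs : s < s')
    (hZ : bowenMeasure F Z s ≠ ⊤) (ε : ℝ) (hε : 0 < ε) (θ κ η : ℝ) (hθ : 0 < θ) (hκ : 0 < κ)
    (hη : 0 < η) (J : ℕ) :
    ∃ Λ : ℕ → Finset (X × ℕ),
      (∀ j < J, ∑ p ∈ Λ j, Real.exp (-s' * ((F p.2).card : ℝ)) ≤ θ ∧
        μ (⋃ p ∈ Λ j, bowenBall (F p.2) p.1 ε)ᶜ ≤ ENNReal.ofReal κ) ∧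
      ∀ i j, i < j → j < J → ∀ l ∈ Λ j,
      (((((Λ i).biUnion fun l => F (Prod.snd l))⁻¹ * F (Prod.snd l)) \ F (Prod.snd l)).card : ℝ) ≤
        η * (F (Prod.snd l)).card := by
  induction J with
  | zero => exact ⟨fun _ => ∅, by simp, by simp⟩
  | succ J ih =>
    obtain ⟨Λ, h1, h2⟩ := ih
    have hev : ∀ᶠ n in atTop, ∀ i ∈ Finset.range J,
        (((((Λ i).biUnion fun l => F (Prod.snd l))⁻¹ * F n) \ F n).card : ℝ) ≤ η * (F n).card :=
      (Finset.eventually_all _).2 fun i _ => outer_boundary F hFol _ η hη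
    obtain ⟨N, hN⟩ := eventually_atTop.1 hev
    obtain ⟨Λ', h3, h4, h5⟩ := finite_cover F hGrow μ Z hZμ s s' hs hZ ε hε N θ κ hθ hκ
    refine ⟨Function.update Λ J Λ', ?_, ?_⟩
    · intro j hj
      rcases Nat.lt_succ_iff_lt_or_eq.1 hj with h | rfl
      · rw [Function.update_of_ne h.ne]; exact h1 j h
      · rw [Function.update_self]; exact ⟨h4, h5⟩
    · intro i j hij hj
      rcases Nat.lt_succ_iff_lt_or_eq.1 hj with h | rfl
      · rw [Function.update_of_ne h.ne, Function.update_of_ne (hij.trans h).ne]; exact h2 i j hij h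
      · rw [Function.update_self, Function.update_of_ne hij.ne]
        intro l hl
        exact hN _ (h3 l hl) i (Finset.mem_range.2 hij)

end PartCov

section PartCnt

set_option linter.unusedSectionVars false

section Counting

variable {G : Type*} [Group G] [DecidableEq G] {X : Type*} [MetricSpace X] [CompactSpace X]
  [MulAction G X] [ContinuousConstSMul G X] [MeasurableSpace X] [BorelSpace X]

open Classical in
/-- admissible tile codes -/
noncomputable def codeS (F : ℕ → Finset G) (δ : ℝ) (B : Finset G) (T : Finset (X × ℕ)) :
    Finset (Finset (G × (X × ℕ))) :=
  (B ×ˢ T).powerset.filter fun S => (1 - δ) * ∑ p ∈ S, ((F p.2.2).card : ℝ) ≤ B.card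

open Classical in
/-- admissible error codes -/
noncomputable def codeR (ρ : ℝ) (k : ℕ) (B : Finset G) : Finset (Finset (G × Fin k)) :=
  (B ×ˢ (Finset.univ : Finset (Fin k))).powerset.filter fun R => (R.card : ℝ) ≤ ρ * B.card

lemma count_S (F : ℕ → Finset G) (s δ Θ : ℝ) (hs : 0 ≤ s) (hδ : δ < 1) (B : Finset G)
    (T : Finset (X × ℕ)) (hT : ∑ p ∈ T, Real.exp (-s * ((F p.2).card : ℝ)) ≤ Θ) :
    ((codeS F δ B T).card : ℝ) ≤ Real.exp (s / (1 - δ) * B.card + B.card * Θ) := by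
  classical
  refine (code_count (B ×ˢ T) (fun p => Real.exp (-s * ((F p.2.2).card : ℝ)))
    (fun _ => (Real.exp_pos _).le) (s / (1 - δ) * B.card) _ ?_).trans ?_
  · intro S hS
    obtain ⟨h1, h2⟩ := Finset.mem_filter.1 hS
    refine ⟨Finset.mem_powerset.1 h1, ?_⟩
    rw [← Real.exp_sum, ← Finset.mul_sum]
    refine Real.exp_le_exp.2 ?_
    have h3 : (0 : ℝ) < 1 - δ := by linarith
    have h4 : ∑ p ∈ S, ((F p.2.2).card : ℝ) ≤ B.card / (1 - δ) := by
      rw [le_div_iff₀ h3]; linarith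
    have h5 := mul_le_mul_of_nonneg_left h4 hs
    have h6 : s / (1 - δ) * B.card = s * (B.card / (1 - δ)) := by ring
    rw [h6]; linarith
  · refine Real.exp_le_exp.2 ?_
    rw [Finset.sum_product]
    simp only [Finset.sum_const, nsmul_eq_mul]
    have := mul_le_mul_of_nonneg_left hT (Nat.cast_nonneg (α := ℝ) B.card)
    linarith

lemma count_R (u ρ : ℝ) (hu : 0 < u) (hu1 : u ≤ 1) (k : ℕ) (B : Finset G) :
    ((codeR ρ k B).card : ℝ) ≤ Real.exp (ρ * B.card * (-Real.log u) + B.card * (k * u)) := by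
  classical
  refine (code_count (B ×ˢ (Finset.univ : Finset (Fin k))) (fun _ => u)
    (fun _ => hu.le) (ρ * B.card * (-Real.log u)) _ ?_).trans (le_of_eq ?_)
  · intro R hR
    obtain ⟨h1, h2⟩ := Finset.mem_filter.1 hR
    refine ⟨Finset.mem_powerset.1 h1, ?_⟩
    rw [Finset.prod_const, ← Real.exp_log (pow_pos hu _), Real.log_pow]
    refine Real.exp_le_exp.2 ?_
    have := Real.log_nonpos hu.le hu1
    nlinarith
  · congr 2
    rw [Finset.sum_const, Finset.card_product, Finset.card_univ, Fintype.card_fin, nsmul_eq_mul]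
    push_cast; ring

lemma good_name (F : ℕ → Finset G) (C : ℝ) (hC0 : 0 ≤ C)
    (hC : ∀ n : ℕ, (((Finset.range n).biUnion fun k => (F k)⁻¹ * F n).card : ℝ) ≤ C * (F n).card)
    (hne : ∀ n, (F n).Nonempty) (δ η : ℝ) (hδ0 : 0 < δ) (hδ1 : δ ≤ 1 / 2) (hη : 0 < η)
    (J : ℕ) (Λ : ℕ → Finset (X × ℕ))
    (hΛ : ∀ i j, i < j → j < J → ∀ l ∈ Λ j,
      (((((Λ i).biUnion fun l => F (Prod.snd l))⁻¹ * F (Prod.snd l)) \ F (Prod.snd l)).card : ℝ) ≤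
        2 * η * (F (Prod.snd l)).card)
    (γ : ℝ) (hγ : γ = 1 / δ + C / (1 - δ)) (ρ : ℝ) (hρ : (1 - 1 / γ) ^ J + 7 * η ≤ ρ)
    (T : Finset (X × ℕ)) (hT : ∀ j < J, Λ j ⊆ T) (P : Finset G) (hP : ∀ l ∈ T, F l.2 ⊆ P)
    {k : ℕ} (hk : 0 < k) (α β : X → Fin k) (K : Set X) (ε : ℝ)
    (hβ : ∀ z, ∀ y ∈ K, dist z y < ε → β z = α y) (B : Finset G)
    (hB : ((B.filter fun c => ∃ g ∈ P, g * c ∉ B).card : ℝ) ≤ η * B.card)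
    (D : Set X) (hDK : D ⊆ K) (hDc : ∀ j < J, D ⊆ ⋃ p ∈ Λ j, bowenBall (F p.2) p.1 ε) (x : X)
    (hx : ∑ c ∈ B, Dᶜ.indicator (fun _ => (1 : ℝ≥0∞)) (c • x) ≤ ENNReal.ofReal (η * B.card)) :
    ∃ S ∈ codeS F δ B T, ∃ R ∈ codeR ρ k B,
      decode F hk β B (S, R) = fun g : ↥B => α ((g : G) • x) := by
  classical
  have hbad : ((B.filter fun c => c • x ∉ D).card : ℝ) ≤ η * B.card := by
    have h1 : ∑ c ∈ B, Dᶜ.indicator (fun _ => (1 : ℝ≥0∞)) (c • x) =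
        ((B.filter fun c => c • x ∉ D).card : ℝ≥0∞) := by
      rw [Finset.card_filter, Nat.cast_sum]
      refine Finset.sum_congr rfl fun c _ => ?_
      by_cases h : c • x ∈ D <;> simp [h]
    rw [h1, ← ENNReal.ofReal_natCast, ENNReal.ofReal_le_ofReal_iff (by positivity)] at hx
    exact hx
  by_cases hL : Nonempty (X × ℕ)
  swap
  · exact absurd ⟨(x, 0)⟩ hL
  set E : Finset G := B.filter fun c => c • x ∈ D ∧ ∀ g ∈ P, g * c ∈ B with hE
  have hEc : ((B \ E).card : ℝ) ≤ 2 * η * B.card := by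
    have h1 : B \ E ⊆ (B.filter fun c => c • x ∉ D) ∪ (B.filter fun c => ∃ g ∈ P, g * c ∉ B) := by
      intro c hc
      obtain ⟨h1, h2⟩ := Finset.mem_sdiff.1 hc
      by_cases h3 : c • x ∈ D
      · refine Finset.mem_union_right _ (Finset.mem_filter.2 ⟨h1, ?_⟩)
        by_contra h4
        push Not at h4
        exact h2 (Finset.mem_filter.2 ⟨h1, h3, h4⟩)
      · exact Finset.mem_union_left _ (Finset.mem_filter.2 ⟨h1, h3⟩)
    have h2 := (Finset.card_le_card h1).trans (Finset.card_union_le _ _)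
    have h3 : ((B \ E).card : ℝ) ≤ ((B.filter fun c => c • x ∉ D).card : ℝ) +
      ((B.filter fun c => ∃ g ∈ P, g * c ∉ B).card : ℝ) := by exact_mod_cast h2
    linarith
  obtain ⟨S, hS1, hS2, hS3⟩ := multi_tiling F C hC0 hC hne δ (2 * η) hδ0 hδ1 (by linarith)
    Prod.snd J Λ hΛ B E (fun c l => c • x ∈ bowenBall (F l.2) l.1 ε) (Finset.filter_subset _ _)
    hEc (by
      intro c hc i hi
      obtain ⟨hcB, hcD, hcP⟩ := Finset.mem_filter.1 hc
      obtain ⟨l, hl, hl'⟩ := mem_iUnion₂.1 (hDc i hi hcD)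
      refine ⟨l, hl, hl', ?_⟩
      intro h hh
      obtain ⟨t, ht, rfl⟩ := mem_rtr.1 hh
      exact hcP t (hP l (hT i hi hl) ht)) γ hγ J le_rfl
  set U := S.biUnion (tile F Prod.snd) with hU
  have hUB : U ⊆ B := Finset.biUnion_subset.2 fun p hp => (hS1 p hp).2.2.1
  set R : Finset (G × Fin k) := (B.filter fun g => g ∉ U ∨ g • x ∉ K).image
    fun g => (g, α (g • x)) with hR
  refine ⟨S, ?_, R, ?_, ?_⟩
  · refine Finset.mem_filter.2 ⟨Finset.mem_powerset.2 ?_, ?_⟩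
    · intro p hp
      obtain ⟨h1, -, -, j, -, hj, h2⟩ := hS1 p hp
      exact Finset.mem_product.2 ⟨Finset.filter_subset _ _ h1, hT j hj h2⟩
    · refine hS2.trans ?_
      exact_mod_cast Finset.card_le_card hUB
  · refine Finset.mem_filter.2 ⟨Finset.mem_powerset.2 ?_, ?_⟩
    · intro q hq
      obtain ⟨g, hg, rfl⟩ := Finset.mem_image.1 hq
      exact Finset.mem_product.2 ⟨Finset.filter_subset _ _ hg, Finset.mem_univ _⟩
    · have h1 : (B.filter fun g => g ∉ U ∨ g • x ∉ K) ⊆ (B \ U) ∪ (B.filter fun c => c • x ∉ D) := by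
        intro g hg
        obtain ⟨h1, h2⟩ := Finset.mem_filter.1 hg
        rcases h2 with h2 | h2
        · exact Finset.mem_union_left _ (Finset.mem_sdiff.2 ⟨h1, h2⟩)
        · exact Finset.mem_union_right _ (Finset.mem_filter.2 ⟨h1, fun h => h2 (hDK h)⟩)
      have h2 : R.card ≤ _ := Finset.card_image_le.trans
        ((Finset.card_le_card h1).trans (Finset.card_union_le _ _))
      have h3 : (R.card : ℝ) ≤ ((B \ U).card : ℝ) + ((B.filter fun c => c • x ∉ D).card : ℝ) := by
        exact_mod_cast h2
      have h4 := mul_le_mul_of_nonneg_right hρ (Nat.cast_nonneg (α := ℝ) B.card)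
      linarith
  · refine decode_spec F hk α β K ε hβ B S x (fun p hp => (hS1 p hp).2.1) R ?_ ?_
    · intro q hq
      obtain ⟨g, -, rfl⟩ := Finset.mem_image.1 hq
      rfl
    · intro g hg h
      exact Finset.mem_image.2 ⟨g, Finset.mem_filter.2 ⟨hg, h⟩, rfl⟩

end Counting

end PartCnt

section PartFin

set_option linter.unusedSectionVars false

section Final

variable {G : Type*} [Group G] [DecidableEq G] {X : Type*} [MetricSpace X] [CompactSpace X]
  [MulAction G X] [ContinuousConstSMul G X] [MeasurableSpace X] [BorelSpace X]

lemma sum_biUnion_le' {L : Type*} [DecidableEq L] (I : Finset ℕ) (Λ : ℕ → Finset L) (f : L → ℝ)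
    (hf : ∀ l, 0 ≤ f l) : ∑ p ∈ I.biUnion Λ, f p ≤ ∑ j ∈ I, ∑ p ∈ Λ j, f p := by
  induction I using Finset.induction_on with
  | empty => simp
  | insert a I ha ih =>
    rw [Finset.biUnion_insert, Finset.sum_insert ha]
    have h1 := Finset.sum_union_inter (s₁ := Λ a) (s₂ := I.biUnion Λ) (f := f)
    have h2 : 0 ≤ ∑ p ∈ Λ a ∩ I.biUnion Λ, f p := Finset.sum_nonneg fun p _ => hf p
    linarith

lemma entropy_bound (F : ℕ → Finset G) (hFol : IsFolnerSeq F) (hTemp : IsTemperedSeq F)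
    (hGrow : GrowthCond F) (μ : Measure X) [IsProbabilityMeasure μ] (hinv : InvariantMeasure G μ)
    (Z : Set X) (hZμ : ∀ᵐ x ∂μ, x ∈ Z) (s s' : ℝ) (hs : s < s') (hs' : 0 ≤ s')
    (hZ : bowenMeasure F Z s ≠ ⊤) (τ : ℝ) (hτ : 0 < τ) {k : ℕ} (hk : 0 < k) (α : X → Fin k)
    (hα : Measurable α) :
    ∀ᶠ m in atTop, partitionEntropy μ α (F m) ≤ (s' + τ) * (F m).card := by
  classical
  obtain ⟨C, hC⟩ := hTemp
  have hcp : ∀ n, (0 : ℝ) < (F n).card := fun n => by exact_mod_cast (hFol.1 n).card_pos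
  have hC0 : 0 ≤ C := by
    by_contra h
    have h1 : (0 : ℝ) ≤ C * (F 0).card := (Nat.cast_nonneg _).trans (hC 0)
    nlinarith [hcp 0]
  have hk' : (1 : ℝ) ≤ k := by exact_mod_cast hk
  have hlogk : 0 ≤ Real.log k := Real.log_nonneg hk'
  obtain ⟨q, hq⟩ : ∃ q, q = τ / 6 := ⟨_, rfl⟩
  have hq0 : 0 < q := by rw [hq]; positivity
  -- the parameter of almost disjointness
  obtain ⟨δ, hδ0, hδ1, hδ2⟩ : ∃ δ : ℝ, 0 < δ ∧ δ ≤ 1 / 2 ∧ s' / (1 - δ) ≤ s' + q := by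
    refine ⟨min (1 / 2) (q / (s' + q)), by positivity, min_le_left _ _, ?_⟩
    have h1 : min (1 / 2) (q / (s' + q)) ≤ 1 / 2 := min_le_left _ _
    have h2 : min (1 / 2) (q / (s' + q)) ≤ q / (s' + q) := min_le_right _ _
    rw [le_div_iff₀ (by linarith)] at h2
    rw [div_le_iff₀ (by linarith)]
    linarith
  obtain ⟨u, hu0, hu1, hu2⟩ : ∃ u : ℝ, 0 < u ∧ u ≤ 1 ∧ k * u ≤ q := by
    refine ⟨min 1 (q / k), by positivity, min_le_left _ _, ?_⟩
    have h2 : min 1 (q / k) ≤ q / k := min_le_right _ _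
    rw [le_div_iff₀ (by linarith)] at h2
    linarith
  have hlu : 0 ≤ -Real.log u := by linarith [Real.log_nonpos hu0.le hu1]
  obtain ⟨ρ, hρ0, hρ1⟩ : ∃ ρ : ℝ, 0 < ρ ∧ ρ * (-Real.log u) ≤ q := by
    refine ⟨q / (1 + -Real.log u), by positivity, ?_⟩
    rw [div_mul_eq_mul_div, div_le_iff₀ (by linarith)]
    nlinarith
  obtain ⟨γ, hγ⟩ : ∃ γ, γ = 1 / δ + C / (1 - δ) := ⟨_, rfl⟩
  have hγ1 : 1 ≤ γ := by
    have h1 : 1 ≤ 1 / δ := by rw [le_div_iff₀ hδ0]; linarith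
    have h2 : 0 ≤ C / (1 - δ) := div_nonneg hC0 (by linarith)
    linarith
  obtain ⟨J, hJ⟩ : ∃ J : ℕ, (1 - 1 / γ) ^ J < ρ / 2 := by
    refine exists_pow_lt_of_lt_one (by positivity) ?_
    have : 0 < 1 / γ := by positivity
    linarith
  obtain ⟨η, hη⟩ : ∃ η, η = ρ / 14 := ⟨_, rfl⟩
  have hη0 : 0 < η := by rw [hη]; positivity
  obtain ⟨η1, hη10, hη11⟩ : ∃ η1 : ℝ, 0 < η1 ∧ η1 * Real.log k ≤ q := by
    refine ⟨q / (1 + Real.log k), by positivity, ?_⟩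
    rw [div_mul_eq_mul_div, div_le_iff₀ (by linarith)]
    nlinarith
  obtain ⟨θ, hθ⟩ : ∃ θ, θ = q / (J + 1) := ⟨_, rfl⟩
  have hθ0 : 0 < θ := by rw [hθ]; positivity
  have hθ1 : J * θ ≤ q := by
    rw [hθ, mul_div_assoc', div_le_iff₀ (by positivity)]
    nlinarith
  obtain ⟨κ, hκ⟩ : ∃ κ, κ = η * η1 / (J + 1) := ⟨_, rfl⟩
  have hκ0 : 0 < κ := by rw [hκ]; positivity
  obtain ⟨K, hKm, hKμ, ε, hε, β, hβ⟩ := lusin_partition μ hk α hα κ hκ0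
  obtain ⟨Λ, hΛ1, hΛ2⟩ := scales F hFol hGrow μ Z hZμ s s' hs hZ ε hε θ κ (2 * η) hθ0 hκ0
    (by linarith) J
  set T : Finset (X × ℕ) := (Finset.range J).biUnion Λ with hTdef
  have hTs : ∑ p ∈ T, Real.exp (-s' * ((F p.2).card : ℝ)) ≤ q := by
    refine le_trans (sum_biUnion_le' _ _ _ fun _ => (Real.exp_pos _).le) (le_trans ?_ hθ1)
    refine (Finset.sum_le_sum fun j hj => (hΛ1 j (Finset.mem_range.1 hj)).1).trans ?_
    simp
  set P : Finset G := T.biUnion fun l => F l.2 with hP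
  set D : Set X := K ∩ ⋂ j ∈ Finset.range J, ⋃ p ∈ Λ j, bowenBall (F p.2) p.1 ε with hD
  have hDm : MeasurableSet D := by
    refine hKm.inter (Finset.measurableSet_biInter _ fun j _ => ?_)
    exact (isOpen_biUnion fun p _ => isOpen_bowenBall _ _ _).measurableSet
  have hDμ : μ Dᶜ ≤ ENNReal.ofReal (η * η1) := by
    have h1 : Dᶜ ⊆ Kᶜ ∪ ⋃ j ∈ Finset.range J, (⋃ p ∈ Λ j, bowenBall (F p.2) p.1 ε)ᶜ := by
      rw [hD, compl_inter, compl_iInter₂]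
    calc μ Dᶜ ≤ μ Kᶜ + ∑ j ∈ Finset.range J, μ (⋃ p ∈ Λ j, bowenBall (F p.2) p.1 ε)ᶜ :=
          (measure_mono h1).trans ((measure_union_le _ _).trans
            (add_le_add le_rfl (measure_biUnion_finset_le _ _)))
      _ ≤ ENNReal.ofReal κ + ∑ j ∈ Finset.range J, ENNReal.ofReal κ :=
          add_le_add hKμ (Finset.sum_le_sum fun j hj => (hΛ1 j (Finset.mem_range.1 hj)).2)
      _ = ENNReal.ofReal (η * η1) := by
          rw [Finset.sum_const, Finset.card_range, nsmul_eq_mul, ← ENNReal.ofReal_natCast,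
            ← ENNReal.ofReal_mul (by positivity), ← ENNReal.ofReal_add hκ0.le (by positivity)]
          congr 1
          rw [hκ]; field_simp; ring
  filter_upwards [inner_boundary F hFol P η hη0,
    (card_tendsto F hGrow).eventually_ge_atTop (2 / q)] with m hm1 hm2
  rw [div_le_iff₀ hq0] at hm2
  have hbp := hcp m
  set B := F m with hB
  set Nm : Finset (↥B → Fin k) := (codeS F δ B T ×ˢ codeR ρ k B).image (decode F hk β B) with hNm
  set e : ℝ := (s' / (1 - δ) * B.card + B.card * q) +
    (ρ * B.card * (-Real.log u) + B.card * (k * u)) with he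
  have he0 : 0 ≤ e := by
    have : 0 ≤ s' / (1 - δ) := div_nonneg hs' (by linarith)
    positivity
  have hcard : (Nm.card : ℝ) ≤ Real.exp e := by
    have h1 : Nm.card ≤ (codeS F δ B T).card * (codeR ρ k B).card :=
      Finset.card_image_le.trans (le_of_eq (Finset.card_product _ _))
    have h2 : (Nm.card : ℝ) ≤ (codeS F δ B T).card * (codeR ρ k B).card := by exact_mod_cast h1
    refine h2.trans ?_
    rw [he, Real.exp_add]
    exact mul_le_mul (count_S F s' δ q hs' (by linarith) B T hTs) (count_R u ρ hu0 hu1 k B)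
      (Nat.cast_nonneg _) (Real.exp_pos _).le
  have hbad : μ {x | (fun g : ↥B => α ((g : G) • x)) ∉ Nm} ≤ ENNReal.ofReal η1 := by
    refine le_trans (measure_mono ?_)
      (markov_visits μ hinv D hDm B (hFol.1 m) η η1 hη0 hη10 hDμ)
    intro x hx hx'
    obtain ⟨S, hS, R, hR, hSR⟩ := good_name F C hC0 hC hFol.1 δ η hδ0 hδ1 hη0 J Λ hΛ2 γ hγ ρ
      (by rw [hη]; linarith) T
      (fun j hj => Finset.subset_biUnion_of_mem Λ (Finset.mem_range.2 hj)) P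
      (fun l hl => Finset.subset_biUnion_of_mem (fun l : X × ℕ => F l.2) hl) hk α β K ε hβ B hm1 D
      inter_subset_left
      (fun j hj y hy => mem_iInter₂.1 hy.2 j (Finset.mem_range.2 hj)) x hx'
    exact hx (Finset.mem_image.2 ⟨(S, R), Finset.mem_product.2 ⟨hS, hR⟩, hSR⟩)
  have hfin := entropy_le_of_names μ hk α hα B Nm (Real.exp e) η1 (Real.one_le_exp he0) hcard
    hη10.le hbad
  rw [Real.log_exp] at hfin
  have hτq : τ = 6 * q := by rw [hq]; ring
  have i1 := mul_le_mul_of_nonneg_right hδ2 hbp.le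
  have i2 := mul_le_mul_of_nonneg_right hρ1 hbp.le
  have i3 := mul_le_mul_of_nonneg_right hu2 hbp.le
  have i4 := mul_le_mul_of_nonneg_right hη11 hbp.le
  rw [hτq]
  linarith

lemma final_bound [Countable G]
    (F : ℕ → Finset G) (hFol : IsFolnerSeq F) (hTemp : IsTemperedSeq F) (hGrow : GrowthCond F)
    (μ : Measure X) [IsProbabilityMeasure μ] (hinv : InvariantMeasure G μ)
    (herg : ErgodicMeasure G μ) :
    measEntropy F μ ≤ bowenEntropy F (genericPointSet F μ) := by
  refine iSup_le fun k => iSup_le fun α => iSup_le fun hα => ?_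
  have hX : Nonempty X := by
    by_contra h
    rw [not_nonempty_iff] at h
    have := measure_univ (μ := μ)
    rw [Set.eq_empty_of_isEmpty (univ : Set X)] at this
    simp at this
  have hk : 0 < k := (Nat.zero_le _).trans_lt (α hX.some).2
  by_cases htop : bowenEntropy F (genericPointSet F μ) = ⊤
  · rw [htop]; exact le_top
  set b := (bowenEntropy F (genericPointSet F μ)).toReal with hb
  have hb0 : 0 ≤ b := ENNReal.toReal_nonneg
  have hbe : bowenEntropy F (genericPointSet F μ) = ENNReal.ofReal b :=
    (ENNReal.ofReal_toReal htop).symm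
  have key : ∀ r : ℝ, 0 < r →
      limsup (fun n => ENNReal.ofReal (partitionEntropy μ α (F n) / (F n).card)) atTop ≤
        ENNReal.ofReal (b + r) := by
    intro r hr
    have hfin : bowenMeasure F (genericPointSet F μ) (b + r / 3) ≠ ⊤ := by
      intro h
      have h1 : ENNReal.ofReal (b + r / 3) ≤ bowenEntropy F (genericPointSet F μ) :=
        le_iSup₂ (f := fun (s : ℝ) (_ : bowenMeasure F (genericPointSet F μ) s = ⊤) =>
          ENNReal.ofReal s) (b + r / 3) h
      rw [hbe, ENNReal.ofReal_le_ofReal_iff hb0] at h1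
      linarith
    have hev := entropy_bound F hFol hTemp hGrow μ hinv _ (ae_generic F hFol hTemp μ hinv herg)
      (b + r / 3) (b + 2 * r / 3) (by linarith) (by positivity) hfin (r / 3) (by positivity) hk α hα
    refine limsup_le_of_le (by isBoundedDefault) ?_
    filter_upwards [hev] with n hn
    have hcp : (0 : ℝ) < (F n).card := by exact_mod_cast (hFol.1 n).card_pos
    refine ENNReal.ofReal_le_ofReal ?_
    rw [div_le_iff₀ hcp]
    refine hn.trans (le_of_eq ?_)
    ring
  rw [hbe]
  refine ENNReal.le_of_forall_pos_le_add fun r hr _ => ?_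
  refine (key r (by exact_mod_cast hr)).trans ?_
  rw [ENNReal.ofReal_add hb0 r.coe_nonneg]
  simp

end Final

end PartFin

variable {G : Type*} [Group G] [Countable G] [Infinite G] [DecidableEq G]
  {X : Type*} [MetricSpace X] [CompactSpace X] [MulAction G X] [ContinuousConstSMul G X]
  [MeasurableSpace X] [BorelSpace X]

theorem measEntropy_le_bowenEntropy_genericPoints
    (F : ℕ → Finset G) (hFol : IsFolnerSeq F) (hTemp : IsTemperedSeq F) (hGrow : GrowthCond F)
    (μ : Measure X) [IsProbabilityMeasure μ] (hinv : InvariantMeasure G μ)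
    (herg : ErgodicMeasure G μ) :
    measEntropy F μ ≤ bowenEntropy F (genericPointSet F μ) := by
  exact final_bound F hFol hTemp hGrow μ hinv herg
end

section
/- Let G be a countable discrete infinite amenable group acting continuously on a compact metric space (X,d), let {F_n} be a Følner sequence in G, and let μ be an ergodic G-invariant Borel probability measure on X. Let {K_m} be a decreasing sequence of closed convex neighborhoods of μ in the space M(X) of Borel probability measures (with the weak* topology) whose intersection is {μ}, and for m,n ∈ ℕ set A_{n,m} = {x ∈ X : (1/|F_n|) Σ_{g∈F_n} δ_x ∘ g^{-1} ∈ K_m}. Let N(A_{n,m},n,ε) denote the maximal cardinality of an (F_n,ε)-separated subset of A_{n,m}. Then lim_{ε→0} lim_{m→∞} limsup_{n→∞} (1/|F_n|) log N(A_{n,m},n,ε) ≤ h_μ(X,G). -/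
open MeasureTheory Filter Set
open scoped Pointwise ENNReal NNReal Topology

/-- A set `E` is `(F,ε)`-separated if distinct points `x,y ∈ E` satisfy `d(gx,gy) > ε`
for some `g ∈ F`. -/
def IsSeparatedSet {G : Type*} [Group G] {X : Type*} [MetricSpace X] [MulAction G X]
    (F : Finset G) (ε : ℝ) (E : Set X) : Prop :=
  ∀ x ∈ E, ∀ y ∈ E, x ≠ y → ∃ g ∈ F, ε < dist (g • x) (g • y)

/-- The empirical measure `(1/|F|) Σ_{g ∈ F} δ_x ∘ g⁻¹` of a point `x` along `F`. -/
noncomputable def empiricalMeasure {G : Type*} [Group G] {X : Type*} [MeasurableSpace X]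
    [MulAction G X] (F : Finset G) (x : X) : Measure X :=
  ((F.card : ℝ≥0∞))⁻¹ • ∑ g ∈ F, Measure.dirac (g • x)

/-- A set of Borel probability measures is convex. -/
def ConvexPM {X : Type*} [MeasurableSpace X] (K : Set (ProbabilityMeasure X)) : Prop :=
  ∀ ν₁ ∈ K, ∀ ν₂ ∈ K, ∀ t : ℝ≥0, t ≤ 1 → ∀ ν : ProbabilityMeasure X,
    (ν : Measure X) = t • (ν₁ : Measure X) + (1 - t) • (ν₂ : Measure X) → ν ∈ K

section Helpers

/-- Shannon entropy of a finite valued map. -/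
noncomputable def hent {X : Type*} [MeasurableSpace X] (μ : Measure X) {S : Type*} [Fintype S]
    (Y : X → S) : ℝ := ∑ s, Real.negMulLog (μ.real (Y ⁻¹' {s}))

lemma hlog_aux {p r : ℝ} (hp : 0 ≤ p) (hr : 0 ≤ r) (h : 0 < p → 0 < r) :
    p * (Real.log r - Real.log p) ≤ r - p := by
  rcases hp.eq_or_lt with rfl | hp
  · simpa using hr
  · have hr' := h hp
    rw [← Real.log_div hr'.ne' hp.ne']
    have := Real.log_le_sub_one_of_pos (div_pos hr' hp)
    calc p * Real.log (r / p) ≤ p * (r / p - 1) := by gcongr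
      _ = r - p := by field_simp

lemma hfin_mono {U T : Type*} [Fintype U] [Fintype T] [DecidableEq T] (p : U → ℝ)
    (hp : ∀ u, 0 ≤ p u) (f : U → T) :
    ∑ t, Real.negMulLog (∑ u with f u = t, p u) ≤ ∑ u, Real.negMulLog (p u) := by
  rw [← Finset.sum_fiberwise (s := Finset.univ) (g := f) (f := fun u => Real.negMulLog (p u))]
  refine Finset.sum_le_sum fun t _ => ?_
  simp only [Real.negMulLog, neg_mul, Finset.sum_neg_distrib, neg_le_neg_iff, Finset.sum_mul]
  refine Finset.sum_le_sum fun u hu => ?_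
  rcases (hp u).eq_or_lt with h | h
  · simp [← h]
  · gcongr
    exact Finset.single_le_sum (f := p) (fun i _ => hp i) hu

lemma hfin_cond {S U T : Type*} [Fintype S] [Fintype U] [Fintype T] [DecidableEq T]
    (p : S → U → ℝ) (hp : ∀ s u, 0 ≤ p s u) (f : U → T) :
    ∑ s, ∑ u, Real.negMulLog (p s u) + ∑ t, Real.negMulLog (∑ s, ∑ u with f u = t, p s u) ≤
      ∑ s, ∑ t, Real.negMulLog (∑ u with f u = t, p s u) +
        ∑ u, Real.negMulLog (∑ s, p s u) := by
  set q : S → T → ℝ := fun s t => ∑ u with f u = t, p s u with hq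
  set Q : T → ℝ := fun t => ∑ s, q s t with hQ
  set P : U → ℝ := fun u => ∑ s, p s u with hP
  have hq0 : ∀ s t, 0 ≤ q s t := fun s t => Finset.sum_nonneg fun u _ => hp s u
  have hQ0 : ∀ t, 0 ≤ Q t := fun t => Finset.sum_nonneg fun s _ => hq0 s t
  have hP0 : ∀ u, 0 ≤ P u := fun u => Finset.sum_nonneg fun s _ => hp s u
  have hpq : ∀ s u, p s u ≤ q s (f u) := fun s u =>
    Finset.single_le_sum (f := p s) (fun i _ => hp s i) (by simp)
  have hqQ : ∀ s t, q s t ≤ Q t := fun s t =>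
    Finset.single_le_sum (f := fun s => q s t) (fun i _ => hq0 i t) (by simp)
  have hpP : ∀ s u, p s u ≤ P u := fun s u =>
    Finset.single_le_sum (f := fun s => p s u) (fun i _ => hp i u) (by simp)
  have hQP : ∀ t, Q t = ∑ u with f u = t, P u := fun t => by
    simp only [hQ, hP, hq]; rw [Finset.sum_comm]
  have e1 : ∑ t, Real.negMulLog (Q t) = ∑ s, ∑ u, -(p s u * Real.log (Q (f u))) := by
    rw [Finset.sum_comm, ← Finset.sum_fiberwise (s := Finset.univ) (g := f)]
    refine Finset.sum_congr rfl fun t _ => ?_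
    rw [Real.negMulLog, neg_mul]
    nth_rw 1 [hQP]
    rw [Finset.sum_mul, ← Finset.sum_neg_distrib]
    refine Finset.sum_congr rfl fun u hu => ?_
    rw [Finset.sum_neg_distrib, ← Finset.sum_mul, (Finset.mem_filter.1 hu).2]
  have e2 : ∑ s, ∑ t, Real.negMulLog (q s t) = ∑ s, ∑ u, -(p s u * Real.log (q s (f u))) := by
    refine Finset.sum_congr rfl fun s _ => ?_
    rw [← Finset.sum_fiberwise (s := Finset.univ) (g := f)]
    refine Finset.sum_congr rfl fun t _ => ?_
    rw [Real.negMulLog, neg_mul]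
    nth_rw 1 [hq]
    rw [Finset.sum_mul, ← Finset.sum_neg_distrib]
    refine Finset.sum_congr rfl fun u hu => ?_
    rw [(Finset.mem_filter.1 hu).2]
  have e3 : ∑ u, Real.negMulLog (P u) = ∑ s, ∑ u, -(p s u * Real.log (P u)) := by
    rw [Finset.sum_comm]
    refine Finset.sum_congr rfl fun u _ => ?_
    rw [Finset.sum_neg_distrib, ← Finset.sum_mul, Real.negMulLog, neg_mul]
  change _ + ∑ t, Real.negMulLog (Q t) ≤ ∑ s, ∑ t, Real.negMulLog (q s t) + _
  rw [e1, e2, e3, ← Finset.sum_add_distrib, ← Finset.sum_add_distrib, ← sub_nonpos,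
    ← Finset.sum_sub_distrib]
  have key : ∀ s u, Real.negMulLog (p s u) + -(p s u * Real.log (Q (f u))) -
      (-(p s u * Real.log (q s (f u))) + -(p s u * Real.log (P u))) ≤
      q s (f u) * P u / Q (f u) - p s u := by
    intro s u
    have hr : 0 < p s u → 0 < q s (f u) * P u / Q (f u) := fun h =>
      div_pos (mul_pos (h.trans_le (hpq s u)) (h.trans_le (hpP s u)))
        (h.trans_le ((hpq s u).trans (hqQ _ _)))
    have h0 : 0 ≤ q s (f u) * P u / Q (f u) :=
      div_nonneg (mul_nonneg (hq0 _ _) (hP0 _)) (hQ0 _)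
    refine le_trans (le_of_eq ?_) (hlog_aux (hp s u) h0 hr)
    rcases (hp s u).eq_or_lt with h | h
    · simp [← h]
    · have h1 := h.trans_le (hpq s u)
      have h2 := h.trans_le (hpP s u)
      have h3 := h1.trans_le (hqQ s (f u))
      rw [Real.log_div (mul_pos h1 h2).ne' h3.ne', Real.log_mul h1.ne' h2.ne', Real.negMulLog]
      ring
  calc _ ≤ ∑ s, ∑ u, (q s (f u) * P u / Q (f u) - p s u) := by
        refine Finset.sum_le_sum fun s _ => ?_
        rw [← Finset.sum_add_distrib, ← Finset.sum_add_distrib, ← Finset.sum_sub_distrib]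
        exact Finset.sum_le_sum fun u _ => key s u
    _ = ∑ u, (Q (f u) * P u / Q (f u) - P u) := by
        rw [Finset.sum_comm]
        refine Finset.sum_congr rfl fun u _ => ?_
        rw [Finset.sum_sub_distrib, ← Finset.sum_div, ← Finset.sum_mul]
    _ ≤ 0 := by
        refine Finset.sum_nonpos fun u _ => ?_
        rcases (hQ0 (f u)).eq_or_lt with h | h
        · simp [← h, hP0]
        · rw [mul_div_right_comm, div_self h.ne']; simp

variable {X : Type*} [MeasurableSpace X]

lemma hreal_fib (μ : Measure X) [IsFiniteMeasure μ] {U T : Type*} [Fintype U]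
    [DecidableEq T] (Z : X → U) (hZ : ∀ u, MeasurableSet (Z ⁻¹' {u})) (B : Set X) (f : U → T) (t : T) :
    μ.real (B ∩ (f ∘ Z) ⁻¹' {t}) = ∑ u with f u = t, μ.real (B ∩ Z ⁻¹' {u}) := by
  have : ∀ u, μ.real (B ∩ Z ⁻¹' {u}) = (μ.restrict B).real (Z ⁻¹' {u}) := fun u => by
    rw [measureReal_restrict_apply (hZ u), inter_comm]
  simp only [this]
  have h2 : MeasurableSet ((f ∘ Z) ⁻¹' {t}) := by
    have : (f ∘ Z) ⁻¹' {t} = ⋃ u ∈ {u | f u = t}, Z ⁻¹' {u} := by ext x; simp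
    rw [this]
    exact MeasurableSet.biUnion (Set.to_countable _) fun u _ => hZ u
  rw [inter_comm, ← measureReal_restrict_apply h2]
  rw [← measureReal_biUnion_finset]
  · congr 1; ext x; simp
  · intro a _ b _ hab
    exact (Set.disjoint_singleton.2 hab).preimage Z
  · intro u _; exact hZ u

lemma hent_mono (μ : Measure X) [IsFiniteMeasure μ] {U T : Type*} [Fintype U] [Fintype T]
    (Z : X → U) (hZ : ∀ u, MeasurableSet (Z ⁻¹' {u})) (f : U → T) :
    hent μ (f ∘ Z) ≤ hent μ Z := by
  classical
  have := hfin_mono (fun u => μ.real (Z ⁻¹' {u})) (fun _ => measureReal_nonneg) f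
  refine le_trans (le_of_eq ?_) this
  refine Finset.sum_congr rfl fun t _ => ?_
  have := hreal_fib μ Z hZ univ f t
  simp only [univ_inter] at this
  rw [this]

lemma hent_cond (μ : Measure X) [IsFiniteMeasure μ] {S U T : Type*} [Fintype S] [Fintype U]
    [Fintype T] (Y : X → S) (hY : ∀ u, MeasurableSet (Y ⁻¹' {u}))
    (Z : X → U) (hZ : ∀ u, MeasurableSet (Z ⁻¹' {u})) (f : U → T) :
    hent μ (fun x => (Y x, Z x)) + hent μ (f ∘ Z) ≤
      hent μ (fun x => (Y x, f (Z x))) + hent μ Z := by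
  classical
  have := hfin_cond (fun s u => μ.real (Y ⁻¹' {s} ∩ Z ⁻¹' {u})) (fun _ _ => measureReal_nonneg) f
  have e : ∀ B : Set X, μ.real B = ∑ s, μ.real (Y ⁻¹' {s} ∩ B) := fun B => by
    have := hreal_fib μ Y hY B (fun _ => ()) ()
    rw [show (fun _ => ()) ∘ Y ⁻¹' {()} = univ by ext; simp] at this
    simp at this
    rw [this]
    exact Finset.sum_congr rfl fun s _ => by rw [inter_comm]
  have pr : ∀ (s : S) (v : U),
      (fun x => (Y x, Z x)) ⁻¹' {(s, v)} = Y ⁻¹' {s} ∩ Z ⁻¹' {v} := by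
    intro s v; ext x; simp
  refine le_trans (le_of_eq ?_) (this.trans (le_of_eq ?_))
  · unfold hent
    rw [Fintype.sum_prod_type]
    simp only [pr]
    congr 1
    refine Finset.sum_congr rfl fun t _ => ?_
    rw [e]
    congr 1
    exact Finset.sum_congr rfl fun s _ => hreal_fib μ Z hZ _ f t
  · unfold hent
    rw [Fintype.sum_prod_type]
    have pr' : ∀ s t, (fun x => (Y x, f (Z x))) ⁻¹' {(s, t)} = Y ⁻¹' {s} ∩ (f ∘ Z) ⁻¹' {t} := by
      intro s t; ext x; simp
    simp only [pr']
    congr 1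
    · refine Finset.sum_congr rfl fun s _ => Finset.sum_congr rfl fun t _ => ?_
      rw [hreal_fib μ Z hZ _ f t]
    · refine Finset.sum_congr rfl fun u _ => ?_
      rw [e]

lemma hent_le_log (μ : Measure X) [IsProbabilityMeasure μ] {S : Type*} [Fintype S]
    (Y : X → S) (hY : ∀ u, MeasurableSet (Y ⁻¹' {u})) :
    hent μ Y ≤ Real.log (Fintype.card S) := by
  classical
  have hs : ∑ s, μ.real (Y ⁻¹' {s}) = 1 := by
    have := hreal_fib μ Y hY univ (fun _ => ()) ()
    rw [show (fun _ => ()) ∘ Y ⁻¹' {()} = univ by ext; simp] at this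
    simp at this
    exact this.symm
  have hne : Nonempty S := by
    by_contra h
    rw [not_nonempty_iff] at h
    simp at hs
  have hc : (0 : ℝ) < Fintype.card S := by exact_mod_cast Fintype.card_pos
  have : ∀ s, Real.negMulLog (μ.real (Y ⁻¹' {s})) ≤
      μ.real (Y ⁻¹' {s}) * Real.log (Fintype.card S) + (1 / Fintype.card S - μ.real (Y ⁻¹' {s})) := by
    intro s
    have := hlog_aux (p := μ.real (Y ⁻¹' {s})) (r := 1 / Fintype.card S) measureReal_nonneg
      (by positivity) (fun _ => by positivity)
    rw [Real.log_div one_ne_zero hc.ne', Real.log_one] at this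
    rw [Real.negMulLog]
    linarith
  refine (Finset.sum_le_sum fun s _ => this s).trans ?_
  rw [Finset.sum_add_distrib, ← Finset.sum_mul, hs, Finset.sum_sub_distrib, hs]
  simp [hc.ne']

lemma hent_const (μ : Measure X) [IsProbabilityMeasure μ] : hent μ (fun _ : X => ()) = 0 := by
  simp [hent]

end Helpers

section Helpers2

/-- Shearer's inequality for submodular set functions. -/
lemma hshearer {G ι : Type*} [DecidableEq G] (H : Finset G → ℝ) (h0 : H ∅ = 0)
    (hmono : ∀ A B, A ⊆ B → H A ≤ H B)
    (hsub : ∀ h A B, B ⊆ A → H (insert h A) + H B ≤ H (insert h B) + H A)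
    (I : Finset ι) (B : ι → Finset G) (r : ℕ) (A : Finset G)
    (hA : ∀ h ∈ A, r ≤ (I.filter fun i => h ∈ B i).card) :
    r * H A ≤ ∑ i ∈ I, H (B i) := by
  suffices r * H A ≤ ∑ i ∈ I, H (B i ∩ A) from
    this.trans (Finset.sum_le_sum fun i _ => hmono _ _ Finset.inter_subset_left)
  induction A using Finset.induction_on with
  | empty => simp [h0]
  | insert h A hh ih =>
    have ih := ih fun x hx => hA x (Finset.mem_insert_of_mem hx)
    have h1 : ∀ i ∈ I, H (B i ∩ A) + (if h ∈ B i then H (insert h A) - H A else 0) ≤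
        H (B i ∩ insert h A) := by
      intro i _
      split_ifs with hi
      · rw [Finset.inter_insert_of_mem hi]
        have := hsub h A (B i ∩ A) Finset.inter_subset_right
        linarith
      · rw [Finset.inter_insert_of_notMem hi]; simp
    have h2 := Finset.sum_le_sum h1
    rw [Finset.sum_add_distrib, ← Finset.sum_filter, Finset.sum_const, nsmul_eq_mul] at h2
    have h3 : 0 ≤ H (insert h A) - H A := sub_nonneg.2 (hmono _ _ (Finset.subset_insert _ _))
    have h4 : (r : ℝ) ≤ ((I.filter fun i => h ∈ B i).card : ℝ) := by
      exact_mod_cast hA h (Finset.mem_insert_self _ _)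
    nlinarith [mul_le_mul_of_nonneg_right h4 h3]

lemma hunion_le {G : Type*} [DecidableEq G] (H : Finset G → ℝ) (c : ℝ)
    (hc : ∀ h A, H (insert h A) ≤ H A + c) (A B : Finset G) :
    H (A ∪ B) ≤ H A + B.card * c := by
  induction B using Finset.induction_on with
  | empty => simp
  | insert h B hh ih =>
    rw [Finset.union_insert, Finset.card_insert_of_notMem hh]
    have := hc h (A ∪ B)
    push_cast
    linarith

variable {G : Type*} [Group G] [DecidableEq G] {X : Type*} [MeasurableSpace X] [MulAction G X]

lemma partitionEntropy_eq_hent (μ : Measure X) {ι : Type*} [Fintype ι] (α : X → ι)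
    (A : Finset G) :
    partitionEntropy μ α A = hent μ (fun x (g : A) => α ((g : G) • x)) := by
  unfold partitionEntropy hent Measure.real
  refine Finset.sum_congr rfl fun f _ => ?_
  congr 3
  ext x
  simp [funext_iff]

variable [MeasurableConstSMul G X]

lemma hmeas_joint {k : ℕ} (α : X → Fin k) (hα : Measurable α) (A : Finset G)
    (u : A → Fin k) : MeasurableSet ((fun x (g : A) => α ((g : G) • x)) ⁻¹' {u}) := by
  have : Measurable (fun x (g : A) => α ((g : G) • x)) :=
    measurable_pi_lambda _ fun g => hα.comp (measurable_const_smul _)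
  exact this (measurableSet_singleton _)

lemma pe_empty (μ : Measure X) [IsProbabilityMeasure μ] {k : ℕ} (α : X → Fin k) :
    partitionEntropy μ α (∅ : Finset G) = 0 := by
  simp [partitionEntropy]

lemma pe_mono (μ : Measure X) [IsProbabilityMeasure μ] {k : ℕ} (α : X → Fin k)
    (hα : Measurable α) (A B : Finset G) (h : A ⊆ B) :
    partitionEntropy μ α A ≤ partitionEntropy μ α B := by
  rw [partitionEntropy_eq_hent, partitionEntropy_eq_hent]
  exact hent_mono μ (fun x (g : B) => α ((g : G) • x)) (hmeas_joint α hα B)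
    (fun (w : B → Fin k) (a : A) => w ⟨a, h a.2⟩)

lemma pe_insert (μ : Measure X) [IsProbabilityMeasure μ] {k : ℕ} (α : X → Fin k)
    (hα : Measurable α) (h : G) (A : Finset G) :
    partitionEntropy μ α (insert h A) =
      hent μ (fun x => (α (h • x), fun g : A => α ((g : G) • x))) := by
  rw [partitionEntropy_eq_hent]
  apply le_antisymm
  · classical
    have := hent_mono μ (fun x => (α (h • x), fun g : A => α ((g : G) • x))) (by
      rintro ⟨s, u⟩
      have : (fun x => (α (h • x), fun g : A => α ((g : G) • x))) ⁻¹' {(s, u)} =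
        (fun x => α (h • x)) ⁻¹' {s} ∩ (fun x (g : A) => α ((g : G) • x)) ⁻¹' {u} := by
        ext x; simp
      rw [this]
      exact ((hα.comp (measurable_const_smul h)) (measurableSet_singleton s)).inter
        (hmeas_joint α hα A u))
      (fun (w : Fin k × (A → Fin k)) (a : (insert h A : Finset G)) =>
        if ha : (a : G) ∈ A then w.2 ⟨a, ha⟩ else w.1)
    refine le_trans (le_of_eq ?_) this
    congr 1
    ext x a
    by_cases ha : (a : G) ∈ A
    · simp [ha]
    · have := a.2
      simp only [Finset.mem_insert, ha, or_false] at this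
      simp [ha, this]
  · exact hent_mono μ (fun x (g : (insert h A : Finset G)) => α ((g : G) • x))
      (hmeas_joint α hα _)
      (fun (w : ↥(insert h A : Finset G) → Fin k) =>
        (w ⟨h, Finset.mem_insert_self _ _⟩,
          fun a : A => w ⟨a, Finset.mem_insert_of_mem a.2⟩))

lemma pe_submod (μ : Measure X) [IsProbabilityMeasure μ] {k : ℕ} (α : X → Fin k)
    (hα : Measurable α) (h : G) (A B : Finset G) (hBA : B ⊆ A) :
    partitionEntropy μ α (insert h A) + partitionEntropy μ α B ≤
      partitionEntropy μ α (insert h B) + partitionEntropy μ α A := by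
  rw [pe_insert μ α hα, pe_insert μ α hα, partitionEntropy_eq_hent, partitionEntropy_eq_hent]
  exact hent_cond μ (fun x => α (h • x))
    (fun s => (hα.comp (measurable_const_smul h)) (measurableSet_singleton s))
    (fun x (g : A) => α ((g : G) • x)) (hmeas_joint α hα A)
    (fun (w : A → Fin k) (b : B) => w ⟨b, hBA b.2⟩)

lemma pe_insert_le (μ : Measure X) [IsProbabilityMeasure μ] {k : ℕ} (α : X → Fin k)
    (hα : Measurable α) (h : G) (A : Finset G) :
    partitionEntropy μ α (insert h A) ≤ partitionEntropy μ α A + Real.log k := by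
  have h1 := pe_submod μ α hα h A ∅ (Finset.empty_subset _)
  rw [pe_empty] at h1
  have h2 : partitionEntropy μ α (insert h (∅ : Finset G)) ≤ Real.log k := by
    have h3 := hent_le_log μ (fun x => α (h • x))
      (fun s => (hα.comp (measurable_const_smul h)) (measurableSet_singleton s))
    rw [Fintype.card_fin] at h3
    refine le_trans ?_ h3
    rw [partitionEntropy_eq_hent]
    have := hent_mono μ (fun x => α (h • x))
      (fun s => (hα.comp (measurable_const_smul h)) (measurableSet_singleton s))
      (fun (w : Fin k) (a : (insert h ∅ : Finset G)) => w)
    refine le_trans (le_of_eq ?_) this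
    congr 1
    ext x a
    have := a.2
    simp only [Finset.mem_insert, Finset.notMem_empty, or_false] at this
    simp [this]
  linarith

/-- The averaging step in Misiurewicz's argument. -/
lemma pe_misiurewicz (σ ν : Measure X) [IsProbabilityMeasure σ] [IsProbabilityMeasure ν]
    {k : ℕ} (α : X → Fin k) (hα : Measurable α) (F T : Finset G) (hF : F.Nonempty)
    (hν : ∀ B, MeasurableSet B →
      ν.real B = ∑ g ∈ F, (F.card : ℝ)⁻¹ * σ.real ((fun x => g • x) ⁻¹' B)) :
    T.card * partitionEntropy σ α F ≤ F.card * partitionEntropy ν α T +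
      T.card * (∑ t ∈ T, ((symmDiff F (F.image (t * ·))).card : ℝ)) * Real.log k := by
  have hk : 0 ≤ Real.log k := Real.log_natCast_nonneg k
  have hFc : (0 : ℝ) < F.card := by exact_mod_cast hF.card_pos
  set F' := F.filter (fun h => ∀ t ∈ T, t⁻¹ * h ∈ F) with hF'
  have hcard : ((F \ F').card : ℝ) ≤ ∑ t ∈ T, ((symmDiff F (F.image (t * ·))).card : ℝ) := by
    have : F \ F' ⊆ T.biUnion fun t => symmDiff F (F.image (t * ·)) := by
      intro h hh
      simp only [hF', Finset.mem_sdiff, Finset.mem_filter, not_and, not_forall] at hh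
      obtain ⟨h1, h2⟩ := hh
      obtain ⟨t, ht, h3⟩ := h2 h1
      rw [Finset.mem_biUnion]
      refine ⟨t, ht, ?_⟩
      rw [Finset.mem_symmDiff]
      left
      refine ⟨h1, ?_⟩
      rw [Finset.mem_image]
      rintro ⟨a, ha, rfl⟩
      exact h3 (by simpa using ha)
    exact_mod_cast (Finset.card_le_card this).trans Finset.card_biUnion_le
  have h1 : partitionEntropy σ α F ≤ partitionEntropy σ α F' + (F \ F').card * Real.log k := by
    have := hunion_le (partitionEntropy σ α) (Real.log k) (pe_insert_le σ α hα) F' (F \ F')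
    rwa [Finset.union_sdiff_of_subset (Finset.filter_subset _ _)] at this
  have h2 : T.card * partitionEntropy σ α F' ≤
      ∑ g ∈ F, partitionEntropy σ α (T.image (· * g)) := by
    refine hshearer (partitionEntropy σ α) (pe_empty σ α) (pe_mono σ α hα)
      (pe_submod σ α hα) F _ T.card F' ?_
    intro h hh
    rw [hF', Finset.mem_filter] at hh
    refine Finset.card_le_card_of_injOn (fun t => t⁻¹ * h) ?_ ?_
    · intro t ht
      simp only [Finset.coe_filter, Set.mem_ofPred_eq, Finset.mem_image]
      exact ⟨hh.2 t ht, t, ht, by group⟩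
    · intro a _ b _ hab
      simpa using hab
  have h3 : ∀ g ∈ F, partitionEntropy σ α (T.image (· * g)) ≤
      ∑ u : T → Fin k, Real.negMulLog
        (σ.real ((fun x => g • x) ⁻¹' ((fun x (t : T) => α ((t : G) • x)) ⁻¹' {u}))) := by
    intro g _
    rw [partitionEntropy_eq_hent]
    have hm : ∀ s : (T.image (· * g) : Finset G), (s : G) * g⁻¹ ∈ T := by
      intro s
      obtain ⟨t, ht, h⟩ := Finset.mem_image.1 s.2
      rw [← h]; simpa using ht
    have := hent_mono σ (fun x (t : T) => α ((t : G) • g • x)) (fun u =>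
      (measurable_const_smul g) (hmeas_joint α hα T u))
      (fun (w : T → Fin k) (s : (T.image (· * g) : Finset G)) => w ⟨s * g⁻¹, hm s⟩)
    refine le_trans (le_of_eq ?_) this
    congr 1
    ext x s
    simp [smul_smul]
  have h4 : ∑ g ∈ F, partitionEntropy σ α (T.image (· * g)) ≤
      F.card * partitionEntropy ν α T := by
    refine (Finset.sum_le_sum h3).trans ?_
    rw [Finset.sum_comm, partitionEntropy_eq_hent, hent, Finset.mul_sum]
    refine Finset.sum_le_sum fun u _ => ?_
    rw [hν _ (hmeas_joint α hα T u)]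
    have := Real.concaveOn_negMulLog.le_map_sum (t := F) (w := fun _ => (F.card : ℝ)⁻¹)
      (p := fun g => σ.real ((fun x => g • x) ⁻¹' ((fun x (t : T) => α ((t : G) • x)) ⁻¹' {u})))
      (fun _ _ => by positivity) (by simp [hFc.ne']) (fun _ _ => measureReal_nonneg)
    simp only [smul_eq_mul] at this
    rw [← Finset.mul_sum] at this
    rw [inv_mul_le_iff₀ hFc] at this
    exact this
  have hT : (0 : ℝ) ≤ T.card := by positivity
  calc T.card * partitionEntropy σ α F
      ≤ T.card * (partitionEntropy σ α F' + (F \ F').card * Real.log k) := by gcongr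
    _ ≤ T.card * (partitionEntropy σ α F' +
        (∑ t ∈ T, ((symmDiff F (F.image (t * ·))).card : ℝ)) * Real.log k) := by gcongr
    _ ≤ _ := by linarith

end Helpers2

section Helpers3

lemma hfrontier_iInter {X ι : Type*} [TopologicalSpace X] [MeasurableSpace X] [Finite ι]
    (μ : Measure X) (s : ι → Set X) (h : ∀ i, μ (frontier (s i)) = 0) :
    μ (frontier (⋂ i, s i)) = 0 := by
  have hsub : frontier (⋂ i, s i) ⊆ ⋃ i, frontier (s i) := by
    intro x hx
    rw [frontier, interior_iInter_of_finite] at hx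
    obtain ⟨h1, h2⟩ := hx
    rw [mem_iInter, not_forall] at h2
    obtain ⟨i, hi⟩ := h2
    exact mem_iUnion.2 ⟨i, closure_mono (iInter_subset _ i) h1, hi⟩
  have := Fintype.ofFinite ι
  exact measure_mono_null hsub (measure_iUnion_null h)

variable {X : Type*} [MetricSpace X] [CompactSpace X] [MeasurableSpace X] [BorelSpace X]

lemma hexists_partition (μ : Measure X) [IsProbabilityMeasure μ] {ε : ℝ} (hε : 0 < ε) :
    ∃ (k : ℕ) (α : X → Fin k), Measurable α ∧ (∀ x y, α x = α y → dist x y ≤ ε) ∧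
      ∀ i, μ (frontier (α ⁻¹' {i})) = 0 := by
  classical
  have hr : ∀ x : X, ∃ r ∈ Ioo 0 (ε / 2), μ (frontier (Metric.ball x r)) = 0 := by
    intro x
    obtain ⟨r, hr, h⟩ := exists_null_frontier_thickening μ {x} (half_pos hε)
    rw [Metric.thickening_singleton] at h
    exact ⟨r, hr, h⟩
  choose r hr hr0 using hr
  obtain ⟨t, -, ht⟩ := isCompact_univ.elim_nhds_subcover (fun x => Metric.ball x (r x))
    (fun x _ => Metric.ball_mem_nhds x (hr x).1)
  let c : X → (t → Bool) := fun x i => decide (x ∈ Metric.ball (i : X) (r i))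
  let e := Fintype.equivFin (t → Bool)
  have hpre : ∀ i, (fun x => e (c x)) ⁻¹' {i} = ⋂ j : t,
      (if e.symm i j then Metric.ball (j : X) (r j) else (Metric.ball (j : X) (r j))ᶜ) := by
    intro i
    ext x
    rw [mem_preimage, mem_singleton_iff, ← Equiv.eq_symm_apply, funext_iff, mem_iInter]
    refine forall_congr' fun j => ?_
    by_cases hj : e.symm i j = true
    · simp [c, hj]
    · rw [Bool.not_eq_true] at hj
      simp [c, hj]
  refine ⟨_, fun x => e (c x), ?_, ?_, ?_⟩
  · refine measurable_to_countable' fun i => ?_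
    rw [hpre]
    refine MeasurableSet.iInter fun j => ?_
    split_ifs
    · exact measurableSet_ball
    · exact measurableSet_ball.compl
  · intro x y hxy
    have hxy := e.injective hxy
    obtain ⟨z, hz, hx⟩ := mem_iUnion₂.1 (ht (mem_univ x))
    have h1 := congrFun hxy ⟨z, hz⟩
    simp only [c, decide_eq_decide] at h1
    have hy := h1.1 hx
    rw [Metric.mem_ball] at hx hy
    have := dist_triangle_right x y z
    have := (hr z).2
    linarith
  · intro i
    rw [hpre]
    refine hfrontier_iInter μ _ fun j => ?_
    split_ifs
    · exact hr0 _
    · rw [frontier_compl]; exact hr0 _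

variable {G : Type*} [Group G] [DecidableEq G] [MulAction G X] [ContinuousConstSMul G X]

lemma pe_tendsto (μ : ProbabilityMeasure X) (hinv : InvariantMeasure G (μ : Measure X))
    (ν : ℕ → ProbabilityMeasure X) (hν : Tendsto ν atTop (𝓝 μ)) {k : ℕ} (α : X → Fin k)
    (hα : ∀ i, (μ : Measure X) (frontier (α ⁻¹' {i})) = 0) (T : Finset G) :
    Tendsto (fun n => partitionEntropy (ν n : Measure X) α T) atTop
      (𝓝 (partitionEntropy (μ : Measure X) α T)) := by
  unfold partitionEntropy
  refine tendsto_finsetSum _ fun f _ => ?_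
  refine (Real.continuous_negMulLog.tendsto _).comp ?_
  refine (ENNReal.tendsto_toReal (measure_ne_top _ _)).comp ?_
  refine ProbabilityMeasure.tendsto_measure_of_null_frontier_of_tendsto' hν ?_
  have : {x | ∀ g : T, α ((g : G) • x) = f g} =
      ⋂ g : T, (fun x => (g : G) • x) ⁻¹' (α ⁻¹' {f g}) := by
    ext x; simp
  rw [this]
  refine hfrontier_iInter _ _ fun g => ?_
  have h2 := (Homeomorph.smul (g : G)).preimage_frontier (X := X) (α ⁻¹' {f g})
  change (fun x => (g : G) • x) ⁻¹' _ = frontier ((fun x => (g : G) • x) ⁻¹' _) at h2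
  rw [← h2]
  have h3 := hinv (g : G)
  rw [← Measure.map_apply (measurable_const_smul _) isClosed_frontier.measurableSet, h3]
  exact hα _

end Helpers3

section Helpers4

variable {X : Type*} [MeasurableSpace X]

lemma hconvex_avg {K : Set (ProbabilityMeasure X)} (hK : ConvexPM K) {ι : Type*}
    (E : Finset ι) (hE : E.Nonempty) (f : ι → Measure X)
    (hf : ∀ x ∈ E, ∃ ν ∈ K, (ν : Measure X) = f x) :
    ∃ ν ∈ K, (ν : Measure X) = (E.card : ℝ≥0)⁻¹ • ∑ x ∈ E, f x := by
  induction hE using Finset.Nonempty.cons_induction with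
  | singleton a =>
    obtain ⟨ν, h1, h2⟩ := hf a (by simp)
    exact ⟨ν, h1, by simp [h2]⟩
  | cons a s ha hs ih =>
    obtain ⟨ν₂, h1, h2⟩ := ih fun x hx => hf x (by simp [hx])
    obtain ⟨ν₁, h3, h4⟩ := hf a (by simp)
    have hc : (0 : ℝ≥0) < s.card := by exact_mod_cast hs.card_pos
    set t : ℝ≥0 := ((s.card : ℝ≥0) + 1)⁻¹ with ht
    have ht1 : t ≤ 1 := by
      rw [ht]; exact inv_le_one_of_one_le₀ (by simp)
    have hp : IsProbabilityMeasure (t • (ν₁ : Measure X) + (1 - t) • (ν₂ : Measure X)) := by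
      constructor
      have : t + (1 - t) = 1 := add_tsub_cancel_of_le ht1
      simp only [Measure.add_apply, Measure.smul_apply, measure_univ]
      rw [← add_smul, this, one_smul]
    refine ⟨⟨_, hp⟩, hK ν₁ h3 ν₂ h1 t ht1 _ rfl, ?_⟩
    have h1t : (1 - t) * (s.card : ℝ≥0)⁻¹ = t := by
      have : 1 - t = s.card * t := by
        apply tsub_eq_of_eq_add
        rw [ht]; field_simp
      rw [this]; field_simp
    change t • (ν₁ : Measure X) + (1 - t) • (ν₂ : Measure X) = _
    rw [h2, h4, smul_smul, h1t, Finset.sum_cons, Finset.card_cons, ← smul_add]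
    push_cast
    rfl

/-- Uniform measure on a finite set. -/
noncomputable def hunif (E : Finset X) : Measure X :=
  (E.card : ℝ≥0)⁻¹ • ∑ x ∈ E, Measure.dirac x

lemma hsum_real {ι : Type*} (E : Finset ι) (f : ι → Measure X) (B : Set X)
    (h : ∀ i ∈ E, f i B ≠ ⊤) : (∑ i ∈ E, f i).real B = ∑ i ∈ E, (f i).real B := by
  simp only [Measure.real, Measure.finsetSum_apply]
  exact ENNReal.toReal_sum h

lemma hunif_real (E : Finset X) (B : Set X) :
    (hunif E).real B = (E.card : ℝ)⁻¹ * ∑ x ∈ E, (Measure.dirac x).real B := by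
  unfold hunif
  rw [measureReal_nnreal_smul_apply, hsum_real _ _ _ fun _ _ => measure_ne_top _ _]
  simp

lemma hunif_prob (E : Finset X) (hE : E.Nonempty) : IsProbabilityMeasure (hunif E) := by
  constructor
  have : (E.card : ℝ≥0) ≠ 0 := by exact_mod_cast hE.card_pos.ne'
  simp only [hunif, Measure.smul_apply, Measure.finsetSum_apply, measure_univ, Finset.sum_const,
    nsmul_eq_mul, mul_one]
  rw [ENNReal.smul_def, smul_eq_mul, ENNReal.coe_inv this]
  simp only [ENNReal.coe_natCast]
  exact ENNReal.inv_mul_cancel (by exact_mod_cast this) (by simp)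

lemma hent_unif (E : Finset X) (hE : E.Nonempty) {S : Type*} [Fintype S] (Y : X → S)
    (hY : ∀ s, MeasurableSet (Y ⁻¹' {s})) (hinj : ∀ x ∈ E, ∀ y ∈ E, Y x = Y y → x = y) :
    Real.log E.card ≤ hent (hunif E) Y := by
  classical
  have hc : (0 : ℝ) < E.card := by exact_mod_cast hE.card_pos
  have h1 : ∀ s, (hunif E).real (Y ⁻¹' {s}) =
      (E.card : ℝ)⁻¹ * ((E.filter fun x => Y x = s).card : ℝ) := by
    intro s
    rw [hunif_real, Finset.card_filter]
    push_cast
    congr 1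
    refine Finset.sum_congr rfl fun x _ => ?_
    rw [Measure.real, Measure.dirac_apply' _ (hY s)]
    by_cases h : Y x = s <;> simp [indicator, h]
  have h2 : ∀ s, Real.negMulLog ((hunif E).real (Y ⁻¹' {s})) =
      ((E.filter fun x => Y x = s).card : ℝ) * ((E.card : ℝ)⁻¹ * Real.log E.card) := by
    intro s
    rw [h1]
    have : (E.filter fun x => Y x = s).card ≤ 1 := by
      rw [Finset.card_le_one]
      intro a ha b hb
      rw [Finset.mem_filter] at ha hb
      exact hinj a ha.1 b hb.1 (ha.2.trans hb.2.symm)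
    interval_cases h : (E.filter fun x => Y x = s).card
    · simp
    · simp [Real.negMulLog]
  unfold hent
  simp only [h2]
  rw [← Finset.sum_mul, ← Nat.cast_sum,
    ← Finset.card_eq_sum_card_fiberwise (f := Y) (fun x _ => Finset.mem_coe.2 (Finset.mem_univ (Y x)))]
  rw [← mul_assoc, mul_inv_cancel₀ hc.ne', one_mul]

end Helpers4
section Main0

lemma hsep_main {G : Type*} [Group G] [DecidableEq G]
    {X : Type*} [MetricSpace X] [CompactSpace X] [MulAction G X] [ContinuousConstSMul G X]
    [MeasurableSpace X] [BorelSpace X] {K : Set (ProbabilityMeasure X)} (hK : ConvexPM K)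
    {ε : ℝ} (F : Finset G) (hF : F.Nonempty) (E : Finset X) (hE : E.Nonempty)
    (hEK : ∀ x ∈ E, ∃ ν ∈ K, (ν : Measure X) = empiricalMeasure F x)
    (hsep : IsSeparatedSet F ε (E : Set X)) {k : ℕ} (α : X → Fin k) (hα : Measurable α)
    (hdist : ∀ x y, α x = α y → dist x y ≤ ε) :
    ∃ ν ∈ K, ∀ T : Finset G, T.Nonempty →
      Real.log E.card / F.card ≤ partitionEntropy (ν : Measure X) α T / T.card +
        (∑ t ∈ T, ((symmDiff F (F.image (t * ·))).card : ℝ) / F.card) * Real.log k := by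
  obtain ⟨ν, hνK, hν⟩ := hconvex_avg hK E hE (fun x => empiricalMeasure F x) hEK
  refine ⟨ν, hνK, fun T hT => ?_⟩
  have := hunif_prob E hE
  have hFc : (0 : ℝ) < F.card := by exact_mod_cast hF.card_pos
  have hTc : (0 : ℝ) < T.card := by exact_mod_cast hT.card_pos
  have hemp : ∀ (x : X) (B : Set X), (empiricalMeasure F x).real B =
      (F.card : ℝ)⁻¹ * ∑ g ∈ F, (Measure.dirac (g • x)).real B := by
    intro x B
    unfold empiricalMeasure
    rw [measureReal_ennreal_smul_apply, hsum_real _ _ _ fun _ _ => measure_ne_top _ _]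
    simp
  have hne : ∀ x ∈ E, ∀ B, empiricalMeasure F x B ≠ ⊤ := by
    intro x hx B
    obtain ⟨ν, -, h⟩ := hEK x hx
    rw [← h]
    exact measure_ne_top _ _
  have hm := pe_misiurewicz (hunif E) (ν : Measure X) α hα F T hF (by
    intro B hB
    rw [hν, measureReal_nnreal_smul_apply, hsum_real _ _ _ fun x hx => hne x hx B]
    simp only [hemp, hunif_real]
    have : ∀ (g : G) (x : X), (Measure.dirac x).real ((fun x => g • x) ⁻¹' B) =
        (Measure.dirac (g • x)).real B := by
      intro g x
      rw [Measure.real, Measure.real, Measure.dirac_apply' _ hB,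
        Measure.dirac_apply' _ (measurable_const_smul g hB)]
      rfl
    simp only [this]
    rw [← Finset.mul_sum, ← Finset.mul_sum, ← Finset.mul_sum, Finset.sum_comm]
    simp only [NNReal.coe_inv, NNReal.coe_natCast]
    ring)
  have hl : Real.log E.card ≤ partitionEntropy (hunif E) α F := by
    rw [partitionEntropy_eq_hent]
    refine hent_unif E hE _ (hmeas_joint α hα F) ?_
    intro x hx y hy hxy
    by_contra hne
    obtain ⟨g, hg, h⟩ := hsep x hx y hy hne
    exact absurd (hdist _ _ (congrFun hxy ⟨g, hg⟩)) (not_le.2 h)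
  have h1 := (mul_le_mul_of_nonneg_left hl hTc.le).trans hm
  rw [← Finset.sum_div, div_add' _ _ _ hTc.ne', div_le_div_iff₀ hFc hTc]
  have : (∑ t ∈ T, ((symmDiff F (F.image (t * ·))).card : ℝ)) / F.card * F.card =
      ∑ t ∈ T, ((symmDiff F (F.image (t * ·))).card : ℝ) := div_mul_cancel₀ _ hFc.ne'
  linear_combination h1 - Real.log k * T.card * this

end Main0

variable {G : Type*} [Group G] [Countable G] [Infinite G] [DecidableEq G]
  {X : Type*} [MetricSpace X] [CompactSpace X] [MulAction G X] [ContinuousConstSMul G X]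
  [MeasurableSpace X] [BorelSpace X]

theorem separated_growth_rate_le_measEntropy
    (F : ℕ → Finset G) (hFol : IsFolnerSeq F)
    (μ : ProbabilityMeasure X) (hinv : InvariantMeasure G (μ : Measure X))
    (herg : ErgodicMeasure G (μ : Measure X))
    (K : ℕ → Set (ProbabilityMeasure X))
    (hdec : ∀ m, K (m + 1) ⊆ K m) (hcl : ∀ m, IsClosed (K m))
    (hconv : ∀ m, ConvexPM (K m)) (hnbhd : ∀ m, K m ∈ 𝓝 μ)
    (hinter : ⋂ m, K m = {μ}) :
    (⨆ (ε : ℝ) (_ : 0 < ε), ⨅ m : ℕ, limsup (fun n =>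
        ⨆ (E : Finset X) (_ : (E : Set X) ⊆ {x : X | ∃ ν ∈ K m,
              (ν : Measure X) = empiricalMeasure (F n) x} ∧
            IsSeparatedSet (F n) ε (E : Set X)),
          ENNReal.ofReal (Real.log E.card / (F n).card)) atTop)
      ≤ measEntropy F (μ : Measure X) := by
  classical
  refine iSup₂_le fun ε hε => ?_
  obtain ⟨k, α, hα, hdist, hfr⟩ := hexists_partition (μ : Measure X) hε
  refine le_of_forall_lt fun c' hc' => ?_
  have hc'top : c' ≠ ⊤ := ne_top_of_lt hc'
  lift c' to ℝ≥0 using hc'top with c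
  obtain ⟨d, hcd, hd⟩ := ENNReal.lt_iff_exists_nnreal_btwn.1 hc'
  refine hcd.trans_le ?_
  have hanti : Antitone K := antitone_nat_of_succ_le hdec
  have hex : ∀ m : ℕ, ∃ n, m ≤ n ∧ ∃ E : Finset X, ((E : Set X) ⊆ {x : X | ∃ ν ∈ K m,
              (ν : Measure X) = empiricalMeasure (F n) x} ∧
            IsSeparatedSet (F n) ε (E : Set X)) ∧
            (d : ℝ≥0∞) < ENNReal.ofReal (Real.log E.card / (F n).card) := by
    intro m
    have h1 := hd.trans_le (iInf_le _ m)
    have h2 := frequently_lt_of_lt_limsup (by isBoundedDefault) h1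
    obtain ⟨n, hn, h3⟩ := (frequently_atTop.1 h2) m
    obtain ⟨E, h4⟩ := lt_iSup_iff.1 h3
    obtain ⟨h5, h6⟩ := lt_iSup_iff.1 h4
    exact ⟨n, hn, E, h5, h6⟩
  choose n hn E hE hEd using hex
  have hEd' : ∀ m, (d : ℝ) < Real.log (E m).card / (F (n m)).card := by
    intro m
    have := hEd m
    rw [← ENNReal.ofReal_coe_nnreal] at this
    exact (ENNReal.ofReal_lt_ofReal_iff_of_nonneg d.2).1 this
  have hEne : ∀ m, (E m).Nonempty := by
    intro m
    rw [Finset.nonempty_iff_ne_empty]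
    intro h
    have := hEd' m
    rw [h] at this
    simp at this
  have hex2 := fun m => hsep_main (hconv m) (F (n m)) (hFol.1 _) (E m) (hEne m)
    (fun x hx => (hE m).1 hx) (hE m).2 α hα hdist
  choose ν hνK hν using hex2
  have hνlim : Tendsto ν atTop (𝓝 μ) := by
    rw [tendsto_def]
    intro U hU
    obtain ⟨m, hm⟩ := exists_subset_nhds_of_isCompact' (V := K) hanti.directed_ge
      (fun m => (hcl m).isCompact) hcl (U := U) (by
        intro x hx
        rw [hinter] at hx
        rw [hx]; exact hU)
    filter_upwards [eventually_ge_atTop m] with j hj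
    exact hm (hanti hj (hνK j))
  have hnlim : Tendsto n atTop atTop := tendsto_atTop_mono hn tendsto_id
  have hT : ∀ T : Finset G, T.Nonempty →
      (d : ℝ) ≤ partitionEntropy (μ : Measure X) α T / T.card := by
    intro T hT
    have hlim : Tendsto (fun m => partitionEntropy (ν m : Measure X) α T / T.card +
        (∑ t ∈ T, ((symmDiff (F (n m)) ((F (n m)).image (t * ·))).card : ℝ) / (F (n m)).card)
          * Real.log k) atTop
        (𝓝 (partitionEntropy (μ : Measure X) α T / T.card + (∑ t ∈ T, 0) * Real.log k)) := by
      refine ((pe_tendsto μ hinv ν hνlim α hfr T).div_const _).add (Tendsto.mul_const _ ?_)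
      exact tendsto_finsetSum _ fun t _ => (hFol.2 t).comp hnlim
    simp only [Finset.sum_const_zero, zero_mul, add_zero] at hlim
    exact ge_of_tendsto' hlim fun m => (hEd' m).le.trans (hν m T hT)
  refine le_trans ?_ (le_iSup_of_le k (le_iSup_of_le α (le_iSup_of_le hα le_rfl)))
  refine le_limsup_of_frequently_le (Eventually.frequently (Eventually.of_forall fun j => ?_))
    (by isBoundedDefault)
  rw [← ENNReal.ofReal_coe_nnreal]
  exact ENNReal.ofReal_le_ofReal (hT (F j) (hFol.1 j))
end

section
/- Let G be a countable discrete infinite amenable group acting continuously on a compact metric space (X,d), let {F_n} be a Følner sequence in G satisfying lim_{n→∞} |F_n|/log n = ∞, and let μ be an ergodic G-invariant Borel probability measure on X. Then h^B_top(G_μ,{F_n}) ≤ h_μ(X,G), where G_μ = {x ∈ X : (1/|F_n|) Σ_{g∈F_n} f(gx) → ∫_X f dμ for every continuous f : X → ℝ}. -/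
open MeasureTheory Filter Set
open scoped Pointwise ENNReal NNReal Topology

lemma aux_shearer {G ι : Type*} [DecidableEq G] (φ : Finset G → ℝ) (C : ℝ) (h0 : φ ∅ = 0)
    (hsub : ∀ (A B : Finset G) (a : G), B ⊆ A → a ∉ A →
      φ (insert a A) - φ A ≤ φ (insert a B) - φ B)
    (hC : ∀ a, φ {a} ≤ C) (I : Finset ι) (S : ι → Finset G) (K : ℕ) (A : Finset G)
    (hcnt : ∀ a ∈ A, (I.filter (fun i => a ∈ S i)).card ≤ K) :
    (K : ℝ) * φ A ≤ ∑ i ∈ I, φ (S i ∩ A)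
      + C * ∑ a ∈ A, ((K : ℝ) - (I.filter (fun i => a ∈ S i)).card) := by
  induction A using Finset.induction_on with
  | empty => simp [h0]
  | insert a A ha ih =>
    have ih' := ih (fun b hb => hcnt b (Finset.mem_insert_of_mem hb))
    have hK := hcnt a (Finset.mem_insert_self _ _)
    set c := (I.filter (fun i => a ∈ S i)).card with hc
    have h1 : φ (insert a A) - φ A ≤ C := by
      have := hsub A ∅ a (by simp) ha
      have := hC a
      simp only [insert_empty_eq, h0] at *
      linarith
    have h2 : ∑ i ∈ I, φ (S i ∩ A) + (c : ℝ) * (φ (insert a A) - φ A)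
        ≤ ∑ i ∈ I, φ (S i ∩ insert a A) := by
      have : (c : ℝ) * (φ (insert a A) - φ A)
          = ∑ i ∈ I, if a ∈ S i then (φ (insert a A) - φ A) else 0 := by
        rw [← Finset.sum_filter, Finset.sum_const, nsmul_eq_mul]
      rw [this, ← Finset.sum_add_distrib]
      refine Finset.sum_le_sum fun i _ => ?_
      split_ifs with h
      · rw [Finset.inter_insert_of_mem h]
        have := hsub A (S i ∩ A) a Finset.inter_subset_right ha
        linarith
      · rw [Finset.inter_insert_of_notMem h]; simp
    rw [Finset.sum_insert ha]
    have hK' : (0:ℝ) ≤ (K:ℝ) - c := by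
      have : (c:ℝ) ≤ K := by exact_mod_cast hK
      linarith
    nlinarith [mul_le_mul_of_nonneg_left h1 hK']

/-- number of points of `Ω` sharing the name of `x` on `A`. -/
noncomputable def auxC {G X ι : Type*} [DecidableEq ι] (Ω : Finset X) (nm : X → G → ι)
    (A : Finset G) (x : X) : ℕ := (Ω.filter (fun y => ∀ h ∈ A, nm y h = nm x h)).card

lemma auxC_pos {G X ι : Type*} [DecidableEq ι] (Ω : Finset X) (nm : X → G → ι)
    (A : Finset G) (x : X) (hx : x ∈ Ω) : 0 < auxC Ω nm A x :=
  Finset.card_pos.2 ⟨x, by simp [hx]⟩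

lemma auxC_congr {G X ι : Type*} [DecidableEq ι] (Ω : Finset X) (nm : X → G → ι)
    (A : Finset G) (x y : X) (h : ∀ g ∈ A, nm x g = nm y g) :
    auxC Ω nm A x = auxC Ω nm A y := by
  unfold auxC
  congr 1
  apply Finset.filter_congr
  intro z _
  exact forall₂_congr fun g hg => by rw [h g hg]

lemma aux_sub_sum {G X ι : Type*} [DecidableEq ι] [DecidableEq G] (Ω : Finset X) (nm : X → G → ι)
    (A B : Finset G) (a : G) (hBA : B ⊆ A) :
    ∑ x ∈ Ω, ((auxC Ω nm A x : ℝ) * auxC Ω nm (insert a B) x /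
      (auxC Ω nm (insert a A) x * auxC Ω nm B x)) ≤ Ω.card := by
  classical
  -- relation
  set R : Finset G → X → X → Prop := fun A y x => ∀ h ∈ A, nm y h = nm x h with hR
  have hc : ∀ A x, (auxC Ω nm A x : ℝ) = ∑ y ∈ Ω, if R A y x then (1:ℝ) else 0 := by
    intro A x
    rw [Finset.sum_boole]; rfl
  have e1 : ∑ x ∈ Ω, ((auxC Ω nm A x : ℝ) * auxC Ω nm (insert a B) x /
      (auxC Ω nm (insert a A) x * auxC Ω nm B x)) =
      ∑ y ∈ Ω, ∑ z ∈ Ω, ∑ x ∈ Ω, if R A z x ∧ R (insert a B) y x then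
        ((auxC Ω nm (insert a A) x : ℝ) * auxC Ω nm B x)⁻¹ else 0 := by
    rw [Finset.sum_comm]
    have : ∀ z ∈ Ω, (∑ y ∈ Ω, ∑ x ∈ Ω, if R A z x ∧ R (insert a B) y x then
        ((auxC Ω nm (insert a A) x : ℝ) * auxC Ω nm B x)⁻¹ else 0)
        = ∑ x ∈ Ω, ∑ y ∈ Ω, if R A z x ∧ R (insert a B) y x then
        ((auxC Ω nm (insert a A) x : ℝ) * auxC Ω nm B x)⁻¹ else 0 := fun z _ => Finset.sum_comm
    rw [Finset.sum_congr rfl this, Finset.sum_comm]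
    refine Finset.sum_congr rfl fun x _ => ?_
    rw [hc A x, hc (insert a B) x, div_eq_mul_inv, Finset.sum_mul_sum, Finset.sum_mul]
    refine Finset.sum_congr rfl fun z _ => ?_
    rw [Finset.sum_mul]
    refine Finset.sum_congr rfl fun y _ => ?_
    by_cases h1 : R A z x <;> by_cases h2 : R (insert a B) y x <;> simp [h1, h2]
  rw [e1, Finset.card_eq_sum_ones, Nat.cast_sum]
  refine Finset.sum_le_sum fun y hy => ?_
  have hBy : (0:ℝ) < auxC Ω nm B y := by exact_mod_cast auxC_pos Ω nm B y hy
  have key : ∀ z ∈ Ω, (∑ x ∈ Ω, if R A z x ∧ R (insert a B) y x then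
        ((auxC Ω nm (insert a A) x : ℝ) * auxC Ω nm B x)⁻¹ else 0)
        ≤ if R B z y then (auxC Ω nm B y : ℝ)⁻¹ else 0 := by
    intro z hz
    by_cases hex : ∃ x0 ∈ Ω, R A z x0 ∧ R (insert a B) y x0
    · obtain ⟨x0, hx0, h1, h2⟩ := hex
      have hzy : R B z y := fun h hh => (h1 h (hBA hh)).trans
        (h2 h (Finset.mem_insert_of_mem hh)).symm
      rw [if_pos hzy]
      have hp : (0:ℝ) < auxC Ω nm (insert a A) x0 := by exact_mod_cast auxC_pos Ω nm _ x0 hx0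
      calc _ ≤ ∑ x ∈ Ω, (if R (insert a A) x x0 then (1:ℝ) else 0) *
            ((auxC Ω nm (insert a A) x0 : ℝ) * auxC Ω nm B y)⁻¹ := by
            refine Finset.sum_le_sum fun x hx => ?_
            split_ifs with hh h3 h3
            · rw [auxC_congr Ω nm _ x x0 h3, auxC_congr Ω nm B x y
                (fun g hg => (hh.2 g (Finset.mem_insert_of_mem hg)).symm), one_mul]
            · exfalso
              apply h3
              intro g hg
              rcases Finset.mem_insert.1 hg with rfl | hg
              · exact (hh.2 _ (Finset.mem_insert_self _ _)).symm.trans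
                  (h2 _ (Finset.mem_insert_self _ _))
              · exact (hh.1 _ hg).symm.trans (h1 _ hg)
            · positivity
            · simp
        _ = _ := by
            rw [← Finset.sum_mul, ← hc, mul_inv, mul_inv_cancel_left₀ hp.ne']
    · push Not at hex
      rw [Finset.sum_eq_zero]
      · split_ifs <;> positivity
      · intro x hx
        rw [if_neg]
        rintro ⟨h1, h2⟩
        exact hex x hx h1 h2
  refine (Finset.sum_le_sum key).trans ?_
  have : ∑ z ∈ Ω, (if R B z y then (auxC Ω nm B y : ℝ)⁻¹ else 0)
     = (∑ z ∈ Ω, if R B z y then (1:ℝ) else 0) * (auxC Ω nm B y : ℝ)⁻¹ := by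
    rw [Finset.sum_mul]; refine Finset.sum_congr rfl fun z _ => by split_ifs <;> simp
  rw [this, ← hc, mul_inv_cancel₀ hBy.ne']; simp

/-- (unnormalised) entropy of the names on `A`. -/
noncomputable def auxPhi {G X ι : Type*} [DecidableEq ι] (Ω : Finset X) (nm : X → G → ι)
    (A : Finset G) : ℝ := Ω.card * Real.log Ω.card - ∑ x ∈ Ω, Real.log (auxC Ω nm A x)

lemma auxPhi_sub {G X ι : Type*} [DecidableEq ι] [DecidableEq G] (Ω : Finset X) (nm : X → G → ι)
    (A B : Finset G) (a : G) (hBA : B ⊆ A) :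
    auxPhi Ω nm (insert a A) - auxPhi Ω nm A ≤ auxPhi Ω nm (insert a B) - auxPhi Ω nm B := by
  have h := aux_sub_sum Ω nm A B a hBA
  have h2 : ∑ x ∈ Ω, (Real.log (auxC Ω nm A x) + Real.log (auxC Ω nm (insert a B) x)
     - Real.log (auxC Ω nm (insert a A) x) - Real.log (auxC Ω nm B x)) ≤
     ∑ x ∈ Ω, ((auxC Ω nm A x : ℝ) * auxC Ω nm (insert a B) x /
      (auxC Ω nm (insert a A) x * auxC Ω nm B x) - 1) := by
    refine Finset.sum_le_sum fun x hx => ?_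
    have p : ∀ A, (0:ℝ) < auxC Ω nm A x := fun A => by exact_mod_cast auxC_pos Ω nm A x hx
    have := Real.log_le_sub_one_of_pos (x := (auxC Ω nm A x : ℝ) * auxC Ω nm (insert a B) x /
      (auxC Ω nm (insert a A) x * auxC Ω nm B x)) (by have := p A; have := p B; have := p (insert a A); have := p (insert a B); positivity)
    rw [Real.log_div (mul_pos (p _) (p _)).ne' (mul_pos (p _) (p _)).ne',
      Real.log_mul (p _).ne' (p _).ne', Real.log_mul (p _).ne' (p _).ne'] at this
    linarith
  simp only [Finset.sum_sub_distrib, Finset.sum_add_distrib, Finset.sum_const, nsmul_eq_mul, mul_one] at h2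
  unfold auxPhi
  linarith

lemma auxPhi_mono {G X ι : Type*} [DecidableEq ι] (Ω : Finset X) (nm : X → G → ι)
    (A B : Finset G) (hBA : B ⊆ A) : auxPhi Ω nm B ≤ auxPhi Ω nm A := by
  unfold auxPhi
  refine sub_le_sub_left (Finset.sum_le_sum fun x hx => ?_) _
  apply Real.log_le_log
  · exact_mod_cast auxC_pos Ω nm A x hx
  · unfold auxC
    apply Nat.cast_le.2
    refine Finset.card_le_card fun y hy => ?_
    rw [Finset.mem_filter] at hy ⊢
    exact ⟨hy.1, fun g hg => hy.2 g (hBA hg)⟩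

lemma auxPhi_eq {G X ι S : Type*} [DecidableEq ι] [Fintype S] [DecidableEq S]
    (Ω : Finset X) (hΩ : Ω.Nonempty) (nm : X → G → ι)
    (A : Finset G) (κ : X → S) (hκ : ∀ x y, κ x = κ y ↔ ∀ h ∈ A, nm x h = nm y h) :
    auxPhi Ω nm A = Ω.card * ∑ f : S,
      Real.negMulLog (((Ω.filter (fun x => κ x = f)).card : ℝ) / Ω.card) := by
  have hN : (0:ℝ) < Ω.card := by exact_mod_cast hΩ.card_pos
  have hc : ∀ x, auxC Ω nm A x = (Ω.filter (fun y => κ y = κ x)).card := by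
    intro x; unfold auxC; congr 1; ext y; simp [hκ]
  have h1 : ∑ x ∈ Ω, Real.log (auxC Ω nm A x) = ∑ f : S, ∑ x ∈ Ω with κ x = f,
     Real.log (auxC Ω nm A x) := (Finset.sum_fiberwise Ω κ _).symm
  have h2 : (Ω.card : ℝ) = ∑ f : S, ((Ω.filter (fun x => κ x = f)).card : ℝ) := by
    rw [← Nat.cast_sum, ← Finset.card_eq_sum_card_fiberwise (fun x _ => by simp)]
  unfold auxPhi
  rw [h1]
  conv_lhs => rw [h2, Finset.sum_mul, ← h2]
  rw [← Finset.sum_sub_distrib, Finset.mul_sum]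
  refine Finset.sum_congr rfl fun f _ => ?_
  have h3 : ∑ x ∈ Ω with κ x = f, Real.log (auxC Ω nm A x) =
     ((Ω.filter (fun x => κ x = f)).card : ℝ) * Real.log (Ω.filter (fun x => κ x = f)).card := by
    rw [← nsmul_eq_mul, ← Finset.sum_const]
    refine Finset.sum_congr rfl fun x hx => ?_
    rw [hc, (Finset.mem_filter.1 hx).2]
  rw [h3]
  rcases Nat.eq_zero_or_pos (Ω.filter (fun x => κ x = f)).card with h | h
  · simp [h]
  · have h' : (0:ℝ) < (Ω.filter (fun x => κ x = f)).card := by exact_mod_cast h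
    rw [Real.negMulLog, Real.log_div h'.ne' hN.ne']
    field_simp
    ring

lemma aux_negMulLog_le_one (x : ℝ) (hx : 0 ≤ x) : Real.negMulLog x ≤ 1 := by
  rcases hx.eq_or_lt with rfl | h
  · simp
  · have := Real.one_sub_inv_le_log_of_pos h
    have h2 : x * (1 - x⁻¹) ≤ x * Real.log x := by gcongr
    rw [mul_sub, mul_inv_cancel₀ h.ne'] at h2
    rw [Real.negMulLog]
    linarith

lemma aux_count {G X : Type*} [Group G] [DecidableEq G] [MulAction G X] {k : ℕ}
    (α : X → Fin k) (Ω : Finset X) (hΩ : Ω.Nonempty) (T E : Finset G) (hE : E.Nonempty)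
    (hinj : ∀ x ∈ Ω, ∀ y ∈ Ω, (∀ g ∈ E, α (g • x) = α (g • y)) → x = y) :
    (T.card : ℝ) * Real.log Ω.card ≤ E.card * ∑ f : T → Fin k, Real.negMulLog
      ((∑ x ∈ Ω, ((E.filter (fun g => ∀ t : T, α ((t : G) • g • x) = f t)).card : ℝ) / E.card)
        / Ω.card)
      + k * ∑ t ∈ T, ((symmDiff E (E.image (t * ·))).card : ℝ) := by
  have hN : (0:ℝ) < Ω.card := by exact_mod_cast hΩ.card_pos
  have hEp : (0:ℝ) < E.card := by exact_mod_cast hE.card_pos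
  set nm : X → G → Fin k := fun x g => α (g • x) with hnm
  have hcnt : ∀ a, (E.filter (fun g => a ∈ T.image (· * g))).card
      = (T.filter (fun t => t⁻¹ * a ∈ E)).card := by
    intro a
    refine Finset.card_bij' (fun g _ => a * g⁻¹) (fun t _ => t⁻¹ * a) ?_ ?_ ?_ ?_
    · intro g hg
      simp only [Finset.mem_filter, Finset.mem_image] at hg ⊢
      obtain ⟨hg, t, ht, rfl⟩ := hg
      simpa using ⟨ht, hg⟩
    · intro t ht
      simp only [Finset.mem_filter, Finset.mem_image] at ht ⊢
      exact ⟨ht.2, t, ht.1, by simp⟩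
    · intro g _; simp
    · intro t _; simp
  have hsh := aux_shearer (auxPhi Ω nm) (Ω.card * k)
    (by simp [auxPhi, auxC]) (fun A B a h _ => auxPhi_sub Ω nm A B a h)
    (by
      intro a
      rw [auxPhi_eq Ω hΩ nm {a} (fun x => nm x a) (by simp)]
      gcongr
      refine (Finset.sum_le_sum (g := fun _ => (1:ℝ)) fun f _ => ?_).trans (by simp)
      exact aux_negMulLog_le_one _ (by positivity))
    E (fun g => T.image (· * g)) T.card E
    (fun a _ => by rw [hcnt]; exact Finset.card_filter_le _ _)
  have hPhiE : auxPhi Ω nm E = Ω.card * Real.log Ω.card := by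
    unfold auxPhi
    rw [Finset.sum_eq_zero, sub_zero]
    intro x hx
    have : auxC Ω nm E x = 1 := by
      unfold auxC
      rw [Finset.card_eq_one]
      refine ⟨x, ?_⟩
      ext y
      simp only [Finset.mem_filter, Finset.mem_singleton]
      exact ⟨fun h => hinj y h.1 x hx h.2, by rintro rfl; exact ⟨hx, fun _ _ => rfl⟩⟩
    simp [this]
  have hbd : ∑ a ∈ E, ((T.card : ℝ) - (E.filter (fun g => a ∈ T.image (· * g))).card)
      ≤ ∑ t ∈ T, ((symmDiff E (E.image (t * ·))).card : ℝ) := by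
    have e : ∀ a, ((T.card : ℝ) - (E.filter (fun g => a ∈ T.image (· * g))).card)
        = ∑ t ∈ T, if t⁻¹ * a ∈ E then (0:ℝ) else 1 := by
      intro a
      rw [hcnt, sub_eq_iff_eq_add, Finset.card_eq_sum_ones, Finset.card_eq_sum_ones, Nat.cast_sum,
        Nat.cast_sum, Finset.sum_filter, ← Finset.sum_add_distrib]
      refine Finset.sum_congr rfl fun t _ => by split_ifs <;> simp
    simp_rw [e]
    rw [Finset.sum_comm]
    refine Finset.sum_le_sum fun t _ => ?_
    have : ∀ a, (if t⁻¹ * a ∈ E then (0:ℝ) else 1) = if t⁻¹ * a ∉ E then (1:ℝ) else 0 := by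
      intro a; split_ifs <;> simp_all
    simp_rw [this]
    rw [Finset.sum_boole]
    norm_cast
    apply Finset.card_le_card
    intro a ha
    simp only [Finset.mem_filter] at ha
    rw [Finset.mem_symmDiff]
    left
    refine ⟨ha.1, fun h => ha.2 ?_⟩
    obtain ⟨b, hb, rfl⟩ := Finset.mem_image.1 h
    simpa using hb
  have hmain : ∑ g ∈ E, auxPhi Ω nm (T.image (· * g) ∩ E) ≤ Ω.card * (E.card *
      ∑ f : T → Fin k, Real.negMulLog
      ((∑ x ∈ Ω, ((E.filter (fun g => ∀ t : T, α ((t : G) • g • x) = f t)).card : ℝ) / E.card)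
        / Ω.card)) := by
    calc _ ≤ ∑ g ∈ E, auxPhi Ω nm (T.image (· * g)) :=
          Finset.sum_le_sum fun g _ => auxPhi_mono _ _ _ _ Finset.inter_subset_left
      _ = ∑ g ∈ E, (Ω.card * ∑ f : T → Fin k, Real.negMulLog
          (((Ω.filter (fun x => (fun t : T => α ((t : G) • g • x)) = f)).card : ℝ) / Ω.card)) := by
          refine Finset.sum_congr rfl fun g _ => ?_
          apply auxPhi_eq Ω hΩ nm _ (fun x => (fun t : T => α ((t : G) • g • x)))
          intro x y
          simp only [funext_iff, hnm, Finset.forall_mem_image, mul_smul, Subtype.forall]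
      _ = Ω.card * ∑ f : T → Fin k, ∑ g ∈ E, Real.negMulLog
          (((Ω.filter (fun x => (fun t : T => α ((t : G) • g • x)) = f)).card : ℝ) / Ω.card) := by
          rw [← Finset.mul_sum, Finset.sum_comm]
      _ ≤ _ := by
          gcongr
          rw [Finset.mul_sum]
          refine Finset.sum_le_sum fun f _ => ?_
          have hj := Real.concaveOn_negMulLog.le_map_sum (t := E) (w := fun _ => (E.card : ℝ)⁻¹)
            (p := fun g => ((Ω.filter (fun x => (fun t : T => α ((t : G) • g • x)) = f)).card : ℝ)
              / Ω.card) (fun _ _ => by positivity)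
            (by simp [hEp.ne']) (fun _ _ => by simp only [Set.mem_Ici]; positivity)
          simp only [smul_eq_mul, ← Finset.mul_sum] at hj
          have heq : (E.card : ℝ)⁻¹ * ∑ g ∈ E,
              ((Ω.filter (fun x => (fun t : T => α ((t : G) • g • x)) = f)).card : ℝ) / Ω.card
              = (∑ x ∈ Ω, ((E.filter (fun g => ∀ t : T, α ((t : G) • g • x) = f t)).card : ℝ)
                / E.card) / Ω.card := by
            rw [← Finset.sum_div, ← Finset.sum_div]
            have : ∑ g ∈ E,
              ((Ω.filter (fun x => (fun t : T => α ((t : G) • g • x)) = f)).card : ℝ)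
              = ∑ x ∈ Ω, ((E.filter (fun g => ∀ t : T, α ((t : G) • g • x) = f t)).card : ℝ) := by
              norm_cast
              simp only [Finset.card_filter, funext_iff]
              exact Finset.sum_comm
            rw [this]; ring
          rw [heq] at hj
          rw [← inv_mul_le_iff₀ hEp]
          exact hj
  rw [hPhiE] at hsh
  have hfin : (Ω.card : ℝ) * ((T.card : ℝ) * Real.log Ω.card) ≤ Ω.card * (E.card *
      ∑ f : T → Fin k, Real.negMulLog
      ((∑ x ∈ Ω, ((E.filter (fun g => ∀ t : T, α ((t : G) • g • x) = f t)).card : ℝ) / E.card)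
        / Ω.card) + k * ∑ t ∈ T, ((symmDiff E (E.image (t * ·))).card : ℝ)) := by
    have := mul_le_mul_of_nonneg_left hbd (show (0:ℝ) ≤ Ω.card * k by positivity)
    linarith
  exact le_of_mul_le_mul_left hfin hN

lemma aux_frontier_inter {X : Type*} [TopologicalSpace X] [MeasurableSpace X] (μ : Measure X)
    (A B : Set X) (hA : μ (frontier A) = 0) (hB : μ (frontier B) = 0) :
    μ (frontier (A ∩ B)) = 0 := by
  refine measure_mono_null (frontier_inter_subset A B) ?_
  exact measure_union_null (measure_mono_null inter_subset_left hA)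
    (measure_mono_null inter_subset_right hB)

lemma aux_frontier_biInter {X κ : Type*} [TopologicalSpace X] [MeasurableSpace X] (μ : Measure X)
    (s : Finset κ) (A : κ → Set X) (hA : ∀ i ∈ s, μ (frontier (A i)) = 0) :
    μ (frontier (⋂ i ∈ s, A i)) = 0 := by
  classical
  induction s using Finset.induction_on with
  | empty => simp
  | insert a s ha ih =>
    rw [Finset.set_biInter_insert]
    exact aux_frontier_inter μ _ _ (hA a (by simp)) (ih fun i hi => hA i (by simp [hi]))

lemma aux_partition {X : Type*} [MetricSpace X] [CompactSpace X] [MeasurableSpace X] [BorelSpace X]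
    (μ : Measure X) [IsProbabilityMeasure μ] (ε : ℝ) (hε : 0 < ε) :
    ∃ (k : ℕ) (α : X → Fin k), Measurable α ∧ (∀ i, μ (frontier (α ⁻¹' {i})) = 0) ∧
      ∀ x y, α x = α y → dist x y < ε := by
  classical
  have h1 : ∀ x : X, ∃ r ∈ Ioo 0 (ε/2), μ (frontier (Metric.ball x r)) = 0 := by
    intro x
    obtain ⟨r, hr, h⟩ := exists_null_frontier_thickening μ {x} (half_pos hε)
    exact ⟨r, hr, by simpa [Metric.thickening_singleton] using h⟩
  choose r hr hfr using h1
  obtain ⟨t, -, ht⟩ := isCompact_univ.elim_nhds_subcover (fun x => Metric.ball x (r x))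
    (fun x _ => Metric.ball_mem_nhds x (hr x).1)
  set e := t.equivFin
  set B : Fin t.card → Set X := fun i => Metric.ball (e.symm i : X) (r (e.symm i)) with hB
  have hcov : ∀ x, ∃ i, x ∈ B i := by
    intro x
    have := ht (mem_univ x)
    simp only [mem_iUnion] at this
    obtain ⟨y, hy, hxy⟩ := this
    exact ⟨e ⟨y, hy⟩, by simpa [hB] using hxy⟩
  have hmin : ∀ x, ∃ i, x ∈ B i ∧ ∀ j < i, x ∉ B j := by
    intro x
    obtain ⟨i, hi, hm⟩ := WellFounded.has_min (wellFounded_lt (α := Fin t.card))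
      {i | x ∈ B i} (hcov x)
    exact ⟨i, hi, fun j hj hxj => hm j hxj hj⟩
  choose α hα1 hα2 using hmin
  have hpre : ∀ i, α ⁻¹' {i} = B i ∩ ⋂ j ∈ Finset.univ.filter (fun j => j < i), (B j)ᶜ := by
    intro i
    ext x
    simp only [mem_preimage, mem_singleton_iff, mem_inter_iff, mem_iInter, Finset.mem_filter,
      Finset.mem_univ, true_and, mem_compl_iff]
    constructor
    · rintro rfl
      exact ⟨hα1 x, fun j hj => hα2 x j hj⟩
    · rintro ⟨h1, h2⟩
      rcases lt_trichotomy (α x) i with h | h | h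
      · exact absurd (hα1 x) (h2 _ h)
      · exact h
      · exact absurd h1 (hα2 x _ h)
  refine ⟨t.card, α, ?_, ?_, ?_⟩
  · refine measurable_to_countable' fun i => ?_
    rw [hpre]
    refine Metric.isOpen_ball.measurableSet.inter ?_
    exact Finset.measurableSet_biInter _ fun j _ => Metric.isOpen_ball.measurableSet.compl
  · intro i
    rw [hpre]
    refine aux_frontier_inter μ _ _ (hfr _) (aux_frontier_biInter μ _ _ fun j _ => ?_)
    rw [frontier_compl]
    exact hfr _
  · intro x y hxy
    have hx := hα1 x
    have hy := hα1 y
    rw [← hxy] at hy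
    simp only [hB, Metric.mem_ball] at hx hy
    have := (hr (e.symm (α x))).2
    have := dist_triangle_right x y (e.symm (α x) : X)
    linarith

lemma aux_freq {G : Type*} [Group G] [DecidableEq G]
    {X : Type*} [MetricSpace X] [CompactSpace X] [MulAction G X] [ContinuousConstSMul G X]
    [MeasurableSpace X] [BorelSpace X]
    (F : ℕ → Finset G) (hF : ∀ n, (F n).Nonempty) (μ : Measure X) [IsProbabilityMeasure μ]
    (x : X) (hx : x ∈ genericPointSet F μ) (A : Set X) [DecidablePred (· ∈ A)]
    (hA : μ (frontier A) = 0) :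
    Tendsto (fun n => (((F n).filter (fun g => g • x ∈ A)).card : ℝ) / (F n).card) atTop
      (𝓝 (μ A).toReal) := by
  set ν : ℕ → Measure X := fun n => ((F n).card : ℝ≥0∞)⁻¹ • ∑ g ∈ F n, Measure.dirac (g • x)
    with hν
  have hc : ∀ n, ((F n).card : ℝ≥0∞) ≠ 0 := fun n => by
    simpa using (hF n).ne_empty
  have hp : ∀ n, IsProbabilityMeasure (ν n) := by
    intro n
    constructor
    simp only [hν, Measure.smul_apply, Measure.finsetSum_apply, measure_univ, Finset.sum_const,
      nsmul_eq_mul, mul_one, smul_eq_mul]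
    exact ENNReal.inv_mul_cancel (hc n) (by simp)
  set P : ℕ → ProbabilityMeasure X := fun n => ⟨ν n, hp n⟩
  have hconv : Tendsto P atTop (𝓝 (⟨μ, inferInstance⟩ : ProbabilityMeasure X)) := by
    refine ProbabilityMeasure.tendsto_iff_forall_integral_tendsto.2 ?_
    intro f
    have h := hx f.toContinuousMap
    refine h.congr fun n => ?_
    change _ = ∫ y, f y ∂(ν n)
    rw [hν, integral_smul_measure, integral_finsetSum_measure]
    · simp [integral_dirac, div_eq_inv_mul]
    · intro g _
      exact BoundedContinuousFunction.integrable _ f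
  have h := ProbabilityMeasure.tendsto_measure_of_null_frontier_of_tendsto' hconv (E := A) hA
  have h' := (ENNReal.tendsto_toReal (measure_ne_top μ A)).comp h
  refine h'.congr fun n => ?_
  change (ν n A).toReal = _
  simp only [hν, Measure.smul_apply, Measure.finsetSum_apply, Measure.dirac_apply, smul_eq_mul,
    indicator_apply, Pi.one_apply, Finset.sum_boole, ENNReal.toReal_mul, ENNReal.toReal_inv,
    ENNReal.toReal_natCast, div_eq_inv_mul]

lemma aux_reps {X S : Type*} [Finite S] (W : Set X) (κ : X → S) :
    ∃ Ω : Finset X, (↑Ω ⊆ W) ∧ (∀ x ∈ Ω, ∀ y ∈ Ω, κ x = κ y → x = y) ∧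
      ∀ x ∈ W, ∃ y ∈ Ω, κ y = κ x := by
  obtain ⟨s, hs, hb⟩ := exists_subset_bijOn W κ
  have hfin : s.Finite := Set.Finite.of_finite_image (Set.toFinite _) hb.injOn
  refine ⟨hfin.toFinset, by simpa using hs, ?_, ?_⟩
  · intro x hx y hy h
    exact hb.injOn (by simpa using hx) (by simpa using hy) h
  · intro x hx
    obtain ⟨y, hy, h⟩ := hb.surjOn (mem_image_of_mem κ hx)
    exact ⟨y, by simpa using hy, h⟩

/-- points whose `T`-block frequencies along `E` are `δ`-close to those of `μ`. -/
def auxGood {G : Type*} [Group G] [DecidableEq G] {X : Type*} [MulAction G X] [MeasurableSpace X]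
    (μ : Measure X) {k : ℕ} (α : X → Fin k) (T E : Finset G) (δ : ℝ) : Set X :=
  {x | ∀ f : T → Fin k,
    |((E.filter (fun g => ∀ t : T, α ((t : G) • g • x) = f t)).card : ℝ) / E.card
      - (μ {x | ∀ g : T, α ((g : G) • x) = f g}).toReal| < δ}

lemma aux_good_eventually {G : Type*} [Group G] [DecidableEq G]
    {X : Type*} [MetricSpace X] [CompactSpace X] [MulAction G X] [ContinuousConstSMul G X]
    [MeasurableSpace X] [BorelSpace X]
    (F : ℕ → Finset G) (hF : ∀ n, (F n).Nonempty) (μ : Measure X) [IsProbabilityMeasure μ]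
    (hinv : InvariantMeasure G μ)
    (x : X) (hx : x ∈ genericPointSet F μ) {k : ℕ} (α : X → Fin k)
    (hα : ∀ i, μ (frontier (α ⁻¹' {i})) = 0) (T : Finset G) (δ : ℝ) (hδ : 0 < δ) :
    ∀ᶠ n in atTop, x ∈ auxGood μ α T (F n) δ := by
  refine eventually_all.2 fun f => ?_
  have hA : μ (frontier {x | ∀ g : T, α ((g : G) • x) = f g}) = 0 := by
    have : {x | ∀ g : T, α ((g : G) • x) = f g} =
        ⋂ g ∈ (Finset.univ : Finset T), (fun x : X => (g : G) • x) ⁻¹' (α ⁻¹' {f g}) := by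
      ext x; simp
    rw [this]
    refine aux_frontier_biInter μ _ _ fun g _ => ?_
    have h1 : frontier ((fun x : X => (g : G) • x) ⁻¹' (α ⁻¹' {f g}))
        = (fun x : X => (g : G) • x) ⁻¹' frontier (α ⁻¹' {f g}) :=
      ((Homeomorph.smul (g : G)).preimage_frontier _).symm
    rw [h1, ← Measure.map_apply (continuous_const_smul (g : G)).measurable
      isClosed_frontier.measurableSet, hinv g]
    exact hα _
  have h := aux_freq F hF μ x hx {x | ∀ g : T, α ((g : G) • x) = f g} hA
  filter_upwards [Metric.tendsto_nhds.1 h δ hδ] with n hn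
  rw [Real.dist_eq] at hn
  exact hn

lemma aux_modulus {S : Type*} [Fintype S] (p : S → ℝ) (ζ : ℝ) (hζ : 0 < ζ) :
    ∃ δ > 0, ∀ q : S → ℝ, (∀ f, |q f - p f| ≤ δ) →
      ∑ f, Real.negMulLog (q f) ≤ ∑ f, Real.negMulLog (p f) + ζ := by
  have hcont : Continuous fun q : S → ℝ => ∑ f, Real.negMulLog (q f) :=
    continuous_finsetSum _ fun f _ => Real.continuous_negMulLog.comp (continuous_apply f)
  obtain ⟨δ, hδ, h⟩ := Metric.continuous_iff.1 hcont p ζ hζ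
  refine ⟨δ / 2, half_pos hδ, fun q hq => ?_⟩
  have h1 := h q (lt_of_le_of_lt ((dist_pi_le_iff (half_pos hδ).le).2
    fun f => by rw [Real.dist_eq]; exact hq f) (half_lt_self hδ))
  rw [Real.dist_eq] at h1
  linarith [(abs_lt.1 h1).2]

/-- Counting: few names are good. -/
lemma aux_count_good {G : Type*} [Group G] [DecidableEq G]
    {X : Type*} [MulAction G X] [MeasurableSpace X]
    (F : ℕ → Finset G) (hFol : IsFolnerSeq F) (μ : Measure X) {k : ℕ} (α : X → Fin k)
    (T : Finset G) (hT : T.Nonempty) (r : ℝ) (hr : partitionEntropy μ α T / T.card < r) :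
    ∃ δ > 0, ∀ᶠ n in atTop, ∀ Ω : Finset X, (↑Ω ⊆ auxGood μ α T (F n) δ) →
      (∀ x ∈ Ω, ∀ y ∈ Ω, (∀ g ∈ F n, α (g • x) = α (g • y)) → x = y) →
      (Ω.card : ℝ) ≤ Real.exp (r * (F n).card) := by
  have hTp : (0:ℝ) < T.card := by exact_mod_cast hT.card_pos
  rw [div_lt_iff₀ hTp] at hr
  set ζ := (r * T.card - partitionEntropy μ α T) / 2 with hζ
  have hζp : 0 < ζ := by rw [hζ]; linarith
  obtain ⟨δ, hδ, hmod⟩ := aux_modulus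
    (fun f : T → Fin k => (μ {x | ∀ g : T, α ((g : G) • x) = f g}).toReal) ζ hζp
  refine ⟨δ, hδ, ?_⟩
  have hlim : Tendsto (fun n => (k : ℝ) * ∑ t ∈ T,
      ((symmDiff (F n) ((F n).image (t * ·))).card : ℝ) / (F n).card) atTop (𝓝 0) := by
    have : Tendsto (fun n => (k : ℝ) * ∑ t ∈ T,
      ((symmDiff (F n) ((F n).image (t * ·))).card : ℝ) / (F n).card) atTop
        (𝓝 ((k : ℝ) * ∑ t ∈ T, 0)) :=
      (tendsto_finsetSum _ fun t _ => hFol.2 t).const_mul _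
    simpa using this
  filter_upwards [hlim.eventually (gt_mem_nhds hζp)] with n hn Ω hΩ hinj
  rcases Ω.eq_empty_or_nonempty with rfl | hne
  · simp [Real.exp_nonneg]
  have hN : (0:ℝ) < Ω.card := by exact_mod_cast hne.card_pos
  have hEp : (0:ℝ) < (F n).card := by exact_mod_cast (hFol.1 n).card_pos
  have h1 := aux_count α Ω hne T (F n) (hFol.1 n) hinj
  have h2 := hmod (fun f => (∑ x ∈ Ω, (((F n).filter
      (fun g => ∀ t : T, α ((t : G) • g • x) = f t)).card : ℝ) / (F n).card) / Ω.card) (by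
    intro f
    rw [div_sub' hN.ne', abs_div, abs_of_pos hN, div_le_iff₀ hN, mul_comm δ,
      ← nsmul_eq_mul, ← nsmul_eq_mul, ← Finset.sum_const, ← Finset.sum_const,
      ← Finset.sum_sub_distrib]
    refine (Finset.abs_sum_le_sum_abs _ _).trans (Finset.sum_le_sum fun x hx => ?_)
    exact (hΩ hx f).le)
  rw [← Finset.sum_div, ← mul_div_assoc, div_lt_iff₀ hEp] at hn
  change _ ≤ partitionEntropy μ α T + ζ at h2
  have h3 := mul_le_mul_of_nonneg_left h2 hEp.le
  have h4 : (T.card : ℝ) * Real.log Ω.card ≤ T.card * (r * (F n).card) := by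
    refine h1.trans ((add_le_add h3 hn.le).trans (le_of_eq ?_))
    rw [hζ]; ring
  have h5 := le_of_mul_le_mul_left h4 hTp
  rwa [← Real.log_le_iff_le_exp hN]

lemma aux_card_tendsto {G : Type*} (F : ℕ → Finset G) (hGrow : GrowthCond F) :
    Tendsto (fun n => ((F n).card : ℝ)) atTop atTop := by
  refine tendsto_atTop_mono' atTop ?_
    (Real.tendsto_log_atTop.comp (tendsto_natCast_atTop_atTop (R := ℝ)))
  filter_upwards [hGrow.eventually_ge_atTop 1, eventually_ge_atTop 2] with n h1 h2
  have : 0 < Real.log n := Real.log_pos (by exact_mod_cast h2)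
  simpa using (le_div_iff₀ this).1 h1

lemma aux_mpre_le_one {G : Type*} [Group G] [DecidableEq G]
    {X : Type*} [MetricSpace X] [CompactSpace X] [MulAction G X] [ContinuousConstSMul G X]
    [MeasurableSpace X] [BorelSpace X]
    (F : ℕ → Finset G) (hFol : IsFolnerSeq F) (hGrow : GrowthCond F)
    (μ : Measure X) [IsProbabilityMeasure μ] (hinv : InvariantMeasure G μ)
    (r s : ℝ) (hrs : r < s) (hr : measEntropy F μ < ENNReal.ofReal r) (N : ℕ) (ε : ℝ)
    (hε : 0 < ε) : bowenMpre F (genericPointSet F μ) N ε s ≤ 1 := by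
  have hr0 : 0 < r := ENNReal.ofReal_pos.1 (lt_of_le_of_lt zero_le hr)
  obtain ⟨k, α, hαm, hαf, hαd⟩ := aux_partition μ ε hε
  have hlim : limsup (fun n => ENNReal.ofReal (partitionEntropy μ α (F n) / (F n).card)) atTop
      < ENNReal.ofReal r := by
    refine lt_of_le_of_lt ?_ hr
    exact le_iSup_of_le k (le_iSup_of_le α (le_iSup_of_le hαm le_rfl))
  obtain ⟨m, hm⟩ := (eventually_lt_of_limsup_lt hlim).exists
  have hm' : partitionEntropy μ α (F m) / (F m).card < r :=
    (ENNReal.ofReal_lt_ofReal_iff hr0).1 hm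
  obtain ⟨δ, hδ, hcount⟩ := aux_count_good F hFol μ α (F m) (hFol.1 m) r hm'
  have hexp : Tendsto (fun n => Real.exp (-(s - r) * ((F n).card : ℝ))) atTop (𝓝 0) := by
    refine Real.tendsto_exp_atBot.comp ?_
    exact (aux_card_tendsto F hGrow).const_mul_atTop_of_neg (by linarith)
  have hn : ∀ j : ℕ, ∃ n, j ≤ n ∧ N ≤ n ∧ Real.exp (-(s - r) * ((F n).card : ℝ)) < (1/2)^(j+1) ∧
      ∀ Ω : Finset X, (↑Ω ⊆ auxGood μ α (F m) (F n) δ) →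
      (∀ x ∈ Ω, ∀ y ∈ Ω, (∀ g ∈ F n, α (g • x) = α (g • y)) → x = y) →
      (Ω.card : ℝ) ≤ Real.exp (r * (F n).card) := by
    intro j
    have h1 := hexp.eventually (gt_mem_nhds (show (0:ℝ) < (1/2)^(j+1) by positivity))
    obtain ⟨n, h⟩ := ((eventually_ge_atTop j).and ((eventually_ge_atTop N).and
      (h1.and hcount))).exists
    exact ⟨n, h⟩
  choose n hnj hnN hnexp hnc using hn
  have hrep : ∀ j : ℕ, ∃ Ω : Finset X, (↑Ω ⊆ auxGood μ α (F m) (F (n j)) δ) ∧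
      (∀ x ∈ Ω, ∀ y ∈ Ω, (∀ g ∈ F (n j), α (g • x) = α (g • y)) → x = y) ∧
      ∀ x ∈ auxGood μ α (F m) (F (n j)) δ, ∃ y ∈ Ω, ∀ g ∈ F (n j), α (g • y) = α (g • x) := by
    intro j
    obtain ⟨Ω, h1, h2, h3⟩ := aux_reps (auxGood μ α (F m) (F (n j)) δ)
      (fun x => fun g : F (n j) => α ((g : G) • x))
    refine ⟨Ω, h1, fun x hx y hy h => h2 x hx y hy (funext fun g => h g g.2), fun x hx => ?_⟩
    obtain ⟨y, hy, h⟩ := h3 x hx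
    exact ⟨y, hy, fun g hg => congrFun h ⟨g, hg⟩⟩
  choose Ω hΩ1 hΩ2 hΩ3 using hrep
  set D : ℕ → Set (X × ℕ) := fun j => (fun x => (x, n j)) '' (Ω j : Set X) with hD
  have hsum : ∀ j, ∑' p : D j, ENNReal.ofReal (Real.exp (-s * ((F (p : X × ℕ).2).card : ℝ)))
      ≤ ENNReal.ofReal ((1/2)^(j+1)) := by
    intro j
    have hinjp : InjOn (fun x : X => (x, n j)) (Ω j : Set X) :=
      fun x _ y _ h => (Prod.mk.inj h).1
    rw [hD, tsum_image (fun p : X × ℕ => ENNReal.ofReal (Real.exp (-s * ((F p.2).card : ℝ)))) hinjp]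
    rw [Finset.tsum_subtype' (Ω j)
      (fun _ => ENNReal.ofReal (Real.exp (-s * ((F (n j)).card : ℝ)))), Finset.sum_const,
      nsmul_eq_mul, ← ENNReal.ofReal_natCast, ← ENNReal.ofReal_mul (by positivity)]
    apply ENNReal.ofReal_le_ofReal
    calc ((Ω j).card : ℝ) * Real.exp (-s * ((F (n j)).card : ℝ))
        ≤ Real.exp (r * (F (n j)).card) * Real.exp (-s * ((F (n j)).card : ℝ)) := by
          gcongr
          exact hnc j (Ω j) (hΩ1 j) (hΩ2 j)
      _ = Real.exp (-(s - r) * ((F (n j)).card : ℝ)) := by rw [← Real.exp_add]; congr 1; ring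
      _ ≤ _ := (hnexp j).le
  refine le_trans (iInf₂_le (⋃ j, D j) ⟨?_, ?_, ?_⟩) ?_
  · refine (ENNReal.tsum_iUnion_le_tsum
      (fun p : X × ℕ => ENNReal.ofReal (Real.exp (-s * ((F p.2).card : ℝ)))) D).trans ?_
    refine (ENNReal.tsum_le_tsum hsum).trans ?_
    rw [← ENNReal.ofReal_tsum_of_nonneg (fun j => by positivity)
      ((summable_nat_add_iff 1).2 summable_geometric_two)]
    have : ∑' j : ℕ, ((1:ℝ)/2)^(j+1) = 1 := by
      simp_rw [pow_succ]
      rw [tsum_mul_right, tsum_geometric_two]; norm_num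
    rw [this]; simp
  · exact countable_iUnion fun j => ((Ω j).countable_toSet.image _)
  · intro p hp
    obtain ⟨j, x, hx, rfl⟩ := mem_iUnion.1 hp
    exact hnN j
  · intro x hx
    obtain ⟨j, hj⟩ := eventually_atTop.1
      (aux_good_eventually F hFol.1 μ hinv x hx α hαf (F m) δ hδ)
    obtain ⟨y, hy, h⟩ := hΩ3 j x (hj (n j) (hnj j))
    refine mem_iUnion₂.2 ⟨(y, n j), mem_iUnion.2 ⟨j, y, hy, rfl⟩, ?_⟩
    exact fun g hg => hαd _ _ (h g hg)

variable {G : Type*} [Group G] [Countable G] [Infinite G] [DecidableEq G]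
  {X : Type*} [MetricSpace X] [CompactSpace X] [MulAction G X] [ContinuousConstSMul G X]
  [MeasurableSpace X] [BorelSpace X]

theorem bowenEntropy_genericPoints_le_measEntropy
    (F : ℕ → Finset G) (hFol : IsFolnerSeq F) (hGrow : GrowthCond F)
    (μ : Measure X) [IsProbabilityMeasure μ] (hinv : InvariantMeasure G μ)
    (herg : ErgodicMeasure G μ) :
    bowenEntropy F (genericPointSet F μ) ≤ measEntropy F μ := by
  refine iSup₂_le fun s hs => ?_
  by_contra hlt
  push Not at hlt
  obtain ⟨r', h1, h2⟩ := exists_between hlt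
  have hne : r' ≠ ⊤ := (h2.trans ENNReal.ofReal_lt_top).ne
  rw [← ENNReal.ofReal_toReal hne] at h1 h2
  have hs0 : 0 < s := ENNReal.ofReal_pos.1 (lt_of_le_of_lt zero_le h2)
  have hrs : r'.toReal < s := (ENNReal.ofReal_lt_ofReal_iff hs0).1 h2
  have hle : bowenMeasure F (genericPointSet F μ) s ≤ 1 :=
    iSup₂_le fun ε hε => iSup_le fun N =>
      aux_mpre_le_one F hFol hGrow μ hinv r'.toReal s hrs h1 N ε hε
  rw [hs] at hle
  exact absurd hle (by simp)
end
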